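/- arXiv:2505.01987 — 4 statements merged into one kernel-verified Lean document; each statement's English description precedes it below -/
import Mathlib

section
/- Let X_1, X_2, ... satisfy Assumption 1 and Assumption 2, and let α = α_{1,n} + α_{2,n} with α_{1,n} = Ω(1/log n) and α_{2,n} → α. With λ_{i,α_{2,n}} := min( sqrt( 2 log(1/α_{2,n}) / (m̂²_{4,i} · n) ), c_1 ), λ̃_{k,α_{1,n}} := min( sqrt( 2 log(2/α_{1,n}) / (σ̂_k² · k · log(1+k)) ), c_5 ), and R̃_{i,α_{1,n}} := (log(2/α_{1,n}) + σ² Σ_{k=1}^{i−1} ψ_P(λ̃_{k,α_{1,n}}))/(Σ_{k=1}^{i−1} λ̃_{k,α_{1,n}}) for i ≥ 2 (and R̃_{1,α_{1,n}} := 1/2), it holds that √n · ( Σ_{i≤n} λ_{i,α_{2,n}} R̃²_{i,α_{1,n}} ) / ( Σ_{i≤n} λ_{i,α_{2,n}} ) → 0 almost surely as n → ∞. -/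
open MeasureTheory ProbabilityTheory Filter Finset

/-- `ψ_P(λ) := exp(λ) − λ − 1`. -/
noncomputable def psiP (l : ℝ) : ℝ := Real.exp l - l - 1

variable {Ω : Type*}

/-- `μ̂_t := (c₄ + Σ_{i≤t−1} X_i)/t`. -/
noncomputable def muHat (c4 : ℝ) (X : ℕ → Ω → ℝ) (t : ℕ) (ω : Ω) : ℝ :=
  (c4 + ∑ i ∈ Finset.Icc 1 (t-1), X i ω) / (t : ℝ)

/-- `σ̂_t² := (c₃ + Σ_{i≤t−1}(X_i − μ̂_i)²)/t`. -/
noncomputable def sigHat2 (c3 c4 : ℝ) (X : ℕ → Ω → ℝ) (t : ℕ) (ω : Ω) : ℝ :=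
  (c3 + ∑ i ∈ Finset.Icc 1 (t-1), (X i ω - muHat c4 X i ω)^2) / (t : ℝ)

/-- `m̂²_{4,t} := (c₂ + Σ_{i≤t−1} [(X_i − μ̂_i)² − σ̂_i²]²)/t`. -/
noncomputable def m4Hat2 (c2 c3 c4 : ℝ) (X : ℕ → Ω → ℝ) (t : ℕ) (ω : Ω) : ℝ :=
  (c2 + ∑ i ∈ Finset.Icc 1 (t-1),
      ((X i ω - muHat c4 X i ω)^2 - sigHat2 c3 c4 X i ω)^2) / (t : ℝ)

/-- Batch plug-in `λ_{i,d} := min(√(2 log(1/d)/(m̂²_{4,i} n)), c₁)`. -/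
noncomputable def lamB (c1 c2 c3 c4 : ℝ) (X : ℕ → Ω → ℝ) (d : ℝ) (n i : ℕ) (ω : Ω) : ℝ :=
  min (Real.sqrt (2 * Real.log (1/d) / (m4Hat2 c2 c3 c4 X i ω * (n : ℝ)))) c1

/-- Bennett plug-in `λ̃_{k,a₁} := min(√(2 log(2/a₁)/(σ̂_k² k log(1+k))), c₅)`. -/
noncomputable def lamT (c3 c4 c5 : ℝ) (X : ℕ → Ω → ℝ) (a1 : ℝ) (k : ℕ) (ω : Ω) : ℝ :=
  min (Real.sqrt (2 * Real.log (2/a1) /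
      (sigHat2 c3 c4 X k ω * (k : ℝ) * Real.log (1 + (k : ℝ))))) c5

/-- Bennett radius `R̃_{i,a₁}`, with `R̃_{1,a₁} := 1/2`. -/
noncomputable def Rtilde (c3 c4 c5 σ2 : ℝ) (X : ℕ → Ω → ℝ) (a1 : ℝ) (i : ℕ) (ω : Ω) : ℝ :=
  if i = 1 then 1/2
  else (Real.log (2/a1) + σ2 * ∑ k ∈ Finset.Icc 1 (i-1), psiP (lamT c3 c4 c5 X a1 k ω)) /
        (∑ k ∈ Finset.Icc 1 (i-1), lamT c3 c4 c5 X a1 k ω)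

lemma aux_pullout {m0 : MeasurableSpace Ω} (P : Measure Ω) [IsProbabilityMeasure P]
    (m : MeasurableSpace Ω) (hm : m ≤ m0) (W g : Ω → ℝ) (C v : ℝ)
    (hW : StronglyMeasurable[m] W) (hWb : ∀ᵐ ω ∂P, ‖W ω‖ ≤ C) (hg : Integrable g P)
    (hv : P[g|m] =ᵐ[P] fun _ => v) :
    ∫ ω, W ω * g ω ∂P = v * ∫ ω, W ω ∂P := by
  have h1 := condExp_stronglyMeasurable_mul_of_bound hm hW hg C hWb
  have h2 : ∫ ω, (P[W * g|m]) ω ∂P = ∫ ω, (W * g) ω ∂P := integral_condExp hm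
  have h3 : ∫ ω, W ω * g ω ∂P = ∫ ω, (W * g) ω ∂P := rfl
  rw [h3, ← h2, ← integral_const_mul]
  apply integral_congr_ae
  filter_upwards [h1, hv] with ω a b
  rw [a, Pi.mul_apply, b, mul_comm]

lemma aux_muHat_mem (c4 : ℝ) (hc4 : c4 ∈ Set.Icc (0:ℝ) 1) (X : ℕ → Ω → ℝ) (ω : Ω)
    (hX : ∀ t, 1 ≤ t → X t ω ∈ Set.Icc (0:ℝ) 1) (t : ℕ) (ht : 1 ≤ t) :
    muHat c4 X t ω ∈ Set.Icc (0:ℝ) 1 := by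
  have ht' : (0:ℝ) < t := by exact_mod_cast ht
  have h0 : 0 ≤ ∑ i ∈ Finset.Icc 1 (t-1), X i ω :=
    Finset.sum_nonneg fun i hi => (hX i (Finset.mem_Icc.1 hi).1).1
  have h1 : ∑ i ∈ Finset.Icc 1 (t-1), X i ω ≤ ((t:ℝ) - 1) := by
    calc _ ≤ ∑ i ∈ Finset.Icc 1 (t-1), (1:ℝ) :=
          Finset.sum_le_sum fun i hi => (hX i (Finset.mem_Icc.1 hi).1).2
      _ = (t:ℝ) - 1 := by simp [Nat.cast_sub ht]
  unfold muHat
  constructor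
  · exact div_nonneg (add_nonneg hc4.1 h0) ht'.le
  · rw [div_le_one ht']; linarith [hc4.2]

/-- partial sums of squared residuals -/
noncomputable def auxT (c4 : ℝ) (X : ℕ → Ω → ℝ) (t : ℕ) (ω : Ω) : ℝ :=
  ∑ i ∈ Finset.Icc 1 t, (X i ω - muHat c4 X i ω)^2

lemma aux_exp_bound {m0 : MeasurableSpace Ω} (P : Measure Ω) [IsProbabilityMeasure P]
    (ℱ : Filtration ℕ m0) (X : ℕ → Ω → ℝ) (μ σ2 : ℝ) (c4 : ℝ)
    (hc4 : c4 ∈ Set.Icc (0:ℝ) 1)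
    (hadapt : Adapted ℱ X)
    (hint : ∀ t, 1 ≤ t → Integrable (X t) P)
    (hbdd : ∀ t, 1 ≤ t → ∀ᵐ ω ∂P, X t ω ∈ Set.Icc (0:ℝ) 1)
    (hmean : ∀ t, 1 ≤ t → P[X t|ℱ (t - 1)] =ᵐ[P] fun _ => μ)
    (hvar : ∀ t, 1 ≤ t → P[(fun ω => (X t ω - μ)^2)|ℱ (t - 1)] =ᵐ[P] fun _ => σ2) (t : ℕ) :
    Integrable (fun ω => Real.exp (-auxT c4 X t ω)) P ∧
    ∫ ω, Real.exp (-auxT c4 X t ω) ∂P ≤ Real.exp (-((1 - Real.exp (-1)) * σ2) * t) := by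
  have hall : ∀ᵐ ω ∂P, ∀ t, 1 ≤ t → X t ω ∈ Set.Icc (0:ℝ) 1 := by
    rw [ae_all_iff]; intro t
    by_cases ht : 1 ≤ t
    · filter_upwards [hbdd t ht] with ω h _ using h
    · exact Eventually.of_forall fun ω h => absurd h ht
  have hmeasX : ∀ s i, i ≤ s → Measurable[ℱ s] (X i) := fun s i h =>
    (hadapt i).mono (ℱ.mono h) le_rfl
  have hmeasmu : ∀ s i, i ≤ s + 1 → Measurable[ℱ s] (muHat c4 X i) := by
    intro s i h
    unfold muHat
    apply Measurable.div_const
    apply Measurable.const_add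
    refine Finset.measurable_sum _ fun j hj => hmeasX s j ?_
    have := (Finset.mem_Icc.1 hj).2
    omega
  have hmeasT : ∀ s, Measurable[ℱ s] (auxT c4 X s) := by
    intro s
    unfold auxT
    refine Finset.measurable_sum _ fun j hj => ?_
    have := (Finset.mem_Icc.1 hj).2
    exact ((hmeasX s j this).sub (hmeasmu s j (by omega))).pow_const 2
  have hmeasZ : ∀ s, Measurable[ℱ s] (fun ω => Real.exp (-auxT c4 X s ω)) := fun s =>
    Real.measurable_exp.comp (hmeasT s).neg
  have hTnn : ∀ s ω, 0 ≤ auxT c4 X s ω := fun s ω => Finset.sum_nonneg fun _ _ => sq_nonneg _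
  have hZle : ∀ s ω, Real.exp (-auxT c4 X s ω) ≤ 1 := fun s ω =>
    Real.exp_le_one_iff.2 (neg_nonpos.2 (hTnn s ω))
  have hZb : ∀ s, ∀ᵐ ω ∂P, ‖Real.exp (-auxT c4 X s ω)‖ ≤ 1 := fun s =>
    Eventually.of_forall fun ω => by
      rw [Real.norm_eq_abs, abs_of_pos (Real.exp_pos _)]; exact hZle s ω
  have hZint : ∀ s, Integrable (fun ω => Real.exp (-auxT c4 X s ω)) P := fun s =>
    Integrable.of_bound (((hmeasZ s).mono (ℱ.le s) le_rfl).aestronglyMeasurable) 1 (hZb s)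
  refine ⟨hZint t, ?_⟩
  induction t with
  | zero => simp [auxT]
  | succ t ih =>
    set Z : Ω → ℝ := fun ω => Real.exp (-auxT c4 X t ω) with hZ
    set M : Ω → ℝ := muHat c4 X (t+1) with hM
    have hMm : Measurable[ℱ t] M := hmeasmu t (t+1) le_rfl
    have hXm : Measurable (X (t+1)) := (hadapt (t+1)).mono (ℱ.le _) le_rfl
    have hMm' : Measurable M := hMm.mono (ℱ.le _) le_rfl
    have hZm' : Measurable Z := (hmeasZ t).mono (ℱ.le _) le_rfl
    -- bounds
    have hmu : μ ∈ Set.Icc (0:ℝ) 1 := by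
      have e : ∫ ω, X (t+1) ω ∂P = μ := by
        rw [← integral_condExp (ℱ.le (t+1-1)), integral_congr_ae (hmean (t+1) (by omega))]; simp
      rw [← e]
      constructor
      · exact integral_nonneg_of_ae (by filter_upwards [hall] with ω h using (h _ (by omega)).1)
      · calc ∫ ω, X (t+1) ω ∂P ≤ ∫ ω, (1:ℝ) ∂P := integral_mono_ae (hint _ (by omega))
              (integrable_const _) (by filter_upwards [hall] with ω h using (h _ (by omega)).2)
          _ = 1 := by simp
    have hXμ : ∀ᵐ ω ∂P, |X (t+1) ω - μ| ≤ 1 := by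
      filter_upwards [hall] with ω h
      have := h (t+1) (by omega)
      rw [abs_le]; constructor <;> linarith [this.1, this.2, hmu.1, hmu.2]
    have hMμ : ∀ᵐ ω ∂P, |μ - M ω| ≤ 1 := by
      filter_upwards [hall] with ω h
      have := aux_muHat_mem c4 hc4 X ω h (t+1) (by omega)
      rw [abs_le]; constructor <;> linarith [this.1, this.2, hmu.1, hmu.2]
    have i1 : Integrable (fun ω => X (t+1) ω - μ) P := (hint _ (by omega)).sub (integrable_const _)
    have i2 : Integrable (fun ω => (X (t+1) ω - μ)^2) P :=
      Integrable.of_bound ((hXm.sub_const _).pow_const 2).aestronglyMeasurable 1 (by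
        filter_upwards [hXμ] with ω h
        rw [Real.norm_eq_abs, abs_pow]; exact pow_le_one₀ (abs_nonneg _) h)
    have ce1 : P[(fun ω => X (t+1) ω - μ)|ℱ t] =ᵐ[P] fun _ => (0:ℝ) := by
      have h1 := condExp_sub (hint (t+1) (by omega)) (integrable_const (μ := P) μ) (ℱ t)
      have h2 := hmean (t+1) (by omega)
      simp only [Nat.add_sub_cancel] at h2
      have h3 : P[(fun _ : Ω => μ)|ℱ t] = fun _ => μ := condExp_const (ℱ.le t) μ
      refine EventuallyEq.trans (show _ =ᵐ[P] _ from h1) ?_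
      filter_upwards [h2] with ω h
      rw [Pi.sub_apply, h, h3]; simp
    have p2 : ∫ ω, Z ω * (X (t+1) ω - μ)^2 ∂P = σ2 * ∫ ω, Z ω ∂P :=
      aux_pullout P (ℱ t) (ℱ.le t) Z _ 1 σ2 (hmeasZ t).stronglyMeasurable (hZb t) i2
        (hvar (t+1) (by omega))
    have hWb : ∀ᵐ ω ∂P, ‖Z ω * (μ - M ω)‖ ≤ 1 := by
      filter_upwards [hZb t, hMμ] with ω h1 h2
      rw [norm_mul]
      exact mul_le_one₀ h1 (norm_nonneg _) h2
    have p1 : ∫ ω, (Z ω * (μ - M ω)) * (X (t+1) ω - μ) ∂P = 0 * ∫ ω, Z ω * (μ - M ω) ∂P :=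
      aux_pullout P (ℱ t) (ℱ.le t) (fun ω => Z ω * (μ - M ω)) _ 1 0
        ((hmeasZ t).mul (hMm.const_sub μ)).stronglyMeasurable hWb i1 ce1
    rw [zero_mul] at p1
    have I2 : Integrable (fun ω => Z ω * (X (t+1) ω - μ)^2) P :=
      i2.bdd_mul hZm'.aestronglyMeasurable (hZb t)
    have I1 : Integrable (fun ω => (Z ω * (μ - M ω)) * (X (t+1) ω - μ)) P :=
      i1.bdd_mul (hZm'.mul (hMm'.const_sub μ)).aestronglyMeasurable hWb
    set c : ℝ := 1 - Real.exp (-1) with hc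
    have hcpos : 0 ≤ c := by
      have : Real.exp (-1) ≤ 1 := Real.exp_le_one_iff.2 (by norm_num)
      linarith
    have hstep : ∀ᵐ ω ∂P, Real.exp (-auxT c4 X (t+1) ω) ≤
        Z ω - c * (Z ω * (X (t+1) ω - μ)^2 + 2 * ((Z ω * (μ - M ω)) * (X (t+1) ω - μ))) := by
      filter_upwards [hall] with ω h
      have hx := h (t+1) (by omega)
      have hm := aux_muHat_mem c4 hc4 X ω h (t+1) (by omega)
      set y : ℝ := (X (t+1) ω - M ω)^2 with hy
      have hy0 : 0 ≤ y := sq_nonneg _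
      have hy1 : y ≤ 1 := by
        rw [hy, sq_le_one_iff_abs_le_one, abs_le]
        constructor <;> linarith [hx.1, hx.2, hm.1, hm.2]
      have hT : auxT c4 X (t+1) ω = auxT c4 X t ω + y := by
        unfold auxT; rw [Finset.sum_Icc_succ_top (by omega)]
      have hexp : Real.exp (-y) ≤ 1 - c * y := by
        have := convexOn_exp.2 (Set.mem_univ (0:ℝ)) (Set.mem_univ (-1:ℝ))
          (show 0 ≤ 1 - y by linarith) hy0 (by ring)
        simp only [smul_eq_mul, mul_zero, zero_add, Real.exp_zero] at this
        rw [hc]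
        have e : y * (-1) = -y := by ring
        rw [e] at this
        linarith
      rw [hT, neg_add, Real.exp_add]
      have hZp : 0 < Z ω := Real.exp_pos _
      have : Z ω * Real.exp (-y) ≤ Z ω * (1 - c * y) := mul_le_mul_of_nonneg_left hexp hZp.le
      refine this.trans ?_
      have h3 : 0 ≤ c * (Z ω * (μ - M ω)^2) := by positivity
      have : y = (X (t+1) ω - μ)^2 + 2 * ((μ - M ω) * (X (t+1) ω - μ)) + (μ - M ω)^2 := by
        rw [hy]; ring
      rw [this]
      nlinarith
    have hZi : Integrable Z P := hZint t
    have I3 : Integrable (fun ω => Z ω * (X (t+1) ω - μ)^2 +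
        2 * ((Z ω * (μ - M ω)) * (X (t+1) ω - μ))) P := I2.add (I1.const_mul 2)
    calc ∫ ω, Real.exp (-auxT c4 X (t+1) ω) ∂P
        ≤ ∫ ω, (Z ω - c * (Z ω * (X (t+1) ω - μ)^2 +
            2 * ((Z ω * (μ - M ω)) * (X (t+1) ω - μ)))) ∂P :=
          integral_mono_ae (hZint (t+1)) (hZi.sub (I3.const_mul c)) hstep
      _ = (1 - c * σ2) * ∫ ω, Z ω ∂P := by
          rw [integral_sub hZi (I3.const_mul c), integral_const_mul,
            integral_add I2 (I1.const_mul 2), integral_const_mul, p1, p2]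
          ring
      _ ≤ Real.exp (-(c * σ2)) * ∫ ω, Z ω ∂P := by
          apply mul_le_mul_of_nonneg_right
          · have := Real.add_one_le_exp (-(c * σ2)); linarith
          · exact integral_nonneg fun ω => (Real.exp_pos _).le
      _ ≤ Real.exp (-(c * σ2)) * Real.exp (-(c * σ2) * t) :=
          mul_le_mul_of_nonneg_left ih (Real.exp_pos _).le
      _ = _ := by rw [← Real.exp_add]; congr 1; push_cast; ring

lemma aux_growth {m0 : MeasurableSpace Ω} (P : Measure Ω) [IsProbabilityMeasure P]
    (ℱ : Filtration ℕ m0) (X : ℕ → Ω → ℝ) (μ σ2 : ℝ) (c3 c4 : ℝ) (hc3 : 0 < c3)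
    (hc4 : c4 ∈ Set.Icc (0:ℝ) 1) (hσ : 0 < σ2)
    (hadapt : Adapted ℱ X)
    (hint : ∀ t, 1 ≤ t → Integrable (X t) P)
    (hbdd : ∀ t, 1 ≤ t → ∀ᵐ ω ∂P, X t ω ∈ Set.Icc (0:ℝ) 1)
    (hmean : ∀ t, 1 ≤ t → P[X t|ℱ (t - 1)] =ᵐ[P] fun _ => μ)
    (hvar : ∀ t, 1 ≤ t → P[(fun ω => (X t ω - μ)^2)|ℱ (t - 1)] =ᵐ[P] fun _ => σ2) :
    ∀ᵐ ω ∂P, ∃ δ > 0, ∀ t : ℕ, 1 ≤ t → δ * t ≤ c3 + auxT c4 X (t-1) ω := by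
  set b : ℝ := (1 - Real.exp (-1)) * σ2 with hb
  have hbpos : 0 < b := by
    have : Real.exp (-1) < 1 := Real.exp_lt_one_iff.2 (by norm_num)
    exact mul_pos (by linarith) hσ
  have key : ∀ t : ℕ, P {ω | Real.exp (-(b/2) * t) ≤ Real.exp (-auxT c4 X t ω)} ≤
      ENNReal.ofReal (Real.exp (-(b/2)) ^ t) := by
    intro t
    obtain ⟨h1, h2⟩ := aux_exp_bound P ℱ X μ σ2 c4 hc4 hadapt hint hbdd hmean hvar t
    have h3 := mul_meas_ge_le_integral_of_nonneg
      (Eventually.of_forall fun ω => (Real.exp_pos (-auxT c4 X t ω)).le) h1 (Real.exp (-(b/2) * t))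
    have h4 := h3.trans h2
    rw [← ofReal_measureReal]
    apply ENNReal.ofReal_le_ofReal
    have e : Real.exp (-((1 - Real.exp (-1)) * σ2) * t) =
        Real.exp (-(b/2) * t) * Real.exp (-(b/2))^t := by
      rw [← Real.exp_nat_mul, ← Real.exp_add]; congr 1; rw [hb]; ring
    rw [e] at h4
    exact le_of_mul_le_mul_left h4 (Real.exp_pos _)
  have hsum : ∑' t : ℕ, P {ω | Real.exp (-(b/2) * t) ≤ Real.exp (-auxT c4 X t ω)} ≠ ⊤ := by
    refine ne_top_of_le_ne_top ?_ (ENNReal.tsum_le_tsum key)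
    have hs : Summable fun t : ℕ => Real.exp (-(b/2)) ^ t :=
      summable_geometric_of_lt_one (Real.exp_pos _).le (Real.exp_lt_one_iff.2 (by linarith))
    exact hs.tsum_ofReal_ne_top
  filter_upwards [ae_eventually_notMem hsum] with ω h
  obtain ⟨N, hN⟩ := eventually_atTop.1 h
  have hTnn : ∀ s, 0 ≤ auxT c4 X s ω := fun s => Finset.sum_nonneg fun _ _ => sq_nonneg _
  refine ⟨min (b/4) (c3/(N+2)), lt_min (by linarith) (by positivity), fun t ht => ?_⟩
  by_cases hc : N + 2 ≤ t
  · have h1 := hN (t-1) (by omega)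
    simp only [not_le, Real.exp_lt_exp] at h1
    rw [Nat.cast_sub ht] at h1
    push_cast at h1
    have ht2 : (2:ℝ) ≤ t := by exact_mod_cast (by omega : 2 ≤ t)
    have : min (b/4) (c3/(N+2)) * t ≤ b/4 * t :=
      mul_le_mul_of_nonneg_right (min_le_left _ _) (by linarith)
    nlinarith
  · have ht2 : (t:ℝ) ≤ N + 2 := by exact_mod_cast (by omega : t ≤ N + 2)
    have : min (b/4) (c3/(N+2)) * t ≤ c3/(N+2) * (N+2) := by
      apply mul_le_mul (min_le_right _ _) ht2 (by positivity) (by positivity)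
    rw [div_mul_cancel₀ _ (by positivity)] at this
    linarith [hTnn (t-1)]

lemma aux_sig (c3 c4 : ℝ) (X : ℕ → Ω → ℝ) (ω : Ω) (k : ℕ) (hk : 1 ≤ k) :
    sigHat2 c3 c4 X k ω * k = c3 + auxT c4 X (k-1) ω := by
  have : (k:ℝ) ≠ 0 := by positivity
  unfold sigHat2 auxT
  rw [div_mul_cancel₀ _ this]

lemma aux_T_le (c4 : ℝ) (hc4 : c4 ∈ Set.Icc (0:ℝ) 1) (X : ℕ → Ω → ℝ) (ω : Ω)
    (hX : ∀ t, 1 ≤ t → X t ω ∈ Set.Icc (0:ℝ) 1) (k : ℕ) : auxT c4 X k ω ≤ k := by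
  unfold auxT
  calc _ ≤ ∑ i ∈ Finset.Icc 1 k, (1:ℝ) := by
        refine Finset.sum_le_sum fun i hi => ?_
        have h1 := (Finset.mem_Icc.1 hi).1
        have hx := hX i h1
        have hm := aux_muHat_mem c4 hc4 X ω hX i h1
        rw [sq_le_one_iff_abs_le_one, abs_le]
        constructor <;> linarith [hx.1, hx.2, hm.1, hm.2]
    _ = k := by simp

lemma aux_sig_mem (c3 c4 : ℝ) (hc3 : c3 ∈ Set.Ioc (0:ℝ) 1) (hc4 : c4 ∈ Set.Icc (0:ℝ) 1)
    (X : ℕ → Ω → ℝ) (ω : Ω)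
    (hX : ∀ t, 1 ≤ t → X t ω ∈ Set.Icc (0:ℝ) 1) (k : ℕ) (hk : 1 ≤ k) :
    0 < sigHat2 c3 c4 X k ω ∧ sigHat2 c3 c4 X k ω ≤ 1 := by
  have hk' : (0:ℝ) < k := by exact_mod_cast hk
  have h1 := aux_sig c3 c4 X ω k hk
  have h2 := aux_T_le c4 hc4 X ω hX (k-1)
  have h3 : 0 ≤ auxT c4 X (k-1) ω := Finset.sum_nonneg fun _ _ => sq_nonneg _
  rw [Nat.cast_sub hk] at h2
  push_cast at h2
  constructor
  · have : 0 < sigHat2 c3 c4 X k ω * k := by rw [h1]; linarith [hc3.1]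
    exact pos_of_mul_pos_left this hk'.le
  · by_contra hcon
    push Not at hcon
    nlinarith [hc3.2]

lemma aux_psi (c x : ℝ) (h0 : 0 ≤ x) (hx : x ≤ c) : psiP x ≤ Real.exp c * x^2 := by
  have h1 := Real.add_one_le_exp (-x)
  have h2 : Real.exp x * (1 - x) ≤ 1 := by
    calc Real.exp x * (1 - x) ≤ Real.exp x * Real.exp (-x) :=
          mul_le_mul_of_nonneg_left (by linarith) (Real.exp_pos _).le
      _ = 1 := by rw [← Real.exp_add]; simp
  have h3 : Real.exp x ≤ Real.exp c := Real.exp_le_exp.2 hx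
  unfold psiP
  have h4 : Real.exp x - 1 ≤ x * Real.exp x := by linarith
  have h5 : x * (Real.exp x - 1) ≤ x * (x * Real.exp x) := mul_le_mul_of_nonneg_left h4 h0
  have h6 : x^2 * Real.exp x ≤ x^2 * Real.exp c := mul_le_mul_of_nonneg_left h3 (sq_nonneg _)
  nlinarith

lemma aux_psi_nonneg (x : ℝ) : 0 ≤ psiP x := by
  unfold psiP; linarith [Real.add_one_le_exp x]

lemma aux_harm (n : ℕ) : ∑ i ∈ Finset.Icc 1 n, (1:ℝ)/i ≤ 1 + Real.log n := by
  have := harmonic_le_one_add_log n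
  rw [harmonic_eq_sum_Icc] at this
  push_cast at this
  simpa [one_div] using this

lemma aux_log1 (n : ℕ) (hn : 2 ≤ n) : 1 ≤ Real.log (1 + (n:ℝ)) := by
  have hn' : (2:ℝ) ≤ n := by exact_mod_cast hn
  rw [Real.le_log_iff_exp_le (by linarith)]
  linarith [Real.exp_one_lt_d9]

lemma aux_R (c3 c4 c5 σ2 : ℝ) (hc3 : c3 ∈ Set.Ioc (0:ℝ) 1) (hc4 : c4 ∈ Set.Icc (0:ℝ) 1)
    (hc5 : 0 < c5) (hσ : 0 ≤ σ2) (X : ℕ → Ω → ℝ) (ω : Ω)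
    (hX : ∀ t, 1 ≤ t → X t ω ∈ Set.Icc (0:ℝ) 1)
    (hg : σ2 = 0 ∨ ∃ δ > 0, ∀ t : ℕ, 1 ≤ t → δ * t ≤ c3 + auxT c4 X (t-1) ω) :
    ∃ K > 0, ∀ (n : ℕ) (a : ℝ), 2 ≤ n → 1 ≤ Real.log (2/a) →
      Real.log (2/a) ≤ 2 * Real.log (1 + (n:ℝ)) → ∀ i, 1 ≤ i → i ≤ n →
      (Rtilde c3 c4 c5 σ2 X a i ω)^2 ≤ K * Real.log (1 + (n:ℝ))^5 / i := by
  -- numerator constant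
  have hnum : ∃ K1 > 0, ∀ (n : ℕ) (a : ℝ), 2 ≤ n → 1 ≤ Real.log (2/a) →
      Real.log (2/a) ≤ 2 * Real.log (1 + (n:ℝ)) → ∀ i, 1 ≤ i → i ≤ n →
      Real.log (2/a) + σ2 * ∑ k ∈ Finset.Icc 1 (i-1), psiP (lamT c3 c4 c5 X a k ω) ≤
        K1 * Real.log (1 + (n:ℝ))^2 := by
    rcases hg with h0 | ⟨δ, hδ, hgr⟩
    · refine ⟨2, by norm_num, fun n a hn _ h2 i _ _ => ?_⟩
      have := aux_log1 n hn
      rw [h0]; nlinarith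
    · have hl2 : 0 < Real.log 2 := Real.log_pos (by norm_num)
      set C : ℝ := Real.exp c5 * (4 / (δ * Real.log 2)) with hC
      have hCpos : 0 < C := by positivity
      refine ⟨2 + σ2 * C * 2, by positivity, fun n a hn h1 h2 i hi hin => ?_⟩
      have hl := aux_log1 n hn
      set l := Real.log (1 + (n:ℝ)) with hl_def
      have hterm : ∀ k ∈ Finset.Icc 1 (i-1), psiP (lamT c3 c4 c5 X a k ω) ≤
          (C * l) * ((1:ℝ)/k) := by
        intro k hk
        have hk1 := (Finset.mem_Icc.1 hk).1
        have hk' : (0:ℝ) < k := by exact_mod_cast hk1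
        have hlam0 : 0 ≤ lamT c3 c4 c5 X a k ω := le_min (Real.sqrt_nonneg _) hc5.le
        refine (aux_psi c5 _ hlam0 (min_le_right _ _)).trans ?_
        rw [hC, mul_assoc, mul_assoc]
        refine mul_le_mul_of_nonneg_left ?_ (Real.exp_pos _).le
        have hlk : Real.log 2 ≤ Real.log (1 + (k:ℝ)) := by
          apply Real.log_le_log (by norm_num)
          have : (1:ℝ) ≤ k := by exact_mod_cast hk1
          linarith
        have hD : δ * k * Real.log 2 ≤
            sigHat2 c3 c4 X k ω * (k : ℝ) * Real.log (1 + (k : ℝ)) := by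
          rw [aux_sig c3 c4 X ω k hk1]
          have := hgr k hk1
          exact mul_le_mul this hlk hl2.le (le_trans (by positivity) this)
        calc lamT c3 c4 c5 X a k ω ^ 2
            ≤ (Real.sqrt (2 * Real.log (2/a) /
              (sigHat2 c3 c4 X k ω * (k : ℝ) * Real.log (1 + (k : ℝ)))))^2 :=
              pow_le_pow_left₀ hlam0 (min_le_left _ _) 2
          _ = 2 * Real.log (2/a) /
              (sigHat2 c3 c4 X k ω * (k : ℝ) * Real.log (1 + (k : ℝ))) := by
              apply Real.sq_sqrt
              apply div_nonneg (by linarith)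
              exact le_trans (by positivity) hD
          _ ≤ (2 * (2 * l)) / (δ * k * Real.log 2) :=
              div_le_div₀ (by linarith) (by linarith) (by positivity) hD
          _ = 4 / (δ * Real.log 2) * (l * (1 / k)) := by
              field_simp; norm_num
      have hsum : ∑ k ∈ Finset.Icc 1 (i-1), psiP (lamT c3 c4 c5 X a k ω) ≤ C * l * (2 * l) := by
        refine (Finset.sum_le_sum hterm).trans ?_
        rw [← Finset.mul_sum]
        refine mul_le_mul_of_nonneg_left ?_ (by positivity)
        calc ∑ k ∈ Finset.Icc 1 (i-1), (1:ℝ)/k ≤ ∑ k ∈ Finset.Icc 1 n, (1:ℝ)/k := by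
              apply Finset.sum_le_sum_of_subset_of_nonneg
              · exact Finset.Icc_subset_Icc le_rfl (by omega)
              · intros; positivity
          _ ≤ 1 + Real.log n := aux_harm n
          _ ≤ 2 * l := by
              have : Real.log n ≤ l := Real.log_le_log (by positivity) (by linarith)
              linarith
      have := mul_le_mul_of_nonneg_left hsum hσ
      nlinarith
  obtain ⟨K1, hK1, hnum⟩ := hnum
  set κ : ℝ := min 1 c5 with hκ
  have hκpos : 0 < κ := lt_min one_pos hc5
  refine ⟨(2 * K1 / κ)^2 + 1, by positivity, fun n a hn h1 h2 i hi hin => ?_⟩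
  have hl := aux_log1 n hn
  have hN := hnum n a hn h1 h2 i hi hin
  set l := Real.log (1 + (n:ℝ)) with hl_def
  by_cases hi1 : i = 1
  · have hl5 : 1 ≤ l^5 := one_le_pow₀ hl
    have : Rtilde c3 c4 c5 σ2 X a i ω = 1/2 := by simp [Rtilde, hi1]
    rw [this, hi1]
    have : 0 ≤ (2 * K1 / κ)^2 := sq_nonneg _
    norm_num
    nlinarith
  have hi2 : 2 ≤ i := by omega
  have hi' : (2:ℝ) ≤ i := by exact_mod_cast hi2
  have hil : 1 ≤ (i:ℝ) * l := by nlinarith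
  have hs1 : 1 ≤ Real.sqrt (i * l) := Real.one_le_sqrt.2 hil
  have hD : κ * Real.sqrt i / (2 * Real.sqrt l) ≤
      ∑ k ∈ Finset.Icc 1 (i-1), lamT c3 c4 c5 X a k ω := by
    have hterm : ∀ k ∈ Finset.Icc 1 (i-1), κ / Real.sqrt (i * l) ≤ lamT c3 c4 c5 X a k ω := by
      intro k hk
      obtain ⟨hk1, hk2⟩ := Finset.mem_Icc.1 hk
      have hk' : (1:ℝ) ≤ k := by exact_mod_cast hk1
      have hki : (k:ℝ) ≤ i := by exact_mod_cast (by omega : k ≤ i)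
      have hin' : (i:ℝ) ≤ n := by exact_mod_cast hin
      obtain ⟨hs0, hsle⟩ := aux_sig_mem c3 c4 hc3 hc4 X ω hX k hk1
      have hlk : Real.log (1 + (k:ℝ)) ≤ l := Real.log_le_log (by linarith) (by linarith)
      have hlk0 : 0 < Real.log (1 + (k:ℝ)) := Real.log_pos (by linarith)
      refine le_min ?_ ?_
      · have : κ / Real.sqrt (i * l) ≤ Real.sqrt (1 / (i * l)) := by
          rw [Real.sqrt_div zero_le_one, Real.sqrt_one]
          exact div_le_div_of_nonneg_right (min_le_left _ _) (Real.sqrt_nonneg _)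
        refine this.trans (Real.sqrt_le_sqrt ?_)
        apply div_le_div₀ (by linarith) (by linarith) (by positivity)
        apply mul_le_mul _ hlk hlk0.le (by linarith)
        nlinarith
      · calc κ / Real.sqrt (i * l) ≤ κ := div_le_self hκpos.le hs1
          _ ≤ c5 := min_le_right _ _
    have hcard := Finset.card_nsmul_le_sum _ _ _ hterm
    rw [Nat.card_Icc, nsmul_eq_mul, Nat.add_sub_cancel, Nat.cast_sub hi] at hcard
    push_cast at hcard
    refine le_trans ?_ hcard
    rw [Real.sqrt_mul (by linarith)]
    have hsi : 0 < Real.sqrt i := Real.sqrt_pos.2 (by linarith)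
    have hsl : 0 < Real.sqrt l := Real.sqrt_pos.2 (by linarith)
    have hsq : Real.sqrt i * Real.sqrt i = i := Real.mul_self_sqrt (by linarith)
    rw [← mul_div_assoc, div_le_div_iff₀ (by positivity) (by positivity)]
    have : κ * Real.sqrt i * (Real.sqrt i * Real.sqrt l) = κ * Real.sqrt l * i := by
      calc _ = κ * Real.sqrt l * (Real.sqrt i * Real.sqrt i) := by ring
        _ = _ := by rw [hsq]
    rw [this]
    have : 0 < κ * Real.sqrt l := by positivity
    nlinarith
  have hN0 : 0 ≤ Real.log (2/a) + σ2 * ∑ k ∈ Finset.Icc 1 (i-1), psiP (lamT c3 c4 c5 X a k ω) :=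
    add_nonneg (by linarith) (mul_nonneg hσ (Finset.sum_nonneg fun _ _ => aux_psi_nonneg _))
  have hsi : 0 < Real.sqrt i := Real.sqrt_pos.2 (by linarith)
  have hsl : 0 < Real.sqrt l := Real.sqrt_pos.2 (by linarith)
  have hD0 : 0 < κ * Real.sqrt i / (2 * Real.sqrt l) := by positivity
  have hR : Rtilde c3 c4 c5 σ2 X a i ω = (Real.log (2/a) + σ2 * ∑ k ∈ Finset.Icc 1 (i-1),
      psiP (lamT c3 c4 c5 X a k ω)) / (∑ k ∈ Finset.Icc 1 (i-1), lamT c3 c4 c5 X a k ω) := by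
    simp [Rtilde, hi1]
  have hR0 : 0 ≤ Rtilde c3 c4 c5 σ2 X a i ω := by
    rw [hR]; exact div_nonneg hN0 (hD0.le.trans hD)
  have hRle : Rtilde c3 c4 c5 σ2 X a i ω ≤ K1 * l^2 / (κ * Real.sqrt i / (2 * Real.sqrt l)) := by
    rw [hR]; exact div_le_div₀ (by positivity) hN hD0 hD
  calc (Rtilde c3 c4 c5 σ2 X a i ω)^2
      ≤ (K1 * l^2 / (κ * Real.sqrt i / (2 * Real.sqrt l)))^2 := pow_le_pow_left₀ hR0 hRle 2
    _ = (2 * K1 / κ)^2 * l^4 * (Real.sqrt l)^2 / (Real.sqrt i)^2 := by field_simp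
    _ = (2 * K1 / κ)^2 * l^5 / i := by
        rw [Real.sq_sqrt (by linarith), Real.sq_sqrt (by linarith)]; ring
    _ ≤ _ := by
        apply div_le_div_of_nonneg_right _ (by linarith)
        apply mul_le_mul_of_nonneg_right (by linarith) (by positivity)

lemma aux_m4_mem (c2 c3 c4 : ℝ) (hc2 : c2 ∈ Set.Ioc (0:ℝ) 1)
    (hc3 : c3 ∈ Set.Ioc (0:ℝ) 1) (hc4 : c4 ∈ Set.Icc (0:ℝ) 1)
    (X : ℕ → Ω → ℝ) (ω : Ω)
    (hX : ∀ t, 1 ≤ t → X t ω ∈ Set.Icc (0:ℝ) 1) (k : ℕ) (hk : 1 ≤ k) :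
    c2 / k ≤ m4Hat2 c2 c3 c4 X k ω ∧ m4Hat2 c2 c3 c4 X k ω ≤ 1 := by
  have hk' : (0:ℝ) < k := by exact_mod_cast hk
  have h0 : 0 ≤ ∑ i ∈ Finset.Icc 1 (k-1),
      ((X i ω - muHat c4 X i ω)^2 - sigHat2 c3 c4 X i ω)^2 :=
    Finset.sum_nonneg fun _ _ => sq_nonneg _
  have h1 : ∑ i ∈ Finset.Icc 1 (k-1),
      ((X i ω - muHat c4 X i ω)^2 - sigHat2 c3 c4 X i ω)^2 ≤ (k:ℝ) - 1 := by
    calc _ ≤ ∑ i ∈ Finset.Icc 1 (k-1), (1:ℝ) := by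
          refine Finset.sum_le_sum fun i hi => ?_
          have h1 := (Finset.mem_Icc.1 hi).1
          have hx := hX i h1
          have hm := aux_muHat_mem c4 hc4 X ω hX i h1
          have hs := aux_sig_mem c3 c4 hc3 hc4 X ω hX i h1
          have hy : (X i ω - muHat c4 X i ω)^2 ≤ 1 := by
            rw [sq_le_one_iff_abs_le_one, abs_le]
            constructor <;> linarith [hx.1, hx.2, hm.1, hm.2]
          have hy0 := sq_nonneg (X i ω - muHat c4 X i ω)
          rw [sq_le_one_iff_abs_le_one, abs_le]
          constructor <;> linarith [hs.1, hs.2]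
      _ = (k:ℝ) - 1 := by simp [Nat.cast_sub hk]
  unfold m4Hat2
  constructor
  · exact div_le_div_of_nonneg_right (by linarith) hk'.le
  · rw [div_le_one hk']; linarith [hc2.2]

lemma aux_lamB (c1 c2 c3 c4 : ℝ) (hc1 : c1 ∈ Set.Ioo (0:ℝ) 1) (hc2 : c2 ∈ Set.Ioc (0:ℝ) 1)
    (hc3 : c3 ∈ Set.Ioc (0:ℝ) 1) (hc4 : c4 ∈ Set.Icc (0:ℝ) 1)
    (X : ℕ → Ω → ℝ) (ω : Ω)
    (hX : ∀ t, 1 ≤ t → X t ω ∈ Set.Icc (0:ℝ) 1) (A d : ℝ) (hA : 0 < A)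
    (h1 : A ≤ 2 * Real.log (1/d)) (h2 : 2 * Real.log (1/d) ≤ 4 * A)
    (n i : ℕ) (hi : 1 ≤ i) (hin : i ≤ n) :
    min (Real.sqrt A) c1 / Real.sqrt n ≤ lamB c1 c2 c3 c4 X d n i ω ∧
    lamB c1 c2 c3 c4 X d n i ω ≤ Real.sqrt (4 * A / c2) * Real.sqrt i / Real.sqrt n := by
  have hi' : (0:ℝ) < i := by exact_mod_cast hi
  have hn' : (1:ℝ) ≤ n := by exact_mod_cast hi.trans hin
  obtain ⟨hm1, hm2⟩ := aux_m4_mem c2 c3 c4 hc2 hc3 hc4 X ω hX i hi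
  have hc2' := hc2.1
  have hm0 : 0 < m4Hat2 c2 c3 c4 X i ω := lt_of_lt_of_le (by positivity) hm1
  have hsn : 1 ≤ Real.sqrt n := Real.one_le_sqrt.2 hn'
  have hmin0 : 0 ≤ min (Real.sqrt A) c1 := le_min (Real.sqrt_nonneg _) hc1.1.le
  constructor
  · refine le_min ?_ ?_
    · calc _ ≤ Real.sqrt A / Real.sqrt n :=
            div_le_div_of_nonneg_right (min_le_left _ _) (Real.sqrt_nonneg _)
        _ = Real.sqrt (A / n) := (Real.sqrt_div hA.le _).symm
        _ ≤ _ := by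
            apply Real.sqrt_le_sqrt
            apply div_le_div₀ (by linarith) h1 (by positivity)
            nlinarith
    · exact (div_le_self hmin0 hsn).trans (min_le_right _ _)
  · refine (min_le_left _ _).trans ?_
    rw [← Real.sqrt_mul (by positivity), ← Real.sqrt_div (by positivity)]
    apply Real.sqrt_le_sqrt
    have : 4 * A / c2 * i / n = (4 * A) / (c2 / i * n) := by field_simp
    rw [this]
    apply div_le_div₀ (by positivity) h2 (by positivity)
    exact mul_le_mul_of_nonneg_right hm1 (by linarith)

/-- deterministic weighted-average estimate -/
lemma aux_weighted (n : ℕ) (hn : 2 ≤ n) (lam r : ℕ → ℝ) (B κ Q : ℝ) (hB : 0 < B) (hκ : 0 < κ)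
    (hQ : 0 ≤ Q)
    (hl1 : ∀ i, 1 ≤ i → i ≤ n → κ / Real.sqrt n ≤ lam i)
    (hl2 : ∀ i, 1 ≤ i → i ≤ n → lam i ≤ B * Real.sqrt i / Real.sqrt n)
    (hr : ∀ i, 1 ≤ i → i ≤ n → r i ≤ Q / i) (m : ℝ) (hm : 0 < m) :
    Real.sqrt n * ((∑ i ∈ Finset.Icc 1 n, lam i * r i) / (∑ i ∈ Finset.Icc 1 n, lam i)) ≤
      Q * (Real.sqrt n / m + B / κ * (Real.sqrt m / Real.sqrt n) * (2 * Real.log (1 + (n:ℝ)))) := by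
  have hn' : (2:ℝ) ≤ n := by exact_mod_cast hn
  have hsn : 0 < Real.sqrt n := Real.sqrt_pos.2 (by linarith)
  have hl := aux_log1 n hn
  set l := Real.log (1 + (n:ℝ)) with hl_def
  have hlam0 : ∀ i, 1 ≤ i → i ≤ n → 0 ≤ lam i := fun i a b =>
    le_trans (by positivity) (hl1 i a b)
  set Λ := ∑ i ∈ Finset.Icc 1 n, lam i with hΛ
  have hΛge : κ * Real.sqrt n ≤ Λ := by
    have h := Finset.card_nsmul_le_sum (Finset.Icc 1 n) lam (κ / Real.sqrt n)
      (fun i hi => hl1 i (Finset.mem_Icc.1 hi).1 (Finset.mem_Icc.1 hi).2)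
    rw [Nat.card_Icc, nsmul_eq_mul, Nat.add_sub_cancel] at h
    refine le_trans (le_of_eq ?_) h
    rw [← mul_div_assoc, eq_div_iff hsn.ne', mul_assoc, Real.mul_self_sqrt (by linarith)]
    ring
  have hΛpos : 0 < Λ := lt_of_lt_of_le (by positivity) hΛge
  have hterm : ∀ i ∈ Finset.Icc 1 n, lam i * r i ≤
      Q * (lam i / m + B * Real.sqrt m / Real.sqrt n * ((1:ℝ)/i)) := by
    intro i hi
    obtain ⟨ha, hb⟩ := Finset.mem_Icc.1 hi
    have hi' : (0:ℝ) < i := by exact_mod_cast ha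
    have h0 := hlam0 i ha hb
    calc lam i * r i ≤ lam i * (Q / i) := mul_le_mul_of_nonneg_left (hr i ha hb) h0
      _ = Q * (lam i / i) := by ring
      _ ≤ _ := by
        apply mul_le_mul_of_nonneg_left _ hQ
        by_cases him : m ≤ i
        · have h1 : lam i / i ≤ lam i / m := div_le_div_of_nonneg_left h0 hm him
          have h2 : 0 ≤ B * Real.sqrt m / Real.sqrt n * ((1:ℝ)/i) := by positivity
          linarith
        · push Not at him
          have h1 : 0 ≤ lam i / m := div_nonneg h0 hm.le
          have h2 : lam i / i ≤ B * Real.sqrt m / Real.sqrt n * ((1:ℝ)/i) := by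
            rw [mul_one_div]
            apply div_le_div_of_nonneg_right _ hi'.le
            refine (hl2 i ha hb).trans ?_
            apply div_le_div_of_nonneg_right _ hsn.le
            exact mul_le_mul_of_nonneg_left (Real.sqrt_le_sqrt him.le) hB.le
          linarith
  have hsum : ∑ i ∈ Finset.Icc 1 n, lam i * r i ≤
      Q * (Λ / m + B * Real.sqrt m / Real.sqrt n * (2 * l)) := by
    refine (Finset.sum_le_sum hterm).trans ?_
    rw [← Finset.mul_sum, Finset.sum_add_distrib, ← Finset.sum_div, ← Finset.mul_sum]
    apply mul_le_mul_of_nonneg_left _ hQ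
    have h1 := aux_harm n
    have h2 : Real.log n ≤ l := Real.log_le_log (by positivity) (by linarith)
    have h3 : B * Real.sqrt m / Real.sqrt n * (∑ i ∈ Finset.Icc 1 n, (1:ℝ)/i) ≤
      B * Real.sqrt m / Real.sqrt n * (2 * l) :=
        mul_le_mul_of_nonneg_left (by linarith) (by positivity)
    linarith
  have hfin : (∑ i ∈ Finset.Icc 1 n, lam i * r i) / Λ ≤
      Q * (1 / m + B * Real.sqrt m / Real.sqrt n * (2 * l) / (κ * Real.sqrt n)) := by
    rw [div_le_iff₀ hΛpos]
    refine hsum.trans ?_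
    rw [mul_assoc]
    apply mul_le_mul_of_nonneg_left _ hQ
    rw [add_mul]
    have h3 : 0 ≤ B * Real.sqrt m / Real.sqrt n * (2 * l) := by positivity
    have h4 : B * Real.sqrt m / Real.sqrt n * (2 * l) ≤
        B * Real.sqrt m / Real.sqrt n * (2 * l) / (κ * Real.sqrt n) * Λ := by
      generalize B * Real.sqrt m / Real.sqrt n * (2 * l) = y at h3
      have hp : 0 < κ * Real.sqrt n := by positivity
      rw [div_mul_eq_mul_div, le_div_iff₀ hp]
      exact mul_le_mul_of_nonneg_left hΛge h3
    have h5 : Λ / m = 1 / m * Λ := by ring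
    linarith
  calc _ ≤ Real.sqrt n * (Q * (1 / m + B * Real.sqrt m / Real.sqrt n * (2 * l) /
        (κ * Real.sqrt n))) := mul_le_mul_of_nonneg_left hfin hsn.le
    _ = _ := by field_simp

lemma aux_tend (K : ℝ) : Tendsto (fun x : ℝ => K * (Real.log x ^ (6:ℝ) / x ^ (1/8 : ℝ)))
    atTop (nhds 0) := by
  have h := (isLittleO_log_rpow_rpow_atTop (s := 1/8) 6 (by norm_num)).tendsto_div_nhds_zero
  simpa using h.const_mul K

/-- Theorem 7 of the paper: the extra lower-bound term vanishes,
`√n (Σ_{i≤n} λ_{i,α_{2,n}} R̃²_{i,α_{1,n}})/(Σ_{i≤n} λ_{i,α_{2,n}}) → 0` a.s. -/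
theorem lower_order_term_tendsto_zero
    {m0 : MeasurableSpace Ω} (P : Measure Ω) [IsProbabilityMeasure P]
    (ℱ : Filtration ℕ m0) (X : ℕ → Ω → ℝ) (μ σ2 V α : ℝ) (α1 α2 : ℕ → ℝ)
    (c1 c2 c3 c4 c5 : ℝ)
    (hc1 : c1 ∈ Set.Ioo (0:ℝ) 1) (hc2 : c2 ∈ Set.Ioc (0:ℝ) 1)
    (hc3 : c3 ∈ Set.Ioc (0:ℝ) 1) (hc4 : c4 ∈ Set.Icc (0:ℝ) 1) (hc5 : 0 < c5)
    (hα : α ∈ Set.Ioo (0:ℝ) 1)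
    (hadapt : Adapted ℱ X)
    (hint : ∀ t, 1 ≤ t → Integrable (X t) P)
    (hbdd : ∀ t, 1 ≤ t → ∀ᵐ ω ∂P, X t ω ∈ Set.Icc (0:ℝ) 1)
    (hmean : ∀ t, 1 ≤ t → P[X t|ℱ (t - 1)] =ᵐ[P] fun _ => μ)
    (hvar : ∀ t, 1 ≤ t → P[(fun ω => (X t ω - μ)^2)|ℱ (t - 1)] =ᵐ[P] fun _ => σ2)
    (hvar4 : ∀ t, 1 ≤ t →
      P[(fun ω => ((X t ω - μ)^2 - σ2)^2)|ℱ (t - 1)] =ᵐ[P] fun _ => V)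
    (hsplit : ∀ n, α1 n + α2 n = α)
    (hα1Ω : ∃ c > (0:ℝ), ∃ n0 : ℕ, ∀ n ≥ n0, c / Real.log n ≤ α1 n)
    (hα2lim : Tendsto α2 atTop (nhds α)) :
    ∀ᵐ ω ∂P, Tendsto
      (fun n : ℕ => Real.sqrt n *
        ((∑ i ∈ Finset.Icc 1 n,
            lamB c1 c2 c3 c4 X (α2 n) n i ω * (Rtilde c3 c4 c5 σ2 X (α1 n) i ω)^2) /
          (∑ i ∈ Finset.Icc 1 n, lamB c1 c2 c3 c4 X (α2 n) n i ω)))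
      atTop (nhds 0) := by
  have hall : ∀ᵐ ω ∂P, ∀ t, 1 ≤ t → X t ω ∈ Set.Icc (0:ℝ) 1 := by
    rw [ae_all_iff]; intro t
    by_cases ht : 1 ≤ t
    · filter_upwards [hbdd t ht] with ω h _ using h
    · exact Eventually.of_forall fun ω h => absurd h ht
  have hσ : 0 ≤ σ2 := by
    have e : ∫ ω, (X 1 ω - μ)^2 ∂P = σ2 := by
      rw [← integral_condExp (ℱ.le (1-1)), integral_congr_ae (hvar 1 le_rfl)]; simp
    rw [← e]
    exact integral_nonneg fun ω => sq_nonneg _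
  have hgrow : ∀ᵐ ω ∂P, σ2 = 0 ∨
      ∃ δ > 0, ∀ t : ℕ, 1 ≤ t → δ * t ≤ c3 + auxT c4 X (t-1) ω := by
    rcases hσ.eq_or_lt with h | h
    · exact Eventually.of_forall fun ω => Or.inl h.symm
    · filter_upwards [aux_growth P ℱ X μ σ2 c3 c4 hc3.1 hc4 h hadapt hint hbdd hmean hvar]
        with ω hω using Or.inr hω
  -- deterministic facts on the levels
  have hα1lim : Tendsto α1 atTop (nhds 0) := by
    have h : Tendsto (fun n => α - α2 n) atTop (nhds (α - α)) := tendsto_const_nhds.sub hα2lim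
    rw [sub_self] at h
    refine h.congr fun n => ?_
    linarith [hsplit n]
  set A : ℝ := Real.log (1/α) with hA_def
  have hA : 0 < A := Real.log_pos (by rw [lt_div_iff₀ hα.1]; linarith [hα.2])
  have hAlim : Tendsto (fun n => 2 * Real.log (1 / α2 n)) atTop (nhds (2 * A)) := by
    have h1 : Tendsto (fun n => 1 / α2 n) atTop (nhds (1/α)) :=
      tendsto_const_nhds.div hα2lim hα.1.ne'
    have h2 : (1/α) ≠ 0 := (one_div_pos.2 hα.1).ne'
    exact (h1.log h2).const_mul 2
  have hA1 : ∀ᶠ n in atTop, A ≤ 2 * Real.log (1 / α2 n) :=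
    (hAlim.eventually (lt_mem_nhds (by linarith : A < 2 * A))).mono fun _ h => h.le
  have hA2 : ∀ᶠ n in atTop, 2 * Real.log (1 / α2 n) ≤ 4 * A :=
    (hAlim.eventually (gt_mem_nhds (by linarith : 2 * A < 4 * A))).mono fun _ h => h.le
  obtain ⟨c, hc, n0, hn0⟩ := hα1Ω
  have hn2 : ∀ᶠ n : ℕ in atTop, 2 ≤ n := eventually_ge_atTop 2
  have hpos : ∀ᶠ n : ℕ in atTop, 0 < α1 n := by
    filter_upwards [hn2, eventually_ge_atTop n0] with n h2 h
    have h2' : (2:ℝ) ≤ n := by exact_mod_cast h2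
    have : 0 < Real.log n := Real.log_pos (by linarith)
    exact lt_of_lt_of_le (by positivity) (hn0 n h)
  have hL1 : ∀ᶠ n in atTop, 1 ≤ Real.log (2 / α1 n) := by
    filter_upwards [hpos, hα1lim.eventually (gt_mem_nhds (by norm_num : (0:ℝ) < 1/2))] with n h1 h2
    rw [Real.le_log_iff_exp_le (by positivity), le_div_iff₀ h1]
    have := Real.exp_one_lt_d9
    nlinarith
  have hL2 : ∀ᶠ n : ℕ in atTop, Real.log (2 / α1 n) ≤ 2 * Real.log (1 + (n:ℝ)) := by
    filter_upwards [hpos, hn2, eventually_ge_atTop n0, eventually_ge_atTop ⌈2/c⌉₊]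
      with n h1 h2 h3 h4
    have h2' : (2:ℝ) ≤ n := by exact_mod_cast h2
    have h4' : 2/c ≤ n := Nat.ceil_le.1 h4
    have hlog : 0 < Real.log n := Real.log_pos (by linarith)
    have h5 : 2 / α1 n ≤ (1 + (n:ℝ))^2 := by
      calc 2 / α1 n ≤ 2 / (c / Real.log n) :=
            div_le_div_of_nonneg_left (by norm_num) (by positivity) (hn0 n h3)
        _ = 2 / c * Real.log n := by field_simp
        _ ≤ n * n := mul_le_mul h4' ((Real.log_le_sub_one_of_pos (by linarith)).trans (by linarith))
            hlog.le (by linarith)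
        _ ≤ _ := by nlinarith
    calc _ ≤ Real.log ((1 + (n:ℝ))^2) := Real.log_le_log (by positivity) h5
      _ = _ := by rw [Real.log_pow]; norm_num
  filter_upwards [hall, hgrow] with ω hX hg
  obtain ⟨K, hK, hR⟩ := aux_R c3 c4 c5 σ2 hc3 hc4 hc5 hσ X ω hX hg
  set κ : ℝ := min (Real.sqrt A) c1 with hκ_def
  have hκ : 0 < κ := lt_min (Real.sqrt_pos.2 hA) hc1.1
  set B : ℝ := Real.sqrt (4 * A / c2) with hB_def
  have hB : 0 < B := Real.sqrt_pos.2 (div_pos (by linarith) hc2.1)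
  have hcast : Tendsto (fun n : ℕ => 1 + (n:ℝ)) atTop atTop :=
    tendsto_atTop_add_const_left _ _ tendsto_natCast_atTop_atTop
  refine squeeze_zero' ?_ ?_ ((aux_tend (K * (1 + 4 * (B/κ)))).comp hcast)
  · filter_upwards with n
    have hb : ∀ i, 0 ≤ lamB c1 c2 c3 c4 X (α2 n) n i ω := fun i =>
      le_min (Real.sqrt_nonneg _) hc1.1.le
    apply mul_nonneg (Real.sqrt_nonneg _)
    exact div_nonneg (Finset.sum_nonneg fun i _ => mul_nonneg (hb i) (sq_nonneg _))
      (Finset.sum_nonneg fun i _ => hb i)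
  · filter_upwards [hn2, hA1, hA2, hL1, hL2] with n h2 hA1 hA2 hL1 hL2
    have h2' : (2:ℝ) ≤ n := by exact_mod_cast h2
    have hl := aux_log1 n h2
    have hx1 : 1 ≤ 1 + (n:ℝ) := by linarith
    have hW := aux_weighted n h2 (fun i => lamB c1 c2 c3 c4 X (α2 n) n i ω)
      (fun i => (Rtilde c3 c4 c5 σ2 X (α1 n) i ω)^2) B κ (K * Real.log (1 + (n:ℝ))^5) hB hκ
      (by positivity)
      (fun i a b => (aux_lamB c1 c2 c3 c4 hc1 hc2 hc3 hc4 X ω hX A (α2 n) hA hA1 hA2 n i a b).1)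
      (fun i a b => (aux_lamB c1 c2 c3 c4 hc1 hc2 hc3 hc4 X ω hX A (α2 n) hA hA1 hA2 n i a b).2)
      (fun i a b => hR n (α1 n) h2 hL1 hL2 i a b) ((1 + (n:ℝ))^(3/4:ℝ)) (by positivity)
    refine hW.trans ?_
    simp only [Function.comp_apply]
    have hnx : (n:ℝ) ≤ 1 + n := by linarith
    have hxn : 1 + (n:ℝ) ≤ 4 * n := by linarith
    have hsn : 0 < Real.sqrt n := Real.sqrt_pos.2 (by linarith)
    have hs1 : Real.sqrt n ≤ Real.sqrt (1 + n) := Real.sqrt_le_sqrt hnx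
    have hs2 : Real.sqrt (1 + n) ≤ 2 * Real.sqrt n := by
      calc _ ≤ Real.sqrt (4 * n) := Real.sqrt_le_sqrt hxn
        _ = _ := by
          rw [Real.sqrt_mul (by norm_num)]; congr 1
          rw [show (4:ℝ) = 2^2 by norm_num, Real.sqrt_sq (by norm_num)]
    set x : ℝ := 1 + (n:ℝ) with hx
    have hx0 : 0 < x := by linarith
    set l := Real.log x with hl_def
    have e8 : 0 < x ^ (1/8:ℝ) := by positivity
    have b1 : Real.sqrt n / x ^ (3/4:ℝ) ≤ 1 / x ^ (1/8:ℝ) := by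
      rw [div_le_div_iff₀ (by positivity) e8, one_mul]
      calc Real.sqrt n * x ^ (1/8:ℝ) ≤ x ^ (1/2:ℝ) * x ^ (1/8:ℝ) := by
            apply mul_le_mul_of_nonneg_right _ e8.le
            rw [← Real.sqrt_eq_rpow]; exact hs1
        _ = x ^ (5/8:ℝ) := by rw [← Real.rpow_add hx0]; norm_num
        _ ≤ _ := Real.rpow_le_rpow_of_exponent_le hx1 (by norm_num)
    have b2 : Real.sqrt (x ^ (3/4:ℝ)) / Real.sqrt n ≤ 2 / x ^ (1/8:ℝ) := by
      rw [div_le_div_iff₀ hsn e8]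
      refine le_trans (le_of_eq ?_) hs2
      rw [Real.sqrt_eq_rpow, Real.sqrt_eq_rpow, ← Real.rpow_mul hx0.le, ← Real.rpow_add hx0]
      norm_num
    have e6 : l ^ (6:ℝ) = l ^ 6 := by exact_mod_cast Real.rpow_natCast l 6
    rw [e6]
    have hBκ : 0 < B / κ := by positivity
    calc _ ≤ K * l^5 * (1 / x ^ (1/8:ℝ) + B / κ * (2 / x ^ (1/8:ℝ)) * (2 * l)) := by
          gcongr
      _ = K * l^5 * ((1 + 4 * (B/κ) * l) / x ^ (1/8:ℝ)) := by ring
      _ ≤ K * l^5 * ((l * (1 + 4 * (B/κ))) / x ^ (1/8:ℝ)) := by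
          gcongr
          nlinarith
      _ = _ := by ring
end

section
/- Sharpness: let X_1, X_2, ... satisfy Assumption 1 and Assumption 2 with common conditional variance V := Var((X_i − μ)²), let α ∈ (0,1), and split α_{1,n} := α/log n, α_{2,n} := α(log n − 1)/log n. With the estimators of the context (c_2 > 0, c_3 > 0), the batch upper plug-ins λ_{i,u} := min( sqrt( 2 log(1/α)/(m̂²_{4,i} · n) ), c_1 ) defining U_n := D_n + R_{n,α}, and the lower bound L_n defined from the plug-ins λ_{i,α_{2,n}} := min( sqrt( 2 log(1/α_{2,n})/(m̂²_{4,i} · n) ), c_1 ) and the Bennett radii R̃_{i,α_{1,n}} via L_n := D_n − (Σ_{i≤n} λ_{i,α_{2,n}} R̃²_{i,α_{1,n}})/(Σ_{i≤n} λ_{i,α_{2,n}}) − R_{n,α_{2,n}}, it holds that √n (U_n − D_n) → sqrt( 2 V log(1/α) ) almost surely and √n (D_n − L_n) → sqrt( 2 V log(1/α) ) almost surely. -/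
open MeasureTheory ProbabilityTheory Filter Finset

/-- `ψ_E(λ) := −log(1−λ) − λ`. -/
noncomputable def psiE (l : ℝ) : ℝ := -Real.log (1 - l) - l

variable {Ω : Type*}

/-- `D_n` computed with the batch plug-ins of level `d`. -/
noncomputable def DB (c1 c2 c3 c4 : ℝ) (X : ℕ → Ω → ℝ) (d : ℝ) (n : ℕ) (ω : Ω) : ℝ :=
  (∑ i ∈ Finset.Icc 1 n, lamB c1 c2 c3 c4 X d n i ω * (X i ω - muHat c4 X i ω)^2) /
    (∑ i ∈ Finset.Icc 1 n, lamB c1 c2 c3 c4 X d n i ω)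

/-- `R_{n,d}` computed with the batch plug-ins of level `d`. -/
noncomputable def RB (c1 c2 c3 c4 : ℝ) (X : ℕ → Ω → ℝ) (d : ℝ) (n : ℕ) (ω : Ω) : ℝ :=
  (Real.log (1/d) + ∑ i ∈ Finset.Icc 1 n,
      psiE (lamB c1 c2 c3 c4 X d n i ω) *
        ((X i ω - muHat c4 X i ω)^2 - sigHat2 c3 c4 X i ω)^2) /
    (∑ i ∈ Finset.Icc 1 n, lamB c1 c2 c3 c4 X d n i ω)

/-- Abel summation bound. -/
theorem abel_bound (x : ℕ → ℝ) (B : ℝ)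
    (hB : ∀ n, |∑ i ∈ range n, x (i+1) * ((i+1:ℕ):ℝ)^(-(5/8):ℝ)| ≤ B) (n : ℕ) :
    |∑ i ∈ Finset.Icc 1 n, x i| ≤ (2 * B) * (n:ℝ)^(5/8:ℝ) := by
  set M : ℕ → ℝ := fun n => ∑ i ∈ range n, x (i+1) * ((i+1:ℕ):ℝ)^(-(5/8):ℝ) with hM
  have key : ∀ n : ℕ, |∑ i ∈ Finset.Icc 1 n, x i - (n:ℝ)^(5/8:ℝ) * M n| ≤ B * (n:ℝ)^(5/8:ℝ) := by
    intro n
    induction n with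
    | zero => simp [hM]
    | succ k ih =>
      have h1 : M (k+1) = M k + x (k+1) * ((k+1:ℕ):ℝ)^(-(5/8):ℝ) := by
        simp only [hM]; rw [Finset.sum_range_succ]
      have h2 : ((k+1:ℕ):ℝ)^(5/8:ℝ) * ((k+1:ℕ):ℝ)^(-(5/8):ℝ) = 1 := by
        rw [← Real.rpow_add (by positivity)]; norm_num
      have h3 : (k:ℝ)^(5/8:ℝ) ≤ ((k+1:ℕ):ℝ)^(5/8:ℝ) :=
        Real.rpow_le_rpow (by positivity) (by push_cast; linarith) (by norm_num)
      rw [Finset.sum_Icc_succ_top (by omega), h1]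
      have h4 : ∑ i ∈ Finset.Icc 1 k, x i + x (k+1) - ((k+1:ℕ):ℝ)^(5/8:ℝ) *
          (M k + x (k+1) * ((k+1:ℕ):ℝ)^(-(5/8):ℝ)) =
          (∑ i ∈ Finset.Icc 1 k, x i - (k:ℝ)^(5/8:ℝ) * M k) -
            (((k+1:ℕ):ℝ)^(5/8:ℝ) - (k:ℝ)^(5/8:ℝ)) * M k := by
        linear_combination (-x (k+1)) * h2
      rw [h4]
      have h5 : |(((k+1:ℕ):ℝ)^(5/8:ℝ) - (k:ℝ)^(5/8:ℝ)) * M k| ≤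
          (((k+1:ℕ):ℝ)^(5/8:ℝ) - (k:ℝ)^(5/8:ℝ)) * B := by
        rw [abs_mul, abs_of_nonneg (sub_nonneg.2 h3)]
        exact mul_le_mul_of_nonneg_left (hB k) (sub_nonneg.2 h3)
      refine (abs_sub _ _).trans ?_
      linarith
  have h1 := key n
  have h2 : |(n:ℝ)^(5/8:ℝ) * M n| ≤ (n:ℝ)^(5/8:ℝ) * B := by
    rw [abs_mul, abs_of_nonneg (by positivity)]
    exact mul_le_mul_of_nonneg_left (hB n) (by positivity)
  have h3 := abs_add_le (∑ i ∈ Finset.Icc 1 n, x i - (n:ℝ)^(5/8:ℝ) * M n) ((n:ℝ)^(5/8:ℝ) * M n)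
  rw [sub_add_cancel] at h3
  linarith

theorem mart_bound {m0 : MeasurableSpace Ω} (P : Measure Ω) [IsProbabilityMeasure P]
    (ℱ : Filtration ℕ m0) (ξ : ℕ → Ω → ℝ) (K : ℝ)
    (hmeas : ∀ t, 1 ≤ t → Measurable[ℱ t] (ξ t))
    (hb : ∀ t, 1 ≤ t → ∀ᵐ ω ∂P, |ξ t ω| ≤ K)
    (hc : ∀ t, 1 ≤ t → P[ξ t|ℱ (t - 1)] =ᵐ[P] 0) :
    ∀ᵐ ω ∂P, ∃ C : ℝ, ∀ n : ℕ, |∑ i ∈ Finset.Icc 1 n, ξ i ω| ≤ C * (n:ℝ)^(5/8:ℝ) := by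
  set w : ℕ → ℝ := fun i => ((i+1:ℕ):ℝ)^(-(5/8):ℝ) with hw
  have hw0 : ∀ i, 0 ≤ w i := fun i => by positivity
  set M : ℕ → Ω → ℝ := fun n ω => ∑ i ∈ range n, ξ (i+1) ω * w i with hM
  have hMs : ∀ n, M (n+1) = M n + fun ω => ξ (n+1) ω * w n := by
    intro n; funext ω; simp only [hM, Pi.add_apply]; rw [Finset.sum_range_succ]
  have hmeas0 : ∀ i, Measurable (ξ (i+1)) := fun i => (hmeas (i+1) (by omega)).mono (ℱ.le _) le_rfl
  have hMmeas : ∀ n, Measurable[ℱ n] (M n) := by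
    intro n
    refine Finset.measurable_sum _ fun i hi => ?_
    have h1 : Measurable[ℱ n] (ξ (i+1)) :=
      (hmeas (i+1) (by omega)).mono (ℱ.mono (by have := Finset.mem_range.1 hi; omega)) le_rfl
    exact h1.mul_const _
  have hMmeas0 : ∀ n, Measurable (M n) := fun n => (hMmeas n).mono (ℱ.le _) le_rfl
  have hMb : ∀ n, ∃ B : ℝ, ∀ᵐ ω ∂P, |M n ω| ≤ B := by
    intro n
    induction n with
    | zero => exact ⟨0, by simp [hM]⟩
    | succ k ih =>
      obtain ⟨B, hB⟩ := ih
      refine ⟨B + K * w k, ?_⟩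
      filter_upwards [hB, hb (k+1) (by omega)] with ω h1 h2
      rw [hMs]
      simp only [Pi.add_apply]
      refine (abs_add_le _ _).trans (add_le_add h1 ?_)
      rw [abs_mul, abs_of_nonneg (hw0 k)]
      exact mul_le_mul_of_nonneg_right h2 (hw0 k)
  have hMint : ∀ n, Integrable (M n) P := by
    intro n
    obtain ⟨B, hB⟩ := hMb n
    exact Integrable.of_bound (hMmeas0 n).aestronglyMeasurable B hB
  have hM2int : ∀ n, Integrable (fun ω => M n ω ^ 2) P := by
    intro n
    obtain ⟨B, hB⟩ := hMb n
    refine Integrable.of_bound ((hMmeas0 n).pow_const 2).aestronglyMeasurable (B^2) ?_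
    filter_upwards [hB] with ω h
    rw [Real.norm_eq_abs, abs_pow]
    exact pow_le_pow_left₀ (abs_nonneg _) h 2
  have hξint : ∀ i, Integrable (ξ (i+1)) P := fun i =>
    Integrable.of_bound (hmeas0 i).aestronglyMeasurable K (hb (i+1) (by omega))
  have hMξint : ∀ n, Integrable (M n * ξ (n+1)) P := by
    intro n
    obtain ⟨B, hB⟩ := hMb n
    refine Integrable.of_bound ((hMmeas0 n).mul (hmeas0 n)).aestronglyMeasurable (B*K) ?_
    filter_upwards [hB, hb (n+1) (by omega)] with ω h h'
    rw [Real.norm_eq_abs, Pi.mul_apply, abs_mul]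
    exact mul_le_mul h h' (abs_nonneg _) ((abs_nonneg _).trans h)
  have horth : ∀ n, ∫ ω, (M n * ξ (n+1)) ω ∂P = 0 := by
    intro n
    have h1 := condExp_mul_of_stronglyMeasurable_left (μ := P) (m := ℱ n)
      (hMmeas n).stronglyMeasurable (hMξint n) (hξint n)
    have h2 := hc (n+1) (by omega)
    simp only [Nat.add_sub_cancel] at h2
    rw [← integral_condExp (ℱ.le n)]
    have : P[M n * ξ (n+1)|ℱ n] =ᵐ[P] fun _ => 0 := by
      filter_upwards [h1, h2] with ω h h'
      rw [h, Pi.mul_apply, h']; simp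
    rw [integral_congr_ae this]; simp
  have hmart : Martingale M ℱ P := by
    refine martingale_nat (fun n => (hMmeas n).stronglyMeasurable) hMint fun n => ?_
    have h2 := hc (n+1) (by omega)
    simp only [Nat.add_sub_cancel] at h2
    rw [hMs]
    have h3 : (fun ω => ξ (n+1) ω * w n) = w n • ξ (n+1) := by
      funext ω; simp [mul_comm]
    have h4 := condExp_add (hMint n) ((hξint n).smul (w n)) (ℱ n)
    have h5 := condExp_smul (μ := P) (w n) (ξ (n+1)) (ℱ n)
    have h6 := condExp_of_stronglyMeasurable (ℱ.le n) (hMmeas n).stronglyMeasurable (hMint n)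
    rw [h3]
    filter_upwards [h4, h5, h2] with ω h4 h5 h2
    rw [h4, Pi.add_apply, h5, Pi.smul_apply, h2, h6]; simp
  have hwsum : Summable (fun i => w i ^ 2) := by
    have h1 : Summable (fun n : ℕ => (n:ℝ)^(-(5/4):ℝ)) := by
      rw [Real.summable_nat_rpow]; norm_num
    have h2 := (summable_nat_add_iff 1).2 h1
    refine h2.congr fun i => ?_
    simp only [hw]
    rw [← Real.rpow_natCast, ← Real.rpow_mul (by positivity)]; norm_num
  have hL2 : ∀ n, ∫ ω, M n ω ^ 2 ∂P ≤ K^2 * ∑ i ∈ range n, w i ^ 2 := by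
    intro n
    induction n with
    | zero => simp [hM]
    | succ k ih =>
      have e1 : (fun ω => M (k+1) ω ^ 2) = fun ω => (M k ω ^ 2 + (2 * w k) * (M k * ξ (k+1)) ω)
          + (w k)^2 * (ξ (k+1) ω)^2 := by
        funext ω; rw [hMs]; simp only [Pi.add_apply, Pi.mul_apply]; ring
      have i3 : Integrable (fun ω => ξ (k+1) ω ^ 2) P := by
        refine Integrable.of_bound ((hmeas0 k).pow_const 2).aestronglyMeasurable (K^2) ?_
        filter_upwards [hb (k+1) (by omega)] with ω h
        rw [Real.norm_eq_abs, abs_pow]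
        exact pow_le_pow_left₀ (abs_nonneg _) h 2
      have e2 : ∫ ω, ξ (k+1) ω ^ 2 ∂P ≤ K^2 := by
        have : ∫ ω, ξ (k+1) ω ^ 2 ∂P ≤ ∫ ω, K^2 ∂P := by
          refine integral_mono_ae i3 (integrable_const _) ?_
          filter_upwards [hb (k+1) (by omega)] with ω h
          rw [← sq_abs]
          exact pow_le_pow_left₀ (abs_nonneg _) h 2
        simpa using this
      have i12 : Integrable (fun ω => M k ω ^ 2 + (2 * w k) * (M k * ξ (k+1)) ω) P :=
        (hM2int k).add ((hMξint k).const_mul _)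
      rw [e1, integral_add i12 (i3.const_mul _),
        integral_add (hM2int k) ((hMξint k).const_mul _), integral_const_mul, integral_const_mul,
        horth, Finset.sum_range_succ]
      nlinarith [sq_nonneg (w k)]
  have hbdd : ∀ n, eLpNorm (M n) 1 P ≤ ((1 + K^2 * ∑' i, w i ^ 2).toNNReal : ENNReal) := by
    intro n
    rw [eLpNorm_one_eq_lintegral_enorm, ← ofReal_integral_norm_eq_lintegral_enorm (hMint n)]
    refine ENNReal.ofReal_le_ofReal ?_
    have h1 : ∫ ω, ‖M n ω‖ ∂P ≤ ∫ ω, (1 + M n ω ^ 2) ∂P := by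
      refine integral_mono (hMint n).norm ((integrable_const _).add (hM2int n)) fun ω => ?_
      simp only [Real.norm_eq_abs]
      nlinarith [sq_abs (M n ω), sq_nonneg (|M n ω| - 1), abs_nonneg (M n ω)]
    rw [integral_add (integrable_const _) (hM2int n)] at h1
    have h2 := hwsum.sum_le_tsum (range n) (fun i _ => sq_nonneg (w i))
    have h3 := hL2 n
    have h4 := mul_le_mul_of_nonneg_left h2 (sq_nonneg K)
    simp at h1
    simp only [Real.norm_eq_abs]
    linarith
  filter_upwards [hmart.submartingale.exists_ae_tendsto_of_bdd hbdd] with ω ⟨c, hcω⟩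
  obtain ⟨B, hB⟩ := (hcω.abs).bddAbove_range
  refine ⟨2 * B, fun n => abel_bound (fun i => ξ i ω) B (fun n => ?_) n⟩
  exact hB ⟨n, rfl⟩

theorem cesaro_Icc {u : ℕ → ℝ} {l : ℝ} (h : Tendsto u atTop (nhds l)) :
    Tendsto (fun n : ℕ => (∑ i ∈ Finset.Icc 1 n, u i) / (n:ℝ)) atTop (nhds l) := by
  have h1 := ((tendsto_add_atTop_iff_nat 1).2 h).cesaro
  refine h1.congr fun n => ?_
  have : ∑ i ∈ Finset.Icc 1 n, u i = ∑ i ∈ range n, u (i+1) := by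
    induction n with
    | zero => simp
    | succ k ih => rw [Finset.sum_Icc_succ_top (by omega), Finset.sum_range_succ, ih]
  rw [this, div_eq_inv_mul]

theorem psiE_quad {x : ℝ} (h0 : 0 ≤ x) (h1 : x ≤ 1/2) : |psiE x - x^2/2| ≤ 2 * x^3 := by
  have h := Real.abs_log_sub_add_sum_range_le (x := x) (by rw [abs_of_nonneg h0]; linarith) 2
  rw [abs_of_nonneg h0] at h
  simp only [Finset.sum_range_succ, Finset.sum_range_zero] at h
  have e : psiE x - x^2/2 = -(0 + x ^ (0 + 1) / ((0:ℕ) + 1) + x ^ (1 + 1) / ((1:ℕ) + 1) +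
      Real.log (1 - x)) := by
    unfold psiE; push_cast; ring
  rw [e, abs_neg]
  refine h.trans ?_
  rw [div_le_iff₀ (by linarith)]
  have : 0 ≤ x^3 := by positivity
  norm_num
  nlinarith

theorem core_pos (c1 : ℝ) (hc1 : 0 < c1) (m Y ℓ : ℕ → ℝ) (V L : ℝ) (hV : 0 < V) (hL : 0 < L)
    (hm0 : ∀ i, 1 ≤ i → 0 < m i) (hm : Tendsto m atTop (nhds V))
    (hY : ∀ i, 1 ≤ i → 0 ≤ Y i ∧ Y i ≤ 1)
    (hYa : Tendsto (fun n : ℕ => (∑ i ∈ Finset.Icc 1 n, Y i) / (n:ℝ)) atTop (nhds V))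
    (hℓ : Tendsto ℓ atTop (nhds L)) (r : ℕ → ℕ → ℝ) (hr0 : ∀ n i, 0 ≤ r n i)
    (hr : Tendsto (fun n : ℕ => (∑ i ∈ Finset.Icc 1 n, r n i) / Real.sqrt n) atTop (nhds 0)) :
    Tendsto (fun n : ℕ => Real.sqrt n * ((ℓ n + ∑ i ∈ Finset.Icc 1 n,
        psiE (min (Real.sqrt (2 * ℓ n / (m i * (n:ℝ)))) c1) * Y i) /
        (∑ i ∈ Finset.Icc 1 n, min (Real.sqrt (2 * ℓ n / (m i * (n:ℝ)))) c1)))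
      atTop (nhds (Real.sqrt (2 * V * L))) ∧
    Tendsto (fun n : ℕ => Real.sqrt n * ((∑ i ∈ Finset.Icc 1 n,
        (min (Real.sqrt (2 * ℓ n / (m i * (n:ℝ)))) c1) * r n i) /
        (∑ i ∈ Finset.Icc 1 n, min (Real.sqrt (2 * ℓ n / (m i * (n:ℝ)))) c1)))
      atTop (nhds 0) := by
  set a : ℕ → ℝ := fun i => Real.sqrt (2 / m i) with ha
  have ha0 : ∀ i, 0 ≤ a i := fun i => Real.sqrt_nonneg _
  have hapos : ∀ i, 1 ≤ i → 0 < a i := fun i hi => Real.sqrt_pos.2 (div_pos two_pos (hm0 i hi))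
  have halim : Tendsto a atTop (nhds (Real.sqrt (2 / V))) :=
    (tendsto_const_nhds.div hm hV.ne').sqrt
  obtain ⟨A, hA⟩ := halim.bddAbove_range
  have hA' : ∀ i, a i ≤ A := fun i => hA ⟨i, rfl⟩
  have hA0 : 0 ≤ A := (ha0 0).trans (hA' 0)
  set b : ℕ → ℝ := fun n => Real.sqrt (ℓ n) / Real.sqrt n with hb
  have hsn : Tendsto (fun n : ℕ => Real.sqrt n) atTop atTop :=
    Real.tendsto_sqrt_atTop.comp tendsto_natCast_atTop_atTop
  have hblim : Tendsto b atTop (nhds 0) := hℓ.sqrt.div_atTop hsn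
  have hbA : Tendsto (fun n => b n * A) atTop (nhds 0) := by simpa using hblim.mul_const A
  have hb0 : ∀ n, 0 ≤ b n := fun n => by positivity
  have ev1 : ∀ᶠ n in atTop, b n * A ≤ min c1 (1/2) :=
    (hbA.eventually_lt_const (by positivity)).mono fun n h => h.le
  have ev2 : ∀ᶠ n in atTop, 0 < ℓ n := hℓ.eventually_const_lt hL
  have ev3 : ∀ᶠ n : ℕ in atTop, 1 ≤ n := eventually_ge_atTop 1
  have evlam : ∀ᶠ n : ℕ in atTop, ∀ i ∈ Finset.Icc 1 n,
      min (Real.sqrt (2 * ℓ n / (m i * (n:ℝ)))) c1 = b n * a i := by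
    filter_upwards [ev1, ev2, ev3] with n h1 h2 h3 i hi
    have hi1 := (Finset.mem_Icc.1 hi).1
    have e : Real.sqrt (2 * ℓ n / (m i * (n:ℝ))) = b n * a i := by
      simp only [hb, ha]
      rw [← Real.sqrt_div h2.le, ← Real.sqrt_mul (by positivity)]
      congr 1
      have := hm0 i hi1
      field_simp
    rw [e]
    refine min_eq_left ?_
    exact (mul_le_mul_of_nonneg_left (hA' i) (hb0 n)).trans (h1.trans (min_le_left _ _))
  have hsa := cesaro_Icc halim
  have hsVpos : 0 < Real.sqrt (2 / V) := Real.sqrt_pos.2 (by positivity)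
  have hsq : ∀ i, 1 ≤ i → a i ^ 2 = 2 / m i := fun i hi =>
    Real.sq_sqrt (by have := hm0 i hi; positivity)
  -- average of a_i^2/2 * Y_i
  have hq : Tendsto (fun n : ℕ => (∑ i ∈ Finset.Icc 1 n, a i ^ 2 / 2 * Y i) / (n:ℝ))
      atTop (nhds 1) := by
    have h1 : Tendsto (fun i => |a i ^ 2 / 2 - 1 / V|) atTop (nhds 0) := by
      have h2 : Tendsto (fun i => a i ^ 2 / 2) atTop (nhds (Real.sqrt (2/V) ^ 2 / 2)) :=
        (halim.pow 2).div_const 2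
      rw [Real.sq_sqrt (by positivity)] at h2
      have h3 := (h2.sub_const (1/V)).abs
      have e : |2 / V / 2 - 1 / V| = 0 := by
        rw [abs_eq_zero]; field_simp; norm_num
      rwa [e] at h3
    have h4 := cesaro_Icc h1
    have h5 : Tendsto (fun n : ℕ => (∑ i ∈ Finset.Icc 1 n, (a i ^ 2 / 2 - 1/V) * Y i) / (n:ℝ))
        atTop (nhds 0) := by
      refine squeeze_zero_norm (fun n => ?_) h4
      rw [Real.norm_eq_abs, abs_div, Nat.abs_cast]
      refine div_le_div_of_nonneg_right ?_ (Nat.cast_nonneg n)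
      refine (Finset.abs_sum_le_sum_abs _ _).trans (Finset.sum_le_sum fun i hi => ?_)
      have hYi := hY i (Finset.mem_Icc.1 hi).1
      rw [abs_mul, abs_of_nonneg hYi.1]
      exact mul_le_of_le_one_right (abs_nonneg _) hYi.2
    have h6 := h5.add (hYa.const_mul (1/V))
    have e : 0 + 1 / V * V = 1 := by field_simp; norm_num
    rw [e] at h6
    refine h6.congr fun n => ?_
    rw [← mul_div_assoc, ← add_div, Finset.mul_sum, ← Finset.sum_add_distrib]
    congr 1
    refine Finset.sum_congr rfl fun i _ => by ring
  have hE : Tendsto (fun n : ℕ => ∑ i ∈ Finset.Icc 1 n,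
      (psiE (b n * a i) - (b n * a i)^2/2) * Y i) atTop (nhds 0) := by
    have h1 : Tendsto (fun n : ℕ => 2 * (Real.sqrt (ℓ n) ^ 2) * A^3 * b n) atTop (nhds 0) := by
      have := (((hℓ.sqrt.pow 2).const_mul 2).mul_const (A^3)).mul hblim
      simpa using this
    refine squeeze_zero_norm' ?_ h1
    filter_upwards [ev1, ev2, ev3] with n h1 h2 h3
    rw [Real.norm_eq_abs]
    have hbound : ∀ i ∈ Finset.Icc 1 n, |(psiE (b n * a i) - (b n * a i)^2/2) * Y i| ≤
        2 * (b n * A)^3 := by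
      intro i hi
      have hYi := hY i (Finset.mem_Icc.1 hi).1
      have hle := mul_le_mul_of_nonneg_left (hA' i) (hb0 n)
      have h0 : 0 ≤ b n * a i := mul_nonneg (hb0 n) (ha0 i)
      rw [abs_mul, abs_of_nonneg hYi.1]
      refine (mul_le_of_le_one_right (abs_nonneg _) hYi.2).trans ?_
      refine (psiE_quad h0 (hle.trans (h1.trans (min_le_right _ _)))).trans ?_
      have := pow_le_pow_left₀ h0 hle 3
      linarith
    refine (Finset.abs_sum_le_sum_abs _ _).trans ((Finset.sum_le_sum hbound).trans (le_of_eq ?_))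
    rw [Finset.sum_const, Nat.card_Icc, nsmul_eq_mul]
    simp only [Nat.add_sub_cancel]
    have e : (n:ℝ) * b n ^ 2 = Real.sqrt (ℓ n) ^ 2 := by
      simp only [hb]
      rw [div_pow, Real.sq_sqrt (Nat.cast_nonneg n)]
      have : (n:ℝ) ≠ 0 := by positivity
      field_simp
    rw [← e]; ring
  have hN : Tendsto (fun n : ℕ => ℓ n + ∑ i ∈ Finset.Icc 1 n, psiE (b n * a i) * Y i)
      atTop (nhds (2 * L)) := by
    have h1 := (hℓ.add (hℓ.mul hq)).add hE
    have e : L + L * 1 + 0 = 2 * L := by ring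
    rw [e] at h1
    refine h1.congr' ?_
    filter_upwards [ev2, ev3] with n h2 h3
    have e : b n ^ 2 = ℓ n / n := by
      simp only [hb]
      rw [div_pow, Real.sq_sqrt (Nat.cast_nonneg n), Real.sq_sqrt h2.le]
    have e2 : ℓ n * ((∑ i ∈ Finset.Icc 1 n, a i ^ 2 / 2 * Y i) / (n:ℝ)) =
        ∑ i ∈ Finset.Icc 1 n, (b n * a i)^2/2 * Y i := by
      rw [← mul_div_assoc, mul_div_right_comm, ← e, Finset.mul_sum]
      exact Finset.sum_congr rfl fun i _ => by ring
    rw [e2, add_assoc, ← Finset.sum_add_distrib]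
    congr 1
    exact Finset.sum_congr rfl fun i _ => by ring
  have hden : Real.sqrt L * Real.sqrt (2/V) ≠ 0 := by
    have := Real.sqrt_pos.2 hL
    positivity
  have hsumpos : ∀ n : ℕ, 1 ≤ n → 0 < ∑ i ∈ Finset.Icc 1 n, a i := fun n hn =>
    Finset.sum_pos (fun i hi => hapos i (Finset.mem_Icc.1 hi).1) ⟨1, by simp [hn]⟩
  constructor
  · have h1 := hN.div (hℓ.sqrt.mul hsa) hden
    have e : 2 * L / (Real.sqrt L * Real.sqrt (2/V)) = Real.sqrt (2 * V * L) := by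
      rw [div_eq_iff hden, ← Real.sqrt_mul hL.le, ← Real.sqrt_mul (by positivity)]
      have : 2 * V * L * (L * (2/V)) = (2*L)^2 := by field_simp
      rw [this, Real.sqrt_sq (by positivity)]
    rw [e] at h1
    refine h1.congr' ?_
    filter_upwards [evlam, ev2, ev3] with n h1 h2 h3
    rw [Finset.sum_congr rfl h1, ← Finset.mul_sum]
    have e3 : ∑ i ∈ Finset.Icc 1 n, psiE (min (Real.sqrt (2 * ℓ n / (m i * (n:ℝ)))) c1) * Y i =
        ∑ i ∈ Finset.Icc 1 n, psiE (b n * a i) * Y i :=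
      Finset.sum_congr rfl fun i hi => by rw [h1 i hi]
    rw [e3]
    simp only [hb, Pi.div_apply]
    have hs := hsumpos n h3
    have hsl := Real.sqrt_pos.2 h2
    have hn : (0:ℝ) < n := by positivity
    have hsn' := Real.sqrt_pos.2 hn
    have hss := Real.sq_sqrt hn.le
    generalize ℓ n + ∑ i ∈ Finset.Icc 1 n, psiE (Real.sqrt (ℓ n) / Real.sqrt n * a i) * Y i = N
    field_simp
    rw [hss]
  · have h1 : Tendsto (fun n : ℕ => A * (((∑ i ∈ Finset.Icc 1 n, r n i) / Real.sqrt n) /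
        ((∑ i ∈ Finset.Icc 1 n, a i) / (n:ℝ)))) atTop (nhds 0) := by
      have := (hr.div hsa hsVpos.ne').const_mul A
      simpa using this
    refine squeeze_zero' ?_ ?_ h1
    · refine Eventually.of_forall fun n => ?_
      have h0 : ∀ i, 0 ≤ min (Real.sqrt (2 * ℓ n / (m i * (n:ℝ)))) c1 := fun i =>
        le_min (Real.sqrt_nonneg _) hc1.le
      exact mul_nonneg (Real.sqrt_nonneg _) (div_nonneg
        (Finset.sum_nonneg fun i _ => mul_nonneg (h0 i) (hr0 n i)) (Finset.sum_nonneg fun i _ => h0 i))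
    · filter_upwards [evlam, ev2, ev3] with n h1 h2 h3
      rw [Finset.sum_congr rfl h1, ← Finset.mul_sum]
      have e3 : ∑ i ∈ Finset.Icc 1 n, min (Real.sqrt (2 * ℓ n / (m i * (n:ℝ)))) c1 * r n i ≤
          b n * (A * ∑ i ∈ Finset.Icc 1 n, r n i) := by
        rw [Finset.mul_sum, Finset.mul_sum]
        refine Finset.sum_le_sum fun i hi => ?_
        rw [h1 i hi, mul_assoc]
        exact mul_le_mul_of_nonneg_left (mul_le_mul_of_nonneg_right (hA' i) (hr0 n i)) (hb0 n)
      have hs := hsumpos n h3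
      have hsl := Real.sqrt_pos.2 h2
      have hn : (0:ℝ) < n := by positivity
      have hsn' := Real.sqrt_pos.2 hn
      have hss := Real.sq_sqrt hn.le
      have hbp : 0 < b n := by positivity
      calc _ ≤ Real.sqrt n * ((b n * (A * ∑ i ∈ Finset.Icc 1 n, r n i)) /
            (b n * ∑ i ∈ Finset.Icc 1 n, a i)) := by gcongr
        _ = _ := by
          rw [mul_div_mul_left _ _ hbp.ne']
          field_simp
          rw [hss]
          ring

theorem core_zero (c1 : ℝ) (hc1 : 0 < c1) (hc1' : c1 < 1) (m Y ℓ : ℕ → ℝ) (C L : ℝ)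
    (hC : 0 < C) (hL : 0 < L)
    (hm0 : ∀ i, 1 ≤ i → 0 < m i)
    (hm : ∀ n i : ℕ, 1 ≤ i → i ≤ n → m i ≤ C * (n:ℝ)^(1/4:ℝ) / i)
    (hY : ∀ i, 1 ≤ i → 0 ≤ Y i)
    (hYa : ∀ n : ℕ, ∑ i ∈ Finset.Icc 1 n, Y i ≤ C * (n:ℝ)^(1/4:ℝ))
    (hℓ : Tendsto ℓ atTop (nhds L)) (r : ℕ → ℕ → ℝ) (hr0 : ∀ n i, 0 ≤ r n i)
    (hr : ∀ᶠ n : ℕ in atTop, ∑ i ∈ Finset.Icc 1 n, r n i ≤ C * (n:ℝ)^(1/4:ℝ)) :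
    Tendsto (fun n : ℕ => Real.sqrt n * ((ℓ n + ∑ i ∈ Finset.Icc 1 n,
        psiE (min (Real.sqrt (2 * ℓ n / (m i * (n:ℝ)))) c1) * Y i) /
        (∑ i ∈ Finset.Icc 1 n, min (Real.sqrt (2 * ℓ n / (m i * (n:ℝ)))) c1)))
      atTop (nhds 0) ∧
    Tendsto (fun n : ℕ => Real.sqrt n * ((∑ i ∈ Finset.Icc 1 n,
        (min (Real.sqrt (2 * ℓ n / (m i * (n:ℝ)))) c1) * r n i) /
        (∑ i ∈ Finset.Icc 1 n, min (Real.sqrt (2 * ℓ n / (m i * (n:ℝ)))) c1)))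
      atTop (nhds 0) := by
  set lam : ℕ → ℕ → ℝ := fun n i => min (Real.sqrt (2 * ℓ n / (m i * (n:ℝ)))) c1 with hlam
  have hlam0 : ∀ n i, 0 ≤ lam n i := fun n i => le_min (Real.sqrt_nonneg _) hc1.le
  have hlam1 : ∀ n i, lam n i ≤ c1 := fun n i => min_le_right _ _
  set κ : ℝ := min (Real.sqrt (L / C)) c1 with hκ
  have hκ0 : 0 < κ := lt_min (Real.sqrt_pos.2 (by positivity)) hc1
  have ev2 : ∀ᶠ n in atTop, L / 2 < ℓ n := hℓ.eventually_const_lt (by linarith)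
  have ev2' : ∀ᶠ n in atTop, ℓ n < L + 1 := hℓ.eventually_lt_const (by linarith)
  have ev3 : ∀ᶠ n : ℕ in atTop, 1 ≤ n := eventually_ge_atTop 1
  have hS : ∀ᶠ n : ℕ in atTop, κ / 2 * (n:ℝ)^(7/8:ℝ) ≤ ∑ i ∈ Finset.Icc 1 n, lam n i := by
    filter_upwards [ev2, ev3] with n h2 h3
    have hn : (0:ℝ) < n := by positivity
    have hn1 : (1:ℝ) ≤ n := by exact_mod_cast h3
    have h4 : ∀ i ∈ Finset.Icc 1 n, (κ * (n:ℝ)^(-(9/8):ℝ)) * (i:ℝ) ≤ lam n i := by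
      intro i hi
      obtain ⟨hi1, hin⟩ := Finset.mem_Icc.1 hi
      have hi0 : (0:ℝ) < i := by positivity
      have hin' : (i:ℝ) ≤ n := by exact_mod_cast hin
      have hmi := hm0 i hi1
      refine le_min ?_ ?_
      · refine Real.le_sqrt_of_sq_le ?_
        have e1 : (κ * (n:ℝ)^(-(9/8):ℝ) * (i:ℝ))^2 = κ^2 * ((n:ℝ)^(-(9/4):ℝ) * ((i:ℝ) * i)) := by
          have : ((n:ℝ)^(-(9/8):ℝ))^2 = (n:ℝ)^(-(9/4):ℝ) := by
            rw [← Real.rpow_natCast, ← Real.rpow_mul hn.le]; norm_num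
          rw [mul_pow, mul_pow, this]; ring
        have e2 : κ^2 ≤ L / C := by
          have h := pow_le_pow_left₀ hκ0.le (min_le_left (Real.sqrt (L/C)) c1) 2
          rwa [Real.sq_sqrt (by positivity)] at h
        have e3 : (n:ℝ)^(-(9/4):ℝ) * n = (n:ℝ)^(-(5/4):ℝ) := by
          nth_rewrite 2 [← Real.rpow_one (n:ℝ)]
          rw [← Real.rpow_add hn]; norm_num
        have e4 : (n:ℝ)^(1/4:ℝ) * n * (n:ℝ)^(-(5/4):ℝ) = 1 := by
          nth_rewrite 2 [← Real.rpow_one (n:ℝ)]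
          rw [← Real.rpow_add hn, ← Real.rpow_add hn]; norm_num
        rw [e1]
        calc κ^2 * ((n:ℝ)^(-(9/4):ℝ) * ((i:ℝ) * i)) ≤ L / C * ((n:ℝ)^(-(9/4):ℝ) * ((n:ℝ) * i)) := by
              gcongr
          _ = L / C * ((n:ℝ)^(-(5/4):ℝ) * i) := by rw [← e3]; ring
          _ = L / ((C * (n:ℝ)^(1/4:ℝ) / i) * n) := by
              rw [eq_div_iff (by positivity)]
              have : L / C * ((n:ℝ)^(-(5/4):ℝ) * i) * (C * (n:ℝ)^(1/4:ℝ) / i * n) =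
                L * ((n:ℝ)^(1/4:ℝ) * n * (n:ℝ)^(-(5/4):ℝ)) := by field_simp
              rw [this, e4, mul_one]
          _ ≤ 2 * ℓ n / (m i * (n:ℝ)) := by
              have := hm n i hi1 hin
              gcongr <;> linarith
      · have h5 : (n:ℝ)^(-(9/8):ℝ) * (i:ℝ) ≤ 1 := by
          calc (n:ℝ)^(-(9/8):ℝ) * (i:ℝ) ≤ (n:ℝ)^(-1:ℝ) * n := by
                gcongr
                norm_num
            _ = 1 := by rw [Real.rpow_neg_one]; field_simp
        calc κ * (n:ℝ)^(-(9/8):ℝ) * (i:ℝ) = κ * ((n:ℝ)^(-(9/8):ℝ) * (i:ℝ)) := by ring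
          _ ≤ κ * 1 := by gcongr
          _ ≤ c1 := by rw [mul_one]; exact min_le_right _ _
    refine le_trans ?_ (Finset.sum_le_sum h4)
    rw [← Finset.mul_sum]
    have h6 : (n:ℝ) * n / 2 ≤ ∑ i ∈ Finset.Icc 1 n, (i:ℝ) := by
      have : ∀ k : ℕ, (k:ℝ) * k / 2 ≤ ∑ i ∈ Finset.Icc 1 k, (i:ℝ) := by
        intro k
        induction k with
        | zero => simp
        | succ k ih =>
          rw [Finset.sum_Icc_succ_top (by omega)]
          push_cast
          have : (0:ℝ) ≤ k := Nat.cast_nonneg k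
          nlinarith
      exact this n
    have e7 : (n:ℝ)^(-(9/8):ℝ) * ((n:ℝ) * n) = (n:ℝ)^(7/8:ℝ) := by
      have : (n:ℝ) * n = (n:ℝ)^(2:ℝ) := by norm_num [sq]
      rw [this, ← Real.rpow_add hn]; norm_num
    calc κ / 2 * (n:ℝ)^(7/8:ℝ) = κ * (n:ℝ)^(-(9/8):ℝ) * ((n:ℝ) * n / 2) := by rw [← e7]; ring
      _ ≤ _ := by gcongr
  have key : ∀ (N : ℕ → ℝ) (C' : ℝ), (∀ᶠ n : ℕ in atTop, 0 ≤ N n) →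
      (∀ᶠ n : ℕ in atTop, N n ≤ C' * (n:ℝ)^(1/4:ℝ)) →
      Tendsto (fun n : ℕ => Real.sqrt n * (N n / ∑ i ∈ Finset.Icc 1 n, lam n i)) atTop (nhds 0) := by
    intro N C' hN0 hN
    have h1 : Tendsto (fun n : ℕ => (C' / (κ/2)) * (n:ℝ)^(-(1/8):ℝ)) atTop (nhds 0) := by
      have := ((tendsto_rpow_neg_atTop (y := 1/8) (by norm_num)).comp
        tendsto_natCast_atTop_atTop).const_mul (C' / (κ/2))
      simpa using this
    refine squeeze_zero' ?_ ?_ h1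
    · filter_upwards [hN0] with n h
      exact mul_nonneg (Real.sqrt_nonneg _) (div_nonneg h (Finset.sum_nonneg fun i _ => hlam0 n i))
    · filter_upwards [hN0, hN, hS, ev3] with n h0 h1 h2 h3
      have hn : (0:ℝ) < n := by positivity
      calc _ ≤ Real.sqrt n * (C' * (n:ℝ)^(1/4:ℝ) / (κ / 2 * (n:ℝ)^(7/8:ℝ))) := by
            have : 0 ≤ C' * (n:ℝ)^(1/4:ℝ) := h0.trans h1
            gcongr
        _ = _ := by
            have e : Real.sqrt n * (n:ℝ)^(1/4:ℝ) = (n:ℝ)^(-(1/8):ℝ) * (n:ℝ)^(7/8:ℝ) := by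
              rw [Real.sqrt_eq_rpow, ← Real.rpow_add hn, ← Real.rpow_add hn]; norm_num
            have : (n:ℝ)^(7/8:ℝ) ≠ 0 := by positivity
            field_simp
            linear_combination C' * e
  have hone : ∀ n : ℕ, 1 ≤ n → (1:ℝ) ≤ (n:ℝ)^(1/4:ℝ) := fun n hn =>
    Real.one_le_rpow (by exact_mod_cast hn) (by norm_num)
  have hpsi : ∀ n i, 0 ≤ psiE (lam n i) ∧ psiE (lam n i) ≤ -Real.log (1 - c1) := by
    intro n i
    have h0 := hlam0 n i
    have h1 := hlam1 n i
    unfold psiE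
    constructor
    · have := Real.log_le_sub_one_of_pos (show 0 < 1 - lam n i by linarith)
      linarith
    · have := Real.log_le_log (show 0 < 1 - c1 by linarith) (show 1 - c1 ≤ 1 - lam n i by linarith)
      linarith
  constructor
  · refine key (fun n => ℓ n + ∑ i ∈ Finset.Icc 1 n, psiE (lam n i) * Y i)
      (L + 1 + (-Real.log (1 - c1)) * C) ?_ ?_
    · filter_upwards [ev2] with n h2
      have : 0 ≤ ∑ i ∈ Finset.Icc 1 n, psiE (lam n i) * Y i :=
        Finset.sum_nonneg fun i hi => mul_nonneg (hpsi n i).1 (hY i (Finset.mem_Icc.1 hi).1)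
      linarith
    · filter_upwards [ev2', ev3] with n h2 h3
      have hK : 0 ≤ -Real.log (1 - c1) := (hpsi 0 0).1.trans (hpsi 0 0).2
      have h4 : ∑ i ∈ Finset.Icc 1 n, psiE (lam n i) * Y i ≤
          (-Real.log (1 - c1)) * (C * (n:ℝ)^(1/4:ℝ)) := by
        refine le_trans ?_ (mul_le_mul_of_nonneg_left (hYa n) hK)
        rw [Finset.mul_sum]
        exact Finset.sum_le_sum fun i hi =>
          mul_le_mul_of_nonneg_right (hpsi n i).2 (hY i (Finset.mem_Icc.1 hi).1)
      have h5 := hone n h3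
      nlinarith
  · refine key (fun n => ∑ i ∈ Finset.Icc 1 n, lam n i * r n i) (c1 * C) ?_ ?_
    · exact Eventually.of_forall fun n => Finset.sum_nonneg fun i _ => mul_nonneg (hlam0 n i) (hr0 n i)
    · filter_upwards [hr] with n h
      rw [mul_assoc]
      refine le_trans ?_ (mul_le_mul_of_nonneg_left h hc1.le)
      rw [Finset.mul_sum]
      exact Finset.sum_le_sum fun i _ => mul_le_mul_of_nonneg_right (hlam1 n i) (hr0 n i)

theorem sum_rpow_le (s : ℝ) (hs0 : 0 < s) (hs1 : s < 1) (n : ℕ) :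
    ∑ i ∈ Finset.Icc 1 n, (i:ℝ)^(-s) ≤ 1 / (1 - s) * (n:ℝ)^(1-s) := by
  have h1s : 0 < 1 - s := by linarith
  induction n with
  | zero => simp; positivity
  | succ k ih =>
    rw [Finset.sum_Icc_succ_top (by omega)]
    have hk : (0:ℝ) < ((k+1:ℕ):ℝ) := by positivity
    have h1 := rpow_one_add_le_one_add_mul_self (s := -1 / ((k+1:ℕ):ℝ)) (p := 1 - s)
      (by rw [le_div_iff₀ hk]; push_cast; linarith [(Nat.cast_nonneg k : (0:ℝ) ≤ k)]) h1s.le (by linarith)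
    have e1 : (k:ℝ) = ((k+1:ℕ):ℝ) * (1 + -1 / ((k+1:ℕ):ℝ)) := by
      field_simp; push_cast; ring
    have h0 : 0 ≤ 1 + -1 / ((k+1:ℕ):ℝ) := by
      have : 0 ≤ ((k+1:ℕ):ℝ) * (1 + -1 / ((k+1:ℕ):ℝ)) := by rw [← e1]; positivity
      exact nonneg_of_mul_nonneg_right this hk
    have e2 : (k:ℝ)^(1-s) = ((k+1:ℕ):ℝ)^(1-s) * (1 + -1 / ((k+1:ℕ):ℝ))^(1-s) := by
      rw [← Real.mul_rpow hk.le h0, ← e1]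
    have e3 : ((k+1:ℕ):ℝ)^(1-s) = ((k+1:ℕ):ℝ) * ((k+1:ℕ):ℝ)^(-s) := by
      rw [sub_eq_add_neg, Real.rpow_add hk, Real.rpow_one]
    have h2 : (k:ℝ)^(1-s) ≤ ((k+1:ℕ):ℝ)^(1-s) - (1-s) * ((k+1:ℕ):ℝ)^(-s) := by
      rw [e2]
      refine (mul_le_mul_of_nonneg_left h1 (by positivity)).trans (le_of_eq ?_)
      rw [e3]
      field_simp
      ring
    have h3 := mul_le_mul_of_nonneg_left h2 (show 0 ≤ 1/(1-s) by positivity)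
    have e4 : 1/(1-s) * (((k+1:ℕ):ℝ)^(1-s) - (1-s) * ((k+1:ℕ):ℝ)^(-s)) =
        1/(1-s) * ((k+1:ℕ):ℝ)^(1-s) - ((k+1:ℕ):ℝ)^(-s) := by
      field_simp
    rw [e4] at h3
    linarith

theorem psiP_bound {x c : ℝ} (h0 : 0 ≤ x) (h1 : x ≤ c) : psiP x ≤ Real.exp c * x^2 := by
  have h2 : Real.exp x - 1 ≤ x * Real.exp x := by
    have h := Real.add_one_le_exp (-x)
    have h3 := mul_le_mul_of_nonneg_right h (Real.exp_pos x).le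
    rw [← Real.exp_add] at h3
    simp at h3
    linarith
  have h4 : Real.exp x ≤ Real.exp c := Real.exp_le_exp.2 h1
  unfold psiP
  have h5 := mul_le_mul_of_nonneg_left h2 h0
  have h6 := mul_le_mul_of_nonneg_left h4 (sq_nonneg x)
  nlinarith

theorem harm_le {j n : ℕ} (hj : 1 ≤ j) (hjn : j ≤ n) :
    ∑ k ∈ Finset.Icc 1 j, ((k:ℝ))⁻¹ ≤ 1 + Real.log n := by
  have h := harmonic_le_one_add_log j
  rw [harmonic_eq_sum_Icc] at h
  push_cast at h
  refine h.trans ?_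
  have : Real.log j ≤ Real.log n := Real.log_le_log (by positivity) (by exact_mod_cast hjn)
  linarith

theorem bennett (c3 c4 c5 σ2 : ℝ) (X : ℕ → Ω → ℝ) (ω : Ω) (a : ℕ → ℝ)
    (hc5 : 0 < c5) (hσ : 0 ≤ σ2)
    (hs : ∀ k, 1 ≤ k → 0 < sigHat2 c3 c4 X k ω ∧ sigHat2 c3 c4 X k ω ≤ 1)
    (hs' : 0 < σ2 → ∃ c > 0, ∀ k, 1 ≤ k → c ≤ sigHat2 c3 c4 X k ω)
    (ha1 : ∀ᶠ n in atTop, 1 ≤ Real.log (2 / a n))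
    (ha2 : ∀ᶠ n : ℕ in atTop, Real.log (2 / a n) * (1 + Real.log n) ≤ (n:ℝ)^(1/16:ℝ)) :
    ∃ C : ℝ, ∀ᶠ n : ℕ in atTop, ∑ i ∈ Finset.Icc 1 n, (Rtilde c3 c4 c5 σ2 X (a n) i ω)^2
      ≤ C * (n:ℝ)^(1/4:ℝ) := by
  set s : ℕ → ℝ := fun k => sigHat2 c3 c4 X k ω with hsdef
  set κ : ℝ := min (1/3) c5 with hκ
  have hκ0 : 0 < κ := lt_min (by norm_num) hc5
  have hlog2 : 0 < Real.log 2 := Real.log_pos (by norm_num)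
  have hlogk : ∀ k : ℕ, 1 ≤ k → Real.log 2 ≤ Real.log (1 + (k:ℝ)) := fun k hk =>
    Real.log_le_log two_pos (by have : (1:ℝ) ≤ k := by exact_mod_cast hk
                                linarith)
  -- lower bound on the plug-ins
  have hlow : ∀ n k : ℕ, 1 ≤ Real.log (2 / a n) → 1 ≤ k →
      κ * (k:ℝ)^(-(9/16):ℝ) ≤ lamT c3 c4 c5 X (a n) k ω := by
    intro n k hn hk
    have hk1 : (1:ℝ) ≤ k := by exact_mod_cast hk
    have hk0 : (0:ℝ) < k := by linarith
    have hlk := hlogk k hk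
    obtain ⟨hs0, hs1⟩ := hs k hk
    unfold lamT
    refine le_min ?_ ?_
    · refine Real.le_sqrt_of_sq_le ?_
      have e1 : (κ * (k:ℝ)^(-(9/16):ℝ))^2 = κ^2 * (k:ℝ)^(-(9/8):ℝ) := by
        rw [mul_pow]
        congr 1
        rw [← Real.rpow_natCast, ← Real.rpow_mul hk0.le]; norm_num
      have h2 : κ^2 ≤ 1/8 := by
        have := pow_le_pow_left₀ hκ0.le (min_le_left (1/3) c5) 2
        norm_num at this ⊢
        linarith
      have h3 : Real.log (1 + (k:ℝ)) ≤ 16 * (k:ℝ)^(1/8:ℝ) := by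
        have h4 := Real.log_le_rpow_div (x := 1 + (k:ℝ)) (ε := 1/8) (by linarith) (by norm_num)
        have h5 : (1 + (k:ℝ))^(1/8:ℝ) ≤ (2 * (k:ℝ))^(1/8:ℝ) :=
          Real.rpow_le_rpow (by linarith) (by linarith) (by norm_num)
        rw [Real.mul_rpow (by norm_num) hk0.le] at h5
        have h6 : (2:ℝ)^(1/8:ℝ) ≤ 2 := by
          have := Real.rpow_le_rpow_of_exponent_le (x := 2) (by norm_num) (show (1/8:ℝ) ≤ 1 by norm_num)
          simpa using this
        have h7 : 0 ≤ (k:ℝ)^(1/8:ℝ) := by positivity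
        have h8 : (1 + (k:ℝ))^(1/8:ℝ) ≤ 2 * (k:ℝ)^(1/8:ℝ) :=
          h5.trans (mul_le_mul_of_nonneg_right h6 h7)
        have h9 : (1 + (k:ℝ))^(1/8:ℝ) / (1/8) = 8 * (1 + (k:ℝ))^(1/8:ℝ) := by ring
        linarith
      have e4 : (k:ℝ)^(-(9/8):ℝ) * (k * (k:ℝ)^(1/8:ℝ)) = 1 := by
        nth_rewrite 2 [← Real.rpow_one (k:ℝ)]
        rw [← Real.rpow_add hk0, ← Real.rpow_add hk0]; norm_num
      rw [e1]
      calc κ^2 * (k:ℝ)^(-(9/8):ℝ) ≤ 1/8 * (k:ℝ)^(-(9/8):ℝ) := by gcongr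
        _ = 2 * 1 / (1 * k * (16 * (k:ℝ)^(1/8:ℝ))) := by
          rw [eq_div_iff (by positivity)]
          linear_combination 2 * e4
        _ ≤ _ := by
          have : 0 < Real.log (1 + (k:ℝ)) := hlog2.trans_le hlk
          gcongr
    · have : (k:ℝ)^(-(9/16):ℝ) ≤ 1 := Real.rpow_le_one_of_one_le_of_nonpos hk1 (by norm_num)
      calc _ ≤ κ * 1 := by gcongr
        _ ≤ c5 := by rw [mul_one]; exact min_le_right _ _
  have hsumlow : ∀ n j : ℕ, 1 ≤ Real.log (2 / a n) → 1 ≤ j →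
      κ * (j:ℝ)^(7/16:ℝ) ≤ ∑ k ∈ Finset.Icc 1 j, lamT c3 c4 c5 X (a n) k ω := by
    intro n j hn hj
    have hj0 : (0:ℝ) < j := by positivity
    have h1 : ∀ k ∈ Finset.Icc 1 j, κ * (j:ℝ)^(-(9/16):ℝ) ≤ lamT c3 c4 c5 X (a n) k ω := by
      intro k hk
      obtain ⟨hk1, hkj⟩ := Finset.mem_Icc.1 hk
      refine le_trans ?_ (hlow n k hn hk1)
      refine mul_le_mul_of_nonneg_left ?_ hκ0.le
      exact Real.rpow_le_rpow_of_nonpos (by positivity) (by exact_mod_cast hkj) (by norm_num)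
    refine le_trans (le_of_eq ?_) (Finset.sum_le_sum h1)
    rw [Finset.sum_const, Nat.card_Icc, nsmul_eq_mul]
    simp only [Nat.add_sub_cancel]
    have : (j:ℝ)^(7/16:ℝ) = j * (j:ℝ)^(-(9/16):ℝ) := by
      nth_rewrite 2 [← Real.rpow_one (j:ℝ)]
      rw [← Real.rpow_add hj0]; norm_num
    rw [this]; ring
  have hlamT0 : ∀ n k, 0 ≤ lamT c3 c4 c5 X (a n) k ω := fun n k =>
    le_min (Real.sqrt_nonneg _) hc5.le
  have hpsi0 : ∀ x, 0 ≤ psiP x := fun x => by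
    unfold psiP; linarith [Real.add_one_le_exp x]
  -- upper bound on the psi-sum
  have hup : ∃ D : ℝ, 0 ≤ D ∧ ∀ n j : ℕ, 1 ≤ Real.log (2 / a n) → 1 ≤ j → j ≤ n →
      σ2 * ∑ k ∈ Finset.Icc 1 j, psiP (lamT c3 c4 c5 X (a n) k ω) ≤
        D * (Real.log (2 / a n) * (1 + Real.log n)) := by
    rcases hσ.eq_or_lt with h | h
    · refine ⟨0, le_rfl, fun n j _ _ _ => ?_⟩
      rw [← h]; simp
    · obtain ⟨c, hc, hcs⟩ := hs' h
      refine ⟨σ2 * (Real.exp c5 * (2 / (c * Real.log 2))), by positivity, fun n j hn hj hjn => ?_⟩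
      have h1 : ∀ k ∈ Finset.Icc 1 j, psiP (lamT c3 c4 c5 X (a n) k ω) ≤
          (Real.exp c5 * (2 / (c * Real.log 2)) * Real.log (2 / a n)) * (k:ℝ)⁻¹ := by
        intro k hk
        have hk1 := (Finset.mem_Icc.1 hk).1
        have hk0 : (0:ℝ) < k := by positivity
        refine (psiP_bound (hlamT0 n k) (min_le_right _ _)).trans ?_
        have h2 : (lamT c3 c4 c5 X (a n) k ω)^2 ≤ 2 * Real.log (2 / a n) /
            (sigHat2 c3 c4 X k ω * (k : ℝ) * Real.log (1 + (k : ℝ))) := by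
          have h3 := pow_le_pow_left₀ (hlamT0 n k) (min_le_left _ _ :
            lamT c3 c4 c5 X (a n) k ω ≤ Real.sqrt (2 * Real.log (2 / a n) /
            (sigHat2 c3 c4 X k ω * (k : ℝ) * Real.log (1 + (k : ℝ))))) 2
          rwa [Real.sq_sqrt] at h3
          have := (hs k hk1).1
          have := hlogk k hk1
          have : 0 ≤ Real.log (1 + (k:ℝ)) := by linarith
          positivity
        have h4 : 2 * Real.log (2 / a n) /
            (sigHat2 c3 c4 X k ω * (k : ℝ) * Real.log (1 + (k : ℝ))) ≤
            2 * Real.log (2 / a n) / (c * k * Real.log 2) := by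
          have := hcs k hk1
          have := hlogk k hk1
          have := (hs k hk1).1
          gcongr
        refine (mul_le_mul_of_nonneg_left (h2.trans h4) (Real.exp_pos _).le).trans (le_of_eq ?_)
        field_simp
      have h2 := Finset.sum_le_sum h1
      rw [← Finset.mul_sum] at h2
      have h3 := h2.trans (mul_le_mul_of_nonneg_left (harm_le hj hjn) (by positivity))
      refine (mul_le_mul_of_nonneg_left h3 hσ).trans (le_of_eq ?_)
      ring
  obtain ⟨D, hD0, hD⟩ := hup
  refine ⟨1/4 + 8 * ((1 + D) / κ)^2, ?_⟩
  filter_upwards [ha1, ha2, eventually_ge_atTop 1] with n h1 h2 h3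
  have hn1 : (1:ℝ) ≤ n := by exact_mod_cast h3
  have hn0 : (0:ℝ) < n := by linarith
  set G : ℝ := (n:ℝ)^(1/16:ℝ) with hG
  have hlogn : 0 ≤ Real.log n := Real.log_nonneg hn1
  have hterm : ∀ j ∈ Finset.Icc 1 (n-1), (Rtilde c3 c4 c5 σ2 X (a n) (j+1) ω)^2 ≤
      ((1 + D) / κ)^2 * G^2 * (j:ℝ)^(-(7/8):ℝ) := by
    intro j hj
    obtain ⟨hj1, hjn⟩ := Finset.mem_Icc.1 hj
    have hj0 : (0:ℝ) < j := by positivity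
    have e : Rtilde c3 c4 c5 σ2 X (a n) (j+1) ω = (Real.log (2/a n) +
        σ2 * ∑ k ∈ Finset.Icc 1 j, psiP (lamT c3 c4 c5 X (a n) k ω)) /
        (∑ k ∈ Finset.Icc 1 j, lamT c3 c4 c5 X (a n) k ω) := by
      unfold Rtilde
      rw [if_neg (by omega)]
      simp only [Nat.add_sub_cancel]
    have h5 := hsumlow n j h1 hj1
    have h6 := hD n j h1 hj1 (by omega)
    have h7 : 0 ≤ σ2 * ∑ k ∈ Finset.Icc 1 j, psiP (lamT c3 c4 c5 X (a n) k ω) :=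
      mul_nonneg hσ (Finset.sum_nonneg fun k _ => hpsi0 _)
    have h8 : Real.log (2 / a n) ≤ Real.log (2 / a n) * (1 + Real.log n) := by nlinarith
    have h9 : Real.log (2 / a n) + σ2 * ∑ k ∈ Finset.Icc 1 j, psiP (lamT c3 c4 c5 X (a n) k ω) ≤
        (1 + D) * G := by
      have := mul_le_mul_of_nonneg_left h2 hD0
      linarith
    have h10 : Rtilde c3 c4 c5 σ2 X (a n) (j+1) ω ≤ (1 + D) * G / (κ * (j:ℝ)^(7/16:ℝ)) := by
      rw [e]
      gcongr
    have h11 : 0 ≤ Rtilde c3 c4 c5 σ2 X (a n) (j+1) ω := by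
      rw [e]
      exact div_nonneg (by linarith) (Finset.sum_nonneg fun k _ => hlamT0 n k)
    refine (pow_le_pow_left₀ h11 h10 2).trans (le_of_eq ?_)
    have e2 : (j:ℝ)^(-(7/8):ℝ) = (((j:ℝ)^(7/16:ℝ))^2)⁻¹ := by
      rw [← Real.rpow_natCast, ← Real.rpow_mul hj0.le, Real.rpow_neg hj0.le]; norm_num
    rw [e2]
    field_simp
  have hsplit : ∑ i ∈ Finset.Icc 1 n, (Rtilde c3 c4 c5 σ2 X (a n) i ω)^2 =
      1/4 + ∑ j ∈ Finset.Icc 1 (n-1), (Rtilde c3 c4 c5 σ2 X (a n) (j+1) ω)^2 := by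
    have hgen : ∀ (f : ℕ → ℝ) (k : ℕ), ∑ i ∈ Finset.Icc 1 (k+1), f i =
        f 1 + ∑ j ∈ Finset.Icc 1 k, f (j+1) := by
      intro f k
      induction k with
      | zero => simp
      | succ k ih => rw [Finset.sum_Icc_succ_top (by omega), ih,
          Finset.sum_Icc_succ_top (by omega)]; ring
    obtain ⟨k, rfl⟩ : ∃ k, n = k + 1 := ⟨n - 1, by omega⟩
    rw [hgen]
    simp only [Nat.add_sub_cancel]
    congr 1
    unfold Rtilde
    norm_num
  rw [hsplit]
  have h4 := Finset.sum_le_sum hterm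
  rw [← Finset.mul_sum] at h4
  have h5 := sum_rpow_le (7/8) (by norm_num) (by norm_num) (n-1)
  have h6 : (((n-1:ℕ):ℝ))^(1 - 7/8:ℝ) ≤ (n:ℝ)^(1 - 7/8:ℝ) :=
    Real.rpow_le_rpow (by positivity) (by exact_mod_cast Nat.sub_le n 1) (by norm_num)
  have h7 : ∑ j ∈ Finset.Icc 1 (n-1), (j:ℝ)^(-(7/8):ℝ) ≤ 8 * (n:ℝ)^(1/8:ℝ) := by
    norm_num at h5 h6 ⊢
    linarith
  have h8 := h4.trans (mul_le_mul_of_nonneg_left h7 (by positivity))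
  have e1 : G^2 * (n:ℝ)^(1/8:ℝ) = (n:ℝ)^(1/4:ℝ) := by
    rw [hG, ← Real.rpow_natCast, ← Real.rpow_mul hn0.le, ← Real.rpow_add hn0]; norm_num
  have h9 : (1:ℝ) ≤ (n:ℝ)^(1/4:ℝ) := Real.one_le_rpow hn1 (by norm_num)
  have e2 : ((1 + D) / κ)^2 * G^2 * (8 * (n:ℝ)^(1/8:ℝ)) = 8 * ((1 + D) / κ)^2 * (n:ℝ)^(1/4:ℝ) := by
    rw [← e1]; ring
  rw [e2] at h8
  linarith

/-- The level sequence `α / log n` satisfies the growth hypotheses. -/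
theorem level_growth (α : ℝ) (hα : α ∈ Set.Ioo (0:ℝ) 1) :
    (∀ᶠ n : ℕ in atTop, 1 ≤ Real.log (2 / (α / Real.log n))) ∧
    (∀ᶠ n : ℕ in atTop, Real.log (2 / (α / Real.log n)) * (1 + Real.log n) ≤ (n:ℝ)^(1/16:ℝ)) := by
  obtain ⟨h0, h1⟩ := hα
  have hlog : Tendsto (fun n : ℕ => Real.log n) atTop atTop :=
    Real.tendsto_log_atTop.comp tendsto_natCast_atTop_atTop
  have hlogr : ∀ᶠ n : ℕ in atTop, Real.log n ≤ 1/2 * (n:ℝ)^(1/64:ℝ) := by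
    have := (isLittleO_log_rpow_atTop (r := 1/64) (by norm_num)).def (c := 1/2) (by norm_num)
    have h2 := (tendsto_natCast_atTop_atTop (R := ℝ)).eventually this
    filter_upwards [h2, eventually_ge_atTop 1] with n h h'
    rw [Real.norm_eq_abs, Real.norm_eq_abs, abs_of_nonneg (by positivity : 0 ≤ (n:ℝ)^(1/64:ℝ))] at h
    exact (le_abs_self _).trans h
  have hpow : Tendsto (fun n : ℕ => (n:ℝ)^(1/64:ℝ)) atTop atTop :=
    (tendsto_rpow_atTop (by norm_num)).comp tendsto_natCast_atTop_atTop
  constructor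
  · filter_upwards [hlog.eventually_ge_atTop 2] with n h
    have h3 : Real.exp 1 ≤ 2 / (α / Real.log n) := by
      have e : 2 / (α / Real.log n) = 2 * Real.log n / α := by field_simp
      rw [e, le_div_iff₀ h0]
      have := Real.exp_one_lt_d9
      nlinarith
    have := Real.log_le_log (Real.exp_pos 1) h3
    rwa [Real.log_exp] at this
  · filter_upwards [hlogr, hlog.eventually_ge_atTop 2, hpow.eventually_ge_atTop (2 * (2 / α)),
      hpow.eventually_ge_atTop 2, eventually_ge_atTop 1] with n h2 h3 h4 h5 h6
    have hn0 : (0:ℝ) < n := by positivity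
    set g := (n:ℝ)^(1/64:ℝ) with hg
    have e : 2 / (α / Real.log n) = 2 / α * Real.log n := by field_simp
    have h7 : Real.log (2 / (α / Real.log n)) ≤ g := by
      rw [e, Real.log_mul (by positivity) (by positivity)]
      have h8 := Real.log_le_sub_one_of_pos (show 0 < 2 / α by positivity)
      have h9 := Real.log_le_sub_one_of_pos (show 0 < Real.log n by linarith)
      linarith
    have h10 : g * g ≤ (n:ℝ)^(1/16:ℝ) := by
      rw [hg, ← Real.rpow_add hn0]
      exact Real.rpow_le_rpow_of_exponent_le (by exact_mod_cast h6) (by norm_num)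
    refine le_trans ?_ h10
    exact mul_le_mul h7 (by linarith) (by linarith) (by linarith)

theorem pert (u v : ℕ → ℝ) (c C K : ℝ) (hK : 0 ≤ K)
    (h : ∀ n : ℕ, |∑ i ∈ Finset.Icc 1 n, (u i - c)| ≤ C * (n:ℝ)^(5/8:ℝ))
    (hv : ∀ i : ℕ, 1 ≤ i → |v i - u i| ≤ K * (i:ℝ)^(-(3/8):ℝ)) :
    ∃ C' : ℝ, ∀ n : ℕ, |∑ i ∈ Finset.Icc 1 n, (v i - c)| ≤ C' * (n:ℝ)^(5/8:ℝ) := by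
  refine ⟨C + K * (8/5), fun n => ?_⟩
  have e : ∑ i ∈ Finset.Icc 1 n, (v i - c) =
      ∑ i ∈ Finset.Icc 1 n, (u i - c) + ∑ i ∈ Finset.Icc 1 n, (v i - u i) := by
    rw [← Finset.sum_add_distrib]
    exact Finset.sum_congr rfl fun i _ => by ring
  have h1 : |∑ i ∈ Finset.Icc 1 n, (v i - u i)| ≤ K * (8/5) * (n:ℝ)^(5/8:ℝ) := by
    refine (Finset.abs_sum_le_sum_abs _ _).trans ?_
    refine (Finset.sum_le_sum fun i hi => hv i (Finset.mem_Icc.1 hi).1).trans ?_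
    rw [← Finset.mul_sum, mul_assoc]
    refine mul_le_mul_of_nonneg_left ?_ hK
    have := sum_rpow_le (3/8) (by norm_num) (by norm_num) n
    norm_num at this ⊢
    exact this
  rw [e]
  refine (abs_add_le _ _).trans ?_
  have := h n
  linarith

theorem avg_rate (u : ℕ → ℝ) (c c0 C : ℝ)
    (h : ∀ n : ℕ, |∑ i ∈ Finset.Icc 1 n, (u i - c)| ≤ C * (n:ℝ)^(5/8:ℝ)) :
    ∃ C' : ℝ, 0 ≤ C' ∧ ∀ t : ℕ, 1 ≤ t →
      |(c0 + ∑ i ∈ Finset.Icc 1 (t-1), u i) / (t:ℝ) - c| ≤ C' * (t:ℝ)^(-(3/8):ℝ) := by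
  have hC : 0 ≤ C := by
    have := h 1
    simp at this
    exact (abs_nonneg _).trans this
  refine ⟨|c0 - c| + C, by positivity, fun t ht => ?_⟩
  have ht0 : (0:ℝ) < t := by positivity
  have ht1 : (1:ℝ) ≤ t := by exact_mod_cast ht
  have e : (c0 + ∑ i ∈ Finset.Icc 1 (t-1), u i) / (t:ℝ) - c =
      ((c0 - c) + ∑ i ∈ Finset.Icc 1 (t-1), (u i - c)) / t := by
    rw [Finset.sum_sub_distrib, Finset.sum_const, Nat.card_Icc, nsmul_eq_mul]
    simp only [Nat.add_sub_cancel]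
    rw [Nat.cast_sub ht]
    field_simp
    push_cast
    ring
  rw [e, abs_div, abs_of_pos ht0, div_le_iff₀ ht0]
  have e2 : (t:ℝ)^(-(3/8):ℝ) * t = (t:ℝ)^(5/8:ℝ) := by
    nth_rewrite 2 [← Real.rpow_one (t:ℝ)]
    rw [← Real.rpow_add ht0]; norm_num
  rw [mul_assoc, e2]
  have h1 : (((t-1:ℕ):ℝ))^(5/8:ℝ) ≤ (t:ℝ)^(5/8:ℝ) :=
    Real.rpow_le_rpow (by positivity) (by exact_mod_cast Nat.sub_le t 1) (by norm_num)
  have h2 : (1:ℝ) ≤ (t:ℝ)^(5/8:ℝ) := Real.one_le_rpow ht1 (by norm_num)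
  have h3 := (h (t-1)).trans (mul_le_mul_of_nonneg_left h1 hC)
  refine (abs_add_le _ _).trans ?_
  have h4 := mul_le_mul_of_nonneg_left h2 (abs_nonneg (c0 - c))
  linarith

theorem rate_tendsto (f : ℕ → ℝ) (c C : ℝ)
    (h : ∀ t : ℕ, 1 ≤ t → |f t - c| ≤ C * (t:ℝ)^(-(3/8):ℝ)) : Tendsto f atTop (nhds c) := by
  rw [tendsto_iff_norm_sub_tendsto_zero]
  have h1 : Tendsto (fun n : ℕ => C * (n:ℝ)^(-(3/8):ℝ)) atTop (nhds 0) := by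
    have := ((tendsto_rpow_neg_atTop (y := 3/8) (by norm_num)).comp
      tendsto_natCast_atTop_atTop).const_mul C
    simpa using this
  refine squeeze_zero' (Eventually.of_forall fun _ => norm_nonneg _) ?_ h1
  filter_upwards [eventually_ge_atTop 1] with n hn
  exact h n hn

theorem avg_mem (u : ℕ → ℝ) (c0 : ℝ) (h0 : 0 ≤ c0) (h1 : c0 ≤ 1)
    (t : ℕ) (ht : 1 ≤ t) (hu : ∀ i, 1 ≤ i → i < t → 0 ≤ u i ∧ u i ≤ 1) :
    c0 / t ≤ (c0 + ∑ i ∈ Finset.Icc 1 (t-1), u i) / (t:ℝ) ∧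
    (c0 + ∑ i ∈ Finset.Icc 1 (t-1), u i) / (t:ℝ) ≤ 1 := by
  have ht0 : (0:ℝ) < t := by positivity
  have hmem : ∀ i ∈ Finset.Icc 1 (t-1), 0 ≤ u i ∧ u i ≤ 1 := fun i hi => by
    have := Finset.mem_Icc.1 hi
    exact hu i this.1 (by omega)
  constructor
  · have := Finset.sum_nonneg fun i hi => (hmem i hi).1
    gcongr
    linarith
  · rw [div_le_one ht0]
    have := Finset.sum_le_sum fun i hi => (hmem i hi).2
    rw [Finset.sum_const, Nat.card_Icc, nsmul_eq_mul] at this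
    simp only [Nat.add_sub_cancel] at this
    rw [Nat.cast_sub ht] at this
    push_cast at this
    linarith

theorem det_main (X : ℕ → Ω → ℝ) (ω : Ω) (μ σ2 V : ℝ)
    (c1 c2 c3 c4 c5 : ℝ)
    (hc1 : c1 ∈ Set.Ioo (0:ℝ) 1) (hc2 : c2 ∈ Set.Ioc (0:ℝ) 1)
    (hc3 : c3 ∈ Set.Ioc (0:ℝ) 1) (hc4 : c4 ∈ Set.Icc (0:ℝ) 1) (hc5 : 0 < c5)
    (hx : ∀ i, 1 ≤ i → X i ω ∈ Set.Icc (0:ℝ) 1)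
    (C1 C2 C3 : ℝ)
    (h1 : ∀ n : ℕ, |∑ i ∈ Finset.Icc 1 n, (X i ω - μ)| ≤ C1 * (n:ℝ)^(5/8:ℝ))
    (h2 : ∀ n : ℕ, |∑ i ∈ Finset.Icc 1 n, ((X i ω - μ)^2 - σ2)| ≤ C2 * (n:ℝ)^(5/8:ℝ))
    (h3 : ∀ n : ℕ, |∑ i ∈ Finset.Icc 1 n, (((X i ω - μ)^2 - σ2)^2 - V)| ≤ C3 * (n:ℝ)^(5/8:ℝ))
    (hV0 : V = 0 → ∀ i, 1 ≤ i → (X i ω - μ)^2 = σ2) :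
    (∀ (d : ℕ → ℝ) (L : ℝ), 0 < L → Tendsto (fun n => Real.log (1 / d n)) atTop (nhds L) →
      ∀ (r : ℕ → ℕ → ℝ) (Cr : ℝ), (∀ n i, 0 ≤ r n i) →
      (∀ᶠ n : ℕ in atTop, ∑ i ∈ Finset.Icc 1 n, r n i ≤ Cr * (n:ℝ)^(1/4:ℝ)) →
      Tendsto (fun n : ℕ => Real.sqrt n * RB c1 c2 c3 c4 X (d n) n ω) atTop
        (nhds (Real.sqrt (2 * V * L))) ∧
      Tendsto (fun n : ℕ => Real.sqrt n * ((∑ i ∈ Finset.Icc 1 n,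
        lamB c1 c2 c3 c4 X (d n) n i ω * r n i) /
        (∑ i ∈ Finset.Icc 1 n, lamB c1 c2 c3 c4 X (d n) n i ω))) atTop (nhds 0)) ∧
    (∀ a : ℕ → ℝ, (∀ᶠ n in atTop, 1 ≤ Real.log (2 / a n)) →
      (∀ᶠ n : ℕ in atTop, Real.log (2 / a n) * (1 + Real.log n) ≤ (n:ℝ)^(1/16:ℝ)) →
      ∃ C : ℝ, ∀ᶠ n : ℕ in atTop, ∑ i ∈ Finset.Icc 1 n, (Rtilde c3 c4 c5 σ2 X (a n) i ω)^2
      ≤ C * (n:ℝ)^(1/4:ℝ)) := by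
  have hmu : ∀ t, 1 ≤ t → 0 ≤ muHat c4 X t ω ∧ muHat c4 X t ω ≤ 1 := by
    intro t ht
    obtain ⟨ha, hb⟩ := avg_mem (fun i => X i ω) c4 hc4.1 hc4.2 t ht (fun i hi _ => hx i hi)
    exact ⟨le_trans (div_nonneg hc4.1 (Nat.cast_nonneg t)) ha, hb⟩
  obtain ⟨K1, hK1, hr1⟩ := avg_rate (fun i => X i ω) μ c4 C1 h1
  have hr1' : ∀ t, 1 ≤ t → |muHat c4 X t ω - μ| ≤ K1 * (t:ℝ)^(-(3/8):ℝ) := hr1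
  have hmulim : Tendsto (fun t => muHat c4 X t ω) atTop (nhds μ) := rate_tendsto _ μ K1 hr1'
  have hμ0 : 0 ≤ μ := ge_of_tendsto hmulim ((eventually_ge_atTop 1).mono fun t ht => (hmu t ht).1)
  have hμ1 : μ ≤ 1 := le_of_tendsto hmulim ((eventually_ge_atTop 1).mono fun t ht => (hmu t ht).2)
  set y : ℕ → ℝ := fun i => (X i ω - muHat c4 X i ω)^2 with hy
  have hy01 : ∀ i, 1 ≤ i → 0 ≤ y i ∧ y i ≤ 1 := by
    intro i hi
    have := hx i hi
    have h := hmu i hi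
    refine ⟨sq_nonneg _, ?_⟩
    simp only [hy]
    rw [sq_le_one_iff_abs_le_one, abs_le]
    constructor <;> linarith [this.1, this.2]
  have hye : ∀ i, 1 ≤ i → |y i - (X i ω - μ)^2| ≤ (2 * K1) * (i:ℝ)^(-(3/8):ℝ) := by
    intro i hi
    have hxi := hx i hi
    have h := hmu i hi
    have e : y i - (X i ω - μ)^2 = (muHat c4 X i ω - μ) * (muHat c4 X i ω + μ - 2 * X i ω) := by
      simp only [hy]; ring
    rw [e, abs_mul, show (2 * K1) * (i:ℝ)^(-(3/8):ℝ) = (K1 * (i:ℝ)^(-(3/8):ℝ)) * 2 by ring]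
    refine mul_le_mul (hr1' i hi) ?_ (abs_nonneg _) (by positivity)
    rw [abs_le]
    constructor <;> linarith [hxi.1, hxi.2]
  obtain ⟨C2', h2'⟩ := pert (fun i => (X i ω - μ)^2) y σ2 C2 (2 * K1) (by positivity) h2 hye
  obtain ⟨K2, hK2, hr2⟩ := avg_rate y σ2 c3 C2' h2'
  have hr2' : ∀ t, 1 ≤ t → |sigHat2 c3 c4 X t ω - σ2| ≤ K2 * (t:ℝ)^(-(3/8):ℝ) := hr2
  have hsig : ∀ t, 1 ≤ t → 0 < sigHat2 c3 c4 X t ω ∧ sigHat2 c3 c4 X t ω ≤ 1 := by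
    intro t ht
    obtain ⟨ha, hb⟩ := avg_mem y c3 hc3.1.le hc3.2 t ht (fun i hi _ => hy01 i hi)
    exact ⟨lt_of_lt_of_le (div_pos hc3.1 (by positivity)) ha, hb⟩
  have hsiglim : Tendsto (fun t => sigHat2 c3 c4 X t ω) atTop (nhds σ2) := rate_tendsto _ σ2 K2 hr2'
  have hσ0 : 0 ≤ σ2 :=
    ge_of_tendsto hsiglim ((eventually_ge_atTop 1).mono fun t ht => (hsig t ht).1.le)
  have hσ1 : σ2 ≤ 1 :=
    le_of_tendsto hsiglim ((eventually_ge_atTop 1).mono fun t ht => (hsig t ht).2)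
  set Y : ℕ → ℝ := fun i => (y i - sigHat2 c3 c4 X i ω)^2 with hYdef
  have hY01 : ∀ i, 1 ≤ i → 0 ≤ Y i ∧ Y i ≤ 1 := by
    intro i hi
    have h := hy01 i hi
    have h' := hsig i hi
    refine ⟨sq_nonneg _, ?_⟩
    simp only [hYdef]
    rw [sq_le_one_iff_abs_le_one, abs_le]
    constructor <;> linarith [h.1, h.2, h'.1, h'.2]
  have hde : ∀ i, 1 ≤ i → |(y i - sigHat2 c3 c4 X i ω) - ((X i ω - μ)^2 - σ2)| ≤
      (2 * K1 + K2) * (i:ℝ)^(-(3/8):ℝ) := by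
    intro i hi
    have e : (y i - sigHat2 c3 c4 X i ω) - ((X i ω - μ)^2 - σ2) =
      (y i - (X i ω - μ)^2) - (sigHat2 c3 c4 X i ω - σ2) := by ring
    rw [e]
    refine (abs_sub _ _).trans ?_
    have := hye i hi
    have := hr2' i hi
    linarith
  have hYe : ∀ i, 1 ≤ i → |Y i - ((X i ω - μ)^2 - σ2)^2| ≤
      (2 * (2 * K1 + K2)) * (i:ℝ)^(-(3/8):ℝ) := by
    intro i hi
    have hxi := hx i hi
    have h := hy01 i hi
    have h' := hsig i hi
    have e : Y i - ((X i ω - μ)^2 - σ2)^2 =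
      ((y i - sigHat2 c3 c4 X i ω) - ((X i ω - μ)^2 - σ2)) *
      ((y i - sigHat2 c3 c4 X i ω) + ((X i ω - μ)^2 - σ2)) := by
      simp only [hYdef]; ring
    rw [e, abs_mul, mul_assoc (2:ℝ), mul_comm (2:ℝ)]
    refine mul_le_mul (hde i hi) ?_ (abs_nonneg _) (by positivity)
    have h5 : (X i ω - μ)^2 ≤ 1 := by
      rw [sq_le_one_iff_abs_le_one, abs_le]
      constructor <;> linarith [hxi.1, hxi.2]
    have h6 := sq_nonneg (X i ω - μ)
    rw [abs_le]
    constructor <;> linarith [h.1, h.2, h'.1, h'.2]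
  obtain ⟨C3', h3'⟩ := pert (fun i => ((X i ω - μ)^2 - σ2)^2) Y V C3 (2 * (2 * K1 + K2))
    (by positivity) h3 hYe
  obtain ⟨K3, hK3, hr3⟩ := avg_rate Y V c2 C3' h3'
  have hr3' : ∀ t, 1 ≤ t → |m4Hat2 c2 c3 c4 X t ω - V| ≤ K3 * (t:ℝ)^(-(3/8):ℝ) := hr3
  have hm4 : ∀ t, 1 ≤ t → 0 < m4Hat2 c2 c3 c4 X t ω := by
    intro t ht
    obtain ⟨ha, hb⟩ := avg_mem Y c2 hc2.1.le hc2.2 t ht (fun i hi _ => hY01 i hi)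
    exact lt_of_lt_of_le (div_pos hc2.1 (by positivity)) ha
  have hm4lim : Tendsto (fun t => m4Hat2 c2 c3 c4 X t ω) atTop (nhds V) := rate_tendsto _ V K3 hr3'
  have hVnn : 0 ≤ V :=
    ge_of_tendsto hm4lim ((eventually_ge_atTop 1).mono fun t ht => (hm4 t ht).le)
  refine ⟨?_, fun a ha1 ha2 => ?_⟩
  · intro d L hL hd r Cr hr0 hr
    rcases hVnn.eq_or_lt with hV | hV
    · -- degenerate case V = 0
      have hxσ := hV0 hV.symm
      set K := 2 * K1 + K2 with hK
      have hYb : ∀ i, 1 ≤ i → Y i ≤ K^2 * (i:ℝ)^(-(3/4):ℝ) := by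
        intro i hi
        have h := hde i hi
        rw [hxσ i hi, sub_self, sub_zero] at h
        have h' := pow_le_pow_left₀ (abs_nonneg _) h 2
        rw [sq_abs, mul_pow] at h'
        have e : ((i:ℝ)^(-(3/8):ℝ))^2 = (i:ℝ)^(-(3/4):ℝ) := by
          rw [← Real.rpow_natCast, ← Real.rpow_mul (by positivity)]; norm_num
        rwa [e] at h'
      have hYs : ∀ n : ℕ, ∑ i ∈ Finset.Icc 1 n, Y i ≤ (4 * K^2) * (n:ℝ)^(1/4:ℝ) := by
        intro n
        refine (Finset.sum_le_sum fun i hi => hYb i (Finset.mem_Icc.1 hi).1).trans ?_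
        rw [← Finset.mul_sum]
        have h := sum_rpow_le (3/4) (by norm_num) (by norm_num) n
        have h' := mul_le_mul_of_nonneg_left h (sq_nonneg K)
        norm_num at h' ⊢
        linarith
      have hm4b : ∀ n i : ℕ, 1 ≤ i → i ≤ n →
          m4Hat2 c2 c3 c4 X i ω ≤ (1 + 4 * K^2) * (n:ℝ)^(1/4:ℝ) / i := by
        intro n i hi hin
        have e : m4Hat2 c2 c3 c4 X i ω = (c2 + ∑ j ∈ Finset.Icc 1 (i-1), Y j) / i := rfl
        rw [e]
        refine div_le_div_of_nonneg_right ?_ (Nat.cast_nonneg i)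
        have h5 := hYs (i-1)
        have h6 : (((i-1:ℕ):ℝ))^(1/4:ℝ) ≤ (n:ℝ)^(1/4:ℝ) :=
          Real.rpow_le_rpow (by positivity) (by exact_mod_cast (by omega)) (by norm_num)
        have h7 : (1:ℝ) ≤ (n:ℝ)^(1/4:ℝ) :=
          Real.one_le_rpow (by exact_mod_cast hi.trans hin) (by norm_num)
        have h8 := mul_le_mul_of_nonneg_left h6 (show 0 ≤ 4 * K^2 by positivity)
        linarith [hc2.2]
      set C := max (1 + 4 * K^2) Cr with hC
      have hCpos : 0 < C := lt_of_lt_of_le (by positivity) (le_max_left _ _)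
      have hCm : 1 + 4 * K^2 ≤ C := le_max_left _ _
      have := core_zero c1 hc1.1 hc1.2 (fun i => m4Hat2 c2 c3 c4 X i ω) Y
        (fun n => Real.log (1 / d n)) C L hCpos hL hm4 (fun n i hi hin => (hm4b n i hi hin).trans
          (by gcongr)) (fun i hi => (hY01 i hi).1) (fun n => (hYs n).trans (by
            gcongr; linarith)) hd r hr0 (hr.mono fun n hn => hn.trans (by
            gcongr; exact le_max_right _ _))
      have e0 : Real.sqrt (2 * V * L) = 0 := by rw [← hV]; simp
      rw [e0]
      exact this
    · -- main case V > 0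
      have hYa : Tendsto (fun n : ℕ => (∑ i ∈ Finset.Icc 1 n, Y i) / (n:ℝ)) atTop (nhds V) := by
        have hz : Tendsto (fun n : ℕ => C3' * (n:ℝ)^(-(3/8):ℝ)) atTop (nhds 0) := by
          have := ((tendsto_rpow_neg_atTop (y := 3/8) (by norm_num)).comp
            tendsto_natCast_atTop_atTop).const_mul C3'
          simpa using this
        rw [tendsto_iff_norm_sub_tendsto_zero]
        refine squeeze_zero' (Eventually.of_forall fun _ => norm_nonneg _) ?_ hz
        filter_upwards [eventually_ge_atTop 1] with n hn
        have hn0 : (0:ℝ) < n := by positivity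
        have h := h3' n
        rw [Finset.sum_sub_distrib, Finset.sum_const, Nat.card_Icc, nsmul_eq_mul] at h
        simp only [Nat.add_sub_cancel] at h
        have e : (∑ i ∈ Finset.Icc 1 n, Y i) / (n:ℝ) - V = (∑ i ∈ Finset.Icc 1 n, Y i - n * V) / n := by
          field_simp
        rw [Real.norm_eq_abs, e, abs_div, abs_of_pos hn0, div_le_iff₀ hn0]
        have e2 : (n:ℝ)^(-(3/8):ℝ) * n = (n:ℝ)^(5/8:ℝ) := by
          nth_rewrite 2 [← Real.rpow_one (n:ℝ)]
          rw [← Real.rpow_add hn0]; norm_num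
        rw [mul_assoc, e2]
        exact h
      have hrlim : Tendsto (fun n : ℕ => (∑ i ∈ Finset.Icc 1 n, r n i) / Real.sqrt n)
          atTop (nhds 0) := by
        have hz : Tendsto (fun n : ℕ => Cr * (n:ℝ)^(-(1/4):ℝ)) atTop (nhds 0) := by
          have := ((tendsto_rpow_neg_atTop (y := 1/4) (by norm_num)).comp
            tendsto_natCast_atTop_atTop).const_mul Cr
          simpa using this
        refine squeeze_zero' (Eventually.of_forall fun n =>
          div_nonneg (Finset.sum_nonneg fun i _ => hr0 n i) (Real.sqrt_nonneg _)) ?_ hz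
        filter_upwards [hr, eventually_ge_atTop 1] with n h hn
        have hn0 : (0:ℝ) < n := by positivity
        rw [div_le_iff₀ (Real.sqrt_pos.2 hn0), Real.sqrt_eq_rpow, mul_assoc, ← Real.rpow_add hn0]
        norm_num at h ⊢
        exact h
      exact core_pos c1 hc1.1 (fun i => m4Hat2 c2 c3 c4 X i ω) Y
        (fun n => Real.log (1 / d n)) V L hV hL hm4 hm4lim hY01 hYa hd r hr0 hrlim
  · refine bennett c3 c4 c5 σ2 X ω a hc5 hσ0 hsig (fun hσ => ?_) ha1 ha2
    have hev : ∀ᶠ t in atTop, σ2 / 2 < sigHat2 c3 c4 X t ω :=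
      hsiglim.eventually_const_lt (by linarith)
    obtain ⟨N, hN⟩ := eventually_atTop.1 hev
    have hfin : ∀ M : ℕ, ∃ c > 0, ∀ k, 1 ≤ k → k ≤ M → c ≤ sigHat2 c3 c4 X k ω := by
      intro M
      induction M with
      | zero => exact ⟨1, one_pos, fun k h h' => by omega⟩
      | succ M ih =>
        obtain ⟨c, hc, hck⟩ := ih
        refine ⟨min c (sigHat2 c3 c4 X (M+1) ω), lt_min hc (hsig _ (by omega)).1, fun k hk hkM => ?_⟩
        rcases Nat.lt_or_ge M k with h | h
        · have : k = M + 1 := by omega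
          rw [this]; exact min_le_right _ _
        · exact (min_le_left _ _).trans (hck k hk h)
    obtain ⟨c, hc, hck⟩ := hfin N
    refine ⟨min c (σ2/2), lt_min hc (by linarith), fun k hk => ?_⟩
    rcases Nat.lt_or_ge N k with h | h
    · exact (min_le_right _ _).trans (hN k h.le).le
    · exact (min_le_left _ _).trans (hck k hk h)

theorem level2_tendsto (α : ℝ) (hα : α ∈ Set.Ioo (0:ℝ) 1) :
    Tendsto (fun n : ℕ => Real.log (1 / (α * (Real.log n - 1) / Real.log n))) atTop
      (nhds (Real.log (1/α))) := by
  have hlog : Tendsto (fun n : ℕ => Real.log n) atTop atTop :=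
    Real.tendsto_log_atTop.comp tendsto_natCast_atTop_atTop
  have h1 : Tendsto (fun n : ℕ => α * (1 - (Real.log n)⁻¹)) atTop (nhds (α * (1 - 0))) :=
    (hlog.inv_tendsto_atTop.const_sub 1).const_mul α
  have h2 : Tendsto (fun n : ℕ => α * (Real.log n - 1) / Real.log n) atTop (nhds α) := by
    rw [sub_zero, mul_one] at h1
    refine h1.congr' ?_
    filter_upwards [hlog.eventually_ge_atTop 1] with n hn
    field_simp
  have h3 : Tendsto (fun n : ℕ => 1 / (α * (Real.log n - 1) / Real.log n)) atTop (nhds (1 / α)) :=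
    tendsto_const_nhds.div h2 hα.1.ne'
  exact h3.log (by have := hα.1; positivity)

/-- Sharpness (Corollary 4 of the paper): with the split `α_{1,n} = α/log n`,
`α_{2,n} = α(log n − 1)/log n`, both `√n (U_n − D_n)` and `√n (D_n − L_n)` converge
almost surely to `√(2 V log(1/α))`. -/
theorem sharpness
    {m0 : MeasurableSpace Ω} (P : Measure Ω) [IsProbabilityMeasure P]
    (ℱ : Filtration ℕ m0) (X : ℕ → Ω → ℝ) (μ σ2 V α : ℝ)
    (c1 c2 c3 c4 c5 : ℝ)
    (hc1 : c1 ∈ Set.Ioo (0:ℝ) 1) (hc2 : c2 ∈ Set.Ioc (0:ℝ) 1)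
    (hc3 : c3 ∈ Set.Ioc (0:ℝ) 1) (hc4 : c4 ∈ Set.Icc (0:ℝ) 1) (hc5 : 0 < c5)
    (hα : α ∈ Set.Ioo (0:ℝ) 1)
    (hadapt : Adapted ℱ X)
    (hint : ∀ t, 1 ≤ t → Integrable (X t) P)
    (hbdd : ∀ t, 1 ≤ t → ∀ᵐ ω ∂P, X t ω ∈ Set.Icc (0:ℝ) 1)
    (hmean : ∀ t, 1 ≤ t → P[X t|ℱ (t - 1)] =ᵐ[P] fun _ => μ)
    (hvar : ∀ t, 1 ≤ t → P[(fun ω => (X t ω - μ)^2)|ℱ (t - 1)] =ᵐ[P] fun _ => σ2)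
    (hvar4 : ∀ t, 1 ≤ t →
      P[(fun ω => ((X t ω - μ)^2 - σ2)^2)|ℱ (t - 1)] =ᵐ[P] fun _ => V)
    (α1 α2 : ℕ → ℝ)
    (hα1def : ∀ n : ℕ, α1 n = α / Real.log n)
    (hα2def : ∀ n : ℕ, α2 n = α * (Real.log n - 1) / Real.log n) :
    ∀ᵐ ω ∂P,
      (Tendsto
        (fun n : ℕ => Real.sqrt n *
          ((DB c1 c2 c3 c4 X α n ω + RB c1 c2 c3 c4 X α n ω) - DB c1 c2 c3 c4 X α n ω))
        atTop (nhds (Real.sqrt (2 * V * Real.log (1/α))))) ∧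
      (Tendsto
        (fun n : ℕ => Real.sqrt n *
          (DB c1 c2 c3 c4 X (α2 n) n ω -
            (DB c1 c2 c3 c4 X (α2 n) n ω -
              (∑ i ∈ Finset.Icc 1 n,
                  lamB c1 c2 c3 c4 X (α2 n) n i ω * (Rtilde c3 c4 c5 σ2 X (α1 n) i ω)^2) /
                (∑ i ∈ Finset.Icc 1 n, lamB c1 c2 c3 c4 X (α2 n) n i ω) -
              RB c1 c2 c3 c4 X (α2 n) n ω)))
        atTop (nhds (Real.sqrt (2 * V * Real.log (1/α))))) := by
  have hXm : ∀ t, Measurable[ℱ t] (X t) := hadapt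
  have hXm0 : ∀ t, Measurable (X t) := fun t => (hXm t).mono (ℱ.le t) le_rfl
  have hbX : ∀ t, 1 ≤ t → ∀ᵐ ω ∂P, |X t ω - μ| ≤ 1 + |μ| := by
    intro t ht
    filter_upwards [hbdd t ht] with ω h
    refine (abs_sub _ _).trans ?_
    rw [abs_of_nonneg h.1]
    linarith [h.2]
  set B2 : ℝ := (1 + |μ|)^2 + |σ2| with hB2
  have hb2 : ∀ t, 1 ≤ t → ∀ᵐ ω ∂P, |(X t ω - μ)^2 - σ2| ≤ B2 := by
    intro t ht
    filter_upwards [hbX t ht] with ω h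
    refine (abs_sub _ _).trans ?_
    rw [abs_pow]
    have := pow_le_pow_left₀ (abs_nonneg _) h 2
    linarith
  have hb3 : ∀ t, 1 ≤ t → ∀ᵐ ω ∂P, |((X t ω - μ)^2 - σ2)^2 - V| ≤ B2^2 + |V| := by
    intro t ht
    filter_upwards [hb2 t ht] with ω h
    refine (abs_sub _ _).trans ?_
    rw [abs_pow]
    have := pow_le_pow_left₀ (abs_nonneg _) h 2
    linarith
  have hi2 : ∀ t, 1 ≤ t → Integrable (fun ω => (X t ω - μ)^2) P := by
    intro t ht
    refine Integrable.of_bound (((hXm0 t).sub_const μ).pow_const 2).aestronglyMeasurable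
      ((1 + |μ|)^2) ?_
    filter_upwards [hbX t ht] with ω h
    rw [Real.norm_eq_abs, abs_pow]
    exact pow_le_pow_left₀ (abs_nonneg _) h 2
  have hi3 : ∀ t, 1 ≤ t → Integrable (fun ω => ((X t ω - μ)^2 - σ2)^2) P := by
    intro t ht
    refine Integrable.of_bound
      (((((hXm0 t).sub_const μ).pow_const 2).sub_const σ2).pow_const 2).aestronglyMeasurable
      (B2^2) ?_
    filter_upwards [hb2 t ht] with ω h
    rw [Real.norm_eq_abs, abs_pow]
    exact pow_le_pow_left₀ (abs_nonneg _) h 2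
  have hcen : ∀ (f : Ω → ℝ) (c : ℝ) (t : ℕ), Integrable f P →
      P[f|ℱ (t-1)] =ᵐ[P] (fun _ => c) → P[(fun ω => f ω - c)|ℱ (t-1)] =ᵐ[P] 0 := by
    intro f c t hf hfc
    have h1 := condExp_sub hf (integrable_const c : Integrable (fun _ : Ω => c) P) (ℱ (t-1))
    have h2 : P[(fun _ : Ω => c)|ℱ (t-1)] = fun _ => c := condExp_const (ℱ.le _) c
    have e : (fun ω => f ω - c) = f - fun _ => c := rfl
    rw [e]
    filter_upwards [h1, hfc] with ω h h'
    rw [h, Pi.sub_apply, h', h2]; simp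
  have m1 := mart_bound P ℱ (fun t ω => X t ω - μ) (1 + |μ|)
    (fun t _ => (hXm t).sub_const μ) hbX (fun t ht => hcen (X t) μ t (hint t ht) (hmean t ht))
  have m2 := mart_bound P ℱ (fun t ω => (X t ω - μ)^2 - σ2) B2
    (fun t _ => (((hXm t).sub_const μ).pow_const 2).sub_const σ2) hb2
    (fun t ht => hcen _ σ2 t (hi2 t ht) (hvar t ht))
  have m3 := mart_bound P ℱ (fun t ω => ((X t ω - μ)^2 - σ2)^2 - V) (B2^2 + |V|)
    (fun t _ => (((((hXm t).sub_const μ).pow_const 2).sub_const σ2).pow_const 2).sub_const V) hb3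
    (fun t ht => hcen _ V t (hi3 t ht) (hvar4 t ht))
  have hall : ∀ᵐ ω ∂P, ∀ t, 1 ≤ t → X t ω ∈ Set.Icc (0:ℝ) 1 := by
    rw [ae_all_iff]; intro t
    rw [eventually_imp_distrib_left]; exact hbdd t
  have hV0 : ∀ᵐ ω ∂P, V = 0 → ∀ t, 1 ≤ t → (X t ω - μ)^2 = σ2 := by
    rw [eventually_imp_distrib_left]; intro hV
    rw [ae_all_iff]; intro t
    rw [eventually_imp_distrib_left]; intro ht
    have h1 : ∫ ω, ((X t ω - μ)^2 - σ2)^2 ∂P = 0 := by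
      rw [← integral_condExp (ℱ.le (t-1)), integral_congr_ae (hvar4 t ht), hV]; simp
    have h2 := (integral_eq_zero_iff_of_nonneg (fun ω => sq_nonneg _) (hi3 t ht)).1 h1
    filter_upwards [h2] with ω h
    have h' : ((X t ω - μ)^2 - σ2)^2 = 0 := h
    have := pow_eq_zero_iff (two_ne_zero) |>.1 h'
    linarith
  have hLpos : 0 < Real.log (1/α) := Real.log_pos (by
    rw [lt_div_iff₀ hα.1]; linarith [hα.2])
  filter_upwards [m1, m2, m3, hall, hV0] with ω ⟨C1, h1⟩ ⟨C2, h2⟩ ⟨C3, h3⟩ hx hv0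
  obtain ⟨hmain, hben⟩ := det_main X ω μ σ2 V c1 c2 c3 c4 c5 hc1 hc2 hc3 hc4 hc5 hx C1 C2 C3
    h1 h2 h3 hv0
  have hg := level_growth α hα
  simp only [← hα1def] at hg
  obtain ⟨C, hC⟩ := hben α1 hg.1 hg.2
  have hl2 := level2_tendsto α hα
  simp only [← hα2def] at hl2
  constructor
  · have := (hmain (fun _ => α) _ hLpos tendsto_const_nhds (fun _ _ => 0) 0 (fun _ _ => le_rfl)
      (Eventually.of_forall fun n => by simp)).1
    refine this.congr fun n => ?_
    ring
  · obtain ⟨ha, hb⟩ := hmain α2 _ hLpos hl2 (fun n i => (Rtilde c3 c4 c5 σ2 X (α1 n) i ω)^2) C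
      (fun _ _ => sq_nonneg _) hC
    have := ha.add hb
    rw [add_zero] at this
    refine this.congr fun n => ?_
    ring
end

section
/- Almost sure consistency of the fourth-moment estimator: let X_1, X_2, ... satisfy Assumption 1 and Assumption 2 with common conditional variance V := Var((X_i − μ)²), and let (μ̂_i)_{i≥1} and (σ̂_i²)_{i≥1} be [0,1]-valued predictable sequences such that μ̂_n → μ almost surely and σ̂_n² → σ² almost surely. Then (1/n) Σ_{i=1}^n [ (X_i − μ̂_i)² − σ̂_i² ]² → V almost surely as n → ∞; consequently, for any constant c_2 ∈ [0,1], the estimator m̂²_{4,n} := (c_2 + Σ_{i≤n−1} [ (X_i − μ̂_i)² − σ̂_i² ]² )/n also converges to V almost surely. -/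
open MeasureTheory ProbabilityTheory Filter Finset

/-- second moment bound for sums of bounded martingale differences -/
lemma sq_moment_aux {Ω : Type*} {m0 : MeasurableSpace Ω} (P : Measure Ω) [IsProbabilityMeasure P]
    (ℱ : Filtration ℕ m0) (D : ℕ → Ω → ℝ) (C : ℝ)
    (hD : ∀ n, StronglyMeasurable[ℱ (n+1)] (D n))
    (hb : ∀ n, ∀ᵐ ω ∂P, |D n ω| ≤ C)
    (hc : ∀ n, P[D n|ℱ n] =ᵐ[P] 0) (n : ℕ) :
    Integrable (fun ω => (∑ i ∈ range n, D i ω)^2) P ∧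
    ∫ ω, (∑ i ∈ range n, D i ω)^2 ∂P ≤ n * C^2 := by
  have hmeas : ∀ n, StronglyMeasurable[ℱ n] (fun ω => ∑ i ∈ range n, D i ω) := by
    intro n
    apply Finset.stronglyMeasurable_fun_sum
    intro i hi
    exact (hD i).mono (ℱ.mono (by simpa [Nat.succ_le_iff] using hi))
  have hbd : ∀ n : ℕ, ∀ᵐ ω ∂P, |∑ i ∈ range n, D i ω| ≤ n * C := by
    intro n
    filter_upwards [ae_all_iff.2 hb] with ω hω
    refine (Finset.abs_sum_le_sum_abs _ _).trans ?_
    refine (Finset.sum_le_sum (fun i _ => hω i)).trans ?_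
    simp
  have hDm : ∀ n, AEStronglyMeasurable (D n) P := fun n =>
    ((hD n).mono (ℱ.le _)).aestronglyMeasurable
  have hSm : ∀ n, AEStronglyMeasurable (fun ω => ∑ i ∈ range n, D i ω) P := fun n =>
    ((hmeas n).mono (ℱ.le _)).aestronglyMeasurable
  have hDi : ∀ n, Integrable (D n) P := fun n => Integrable.of_bound (hDm n) C (hb n)
  have hSi : ∀ n, Integrable (fun ω => ∑ i ∈ range n, D i ω) P := fun n =>
    Integrable.of_bound (hSm n) _ (hbd n)
  have hS2 : ∀ n, Integrable (fun ω => (∑ i ∈ range n, D i ω)^2) P := by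
    intro n
    simp only [pow_two]
    exact (hSi n).bdd_mul (hSm n) (hbd n)
  have hSD : ∀ n, Integrable (fun ω => (∑ i ∈ range n, D i ω) * D n ω) P := fun n =>
    (hDi n).bdd_mul (hSm n) (hbd n)
  have hD2 : ∀ n, Integrable (fun ω => (D n ω)^2) P := by
    intro n
    simp only [pow_two]
    exact (hDi n).bdd_mul (hDm n) (hb n)
  refine ⟨hS2 n, ?_⟩
  induction n with
  | zero => simp
  | succ n ih =>
    have h0 : ∫ ω, (∑ i ∈ range n, D i ω) * D n ω ∂P = 0 := by
      have h1 := condExp_mul_of_stronglyMeasurable_left (μ := P) (hmeas n) (hSD n) (hDi n)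
      have h2 : P[(fun ω => ∑ i ∈ range n, D i ω) * D n|ℱ n] =ᵐ[P] 0 := by
        filter_upwards [h1, hc n] with ω h1 h2
        simp [h1, h2]
      have h3 := integral_condExp (μ := P) (f := (fun ω => ∑ i ∈ range n, D i ω) * D n) (ℱ.le n)
      rw [integral_congr_ae h2] at h3
      simpa using h3.symm
    have h1 : ∫ ω, (D n ω)^2 ∂P ≤ C^2 := by
      have := integral_mono_ae (μ := P) (hD2 n) (integrable_const (C^2)) (by
        filter_upwards [hb n] with ω hω
        exact sq_le_sq' (abs_le.1 hω).1 (abs_le.1 hω).2)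
      simpa using this
    have h2 : ∫ ω, (∑ i ∈ range (n+1), D i ω)^2 ∂P =
        ∫ ω, (∑ i ∈ range n, D i ω)^2 ∂P + 2 * ∫ ω, (∑ i ∈ range n, D i ω) * D n ω ∂P
          + ∫ ω, (D n ω)^2 ∂P := by
      rw [← integral_const_mul, ← integral_add (hS2 n) ((hSD n).const_mul 2)]
      have h12 : Integrable (fun ω => (∑ i ∈ range n, D i ω)^2
          + 2 * ((∑ i ∈ range n, D i ω) * D n ω)) P := (hS2 n).add ((hSD n).const_mul 2)
      rw [← integral_add h12 (hD2 n)]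
      congr 1
      ext ω
      rw [Finset.sum_range_succ]
      ring
    rw [h2, h0]
    push_cast
    linarith

/-- convergence along squares -/
lemma squares_aux {Ω : Type*} {m0 : MeasurableSpace Ω} (P : Measure Ω) [IsProbabilityMeasure P]
    (ℱ : Filtration ℕ m0) (D : ℕ → Ω → ℝ) (C : ℝ)
    (hD : ∀ n, StronglyMeasurable[ℱ (n+1)] (D n))
    (hb : ∀ n, ∀ᵐ ω ∂P, |D n ω| ≤ C)
    (hc : ∀ n, P[D n|ℱ n] =ᵐ[P] 0) :
    ∀ᵐ ω ∂P, Tendsto (fun k : ℕ => (∑ i ∈ range (k^2), D i ω) / ((k^2 : ℕ) : ℝ))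
      atTop (nhds 0) := by
  have hm : ∀ k : ℕ, Measurable
      (fun ω => ENNReal.ofReal (((∑ i ∈ range (k^2), D i ω) / ((k^2 : ℕ) : ℝ))^2)) := by
    intro k
    have : ∀ i, Measurable (D i) := fun i => ((hD i).mono (ℱ.le _)).measurable
    fun_prop
  have hle : ∀ k : ℕ, ∫⁻ ω, ENNReal.ofReal (((∑ i ∈ range (k^2), D i ω) / ((k^2 : ℕ) : ℝ))^2) ∂P
      ≤ ENNReal.ofReal (C^2 * (1 / (k:ℝ)^2)) := by
    intro k
    obtain ⟨h1, h2⟩ := sq_moment_aux P ℱ D C hD hb hc (k^2)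
    simp only [div_pow]
    rw [← ofReal_integral_eq_lintegral_ofReal (h1.div_const _)
      (Eventually.of_forall fun ω => by positivity)]
    apply ENNReal.ofReal_le_ofReal
    rw [integral_div]
    rcases Nat.eq_zero_or_pos k with rfl | hk
    · simp
    · have hk' : (0:ℝ) < k := by exact_mod_cast hk
      rw [div_le_iff₀ (by positivity)]
      refine h2.trans (le_of_eq ?_)
      push_cast
      field_simp
  have hsum : ∑' k : ℕ, ENNReal.ofReal (C^2 * (1 / (k:ℝ)^2)) ≠ ⊤ :=
    Summable.tsum_ofReal_ne_top
      ((Real.summable_one_div_nat_pow.2 (by norm_num)).mul_left _)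
  have hfin : ∫⁻ ω, ∑' k : ℕ, ENNReal.ofReal
      (((∑ i ∈ range (k^2), D i ω) / ((k^2 : ℕ) : ℝ))^2) ∂P ≠ ⊤ := by
    rw [lintegral_tsum fun k => (hm k).aemeasurable]
    exact ne_top_of_le_ne_top hsum (ENNReal.tsum_le_tsum hle)
  filter_upwards [ae_lt_top (Measurable.ennreal_tsum hm) hfin] with ω hω
  have h := ENNReal.tendsto_atTop_zero_of_tsum_ne_top hω.ne
  have h' := (ENNReal.tendsto_toReal ENNReal.zero_ne_top).comp h
  have h'' : Tendsto (fun k : ℕ => ((∑ i ∈ range (k^2), D i ω) / ((k^2 : ℕ) : ℝ))^2)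
      atTop (nhds 0) := by
    refine h'.congr fun k => ?_
    simp only [Function.comp]
    exact ENNReal.toReal_ofReal (sq_nonneg _)
  have h3 := (Real.continuous_sqrt.tendsto 0).comp h''
  rw [Real.sqrt_zero] at h3
  rw [tendsto_zero_iff_abs_tendsto_zero]
  refine h3.congr fun k => ?_
  simp [Function.comp, Real.sqrt_sq_eq_abs]

lemma monotone_aux (Y : ℕ → ℝ) (V : ℝ) (hY : ∀ n, 0 ≤ Y n)
    (h : Tendsto (fun k : ℕ => (∑ i ∈ range (k^2), (Y i - V)) / ((k^2 : ℕ) : ℝ))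
      atTop (nhds 0)) :
    Tendsto (fun n : ℕ => (∑ i ∈ range n, Y i) / (n:ℝ)) atTop (nhds V) := by
  apply tendsto_div_of_monotone_of_exists_subseq_tendsto_div (fun n => ∑ i ∈ range n, Y i)
  · exact monotone_nat_of_le_succ fun n => by rw [Finset.sum_range_succ]; linarith [hY n]
  · intro a ha
    refine ⟨fun k => k^2, ?_, tendsto_pow_atTop two_ne_zero, ?_⟩
    · have h1 : Tendsto (fun n : ℕ => (1 + 1 / (n:ℝ))^2) atTop (nhds ((1+0)^2)) :=
        ((tendsto_const_nhds).add tendsto_one_div_atTop_nhds_zero_nat).pow 2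
      filter_upwards [h1.eventually_lt_const (u := a) (by simpa using ha), eventually_gt_atTop 0]
        with n hn hn0
      have hn' : (0:ℝ) < n := by exact_mod_cast hn0
      have h2 : ((n:ℝ)+1)^2 = (1 + 1/(n:ℝ))^2 * (n:ℝ)^2 := by field_simp
      push_cast
      rw [h2]
      gcongr
    · have h2 := h.add_const V
      rw [zero_add] at h2
      refine h2.congr' ?_
      filter_upwards [eventually_gt_atTop 0] with k hk
      have hk' : (0:ℝ) < k := by exact_mod_cast hk
      rw [Finset.sum_sub_distrib]
      simp only [sum_const, card_range, nsmul_eq_mul]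
      push_cast
      field_simp
      ring

/-- Proposition 16 of the paper: almost sure consistency of the fourth-moment
estimator. -/
theorem fourth_moment_as_convergence
    {Ω : Type*} {m0 : MeasurableSpace Ω} (P : Measure Ω) [IsProbabilityMeasure P]
    (ℱ : Filtration ℕ m0) (X muhat sighat2 : ℕ → Ω → ℝ) (μ σ2 V : ℝ)
    (hadapt : Adapted ℱ X)
    (hint : ∀ t, 1 ≤ t → Integrable (X t) P)
    (hbdd : ∀ t, 1 ≤ t → ∀ᵐ ω ∂P, X t ω ∈ Set.Icc (0:ℝ) 1)
    (hmean : ∀ t, 1 ≤ t → P[X t|ℱ (t - 1)] =ᵐ[P] fun _ => μ)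
    (hvar : ∀ t, 1 ≤ t → P[(fun ω => (X t ω - μ)^2)|ℱ (t - 1)] =ᵐ[P] fun _ => σ2)
    (hvar4 : ∀ t, 1 ≤ t →
      P[(fun ω => ((X t ω - μ)^2 - σ2)^2)|ℱ (t - 1)] =ᵐ[P] fun _ => V)
    (hmu_pred : ∀ t, 1 ≤ t → StronglyMeasurable[ℱ (t - 1)] (muhat t))
    (hmu_mem : ∀ t, 1 ≤ t → ∀ ω, muhat t ω ∈ Set.Icc (0:ℝ) 1)
    (hsig_pred : ∀ t, 1 ≤ t → StronglyMeasurable[ℱ (t - 1)] (sighat2 t))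
    (hsig_mem : ∀ t, 1 ≤ t → ∀ ω, sighat2 t ω ∈ Set.Icc (0:ℝ) 1)
    (hmu_lim : ∀ᵐ ω ∂P, Tendsto (fun n : ℕ => muhat n ω) atTop (nhds μ))
    (hsig_lim : ∀ᵐ ω ∂P, Tendsto (fun n : ℕ => sighat2 n ω) atTop (nhds σ2)) :
    ∀ᵐ ω ∂P,
      Tendsto (fun n : ℕ => (1/(n:ℝ)) *
          ∑ i ∈ Finset.Icc 1 n, ((X i ω - muhat i ω)^2 - sighat2 i ω)^2)
        atTop (nhds V) ∧
      ∀ c2 ∈ Set.Icc (0:ℝ) 1,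
        Tendsto (fun n : ℕ =>
            (c2 + ∑ i ∈ Finset.Icc 1 (n-1), ((X i ω - muhat i ω)^2 - sighat2 i ω)^2) / (n:ℝ))
          atTop (nhds V) := by
  set A : ℝ := (1 + |μ|)^2 + |σ2| with hA
  have hbX : ∀ n, ∀ᵐ ω ∂P, |(X (n+1) ω - μ)^2 - σ2| ≤ A := by
    intro n
    filter_upwards [hbdd (n+1) (by omega)] with ω hω
    have h1 : |X (n+1) ω - μ| ≤ 1 + |μ| := by
      refine (abs_sub _ _).trans ?_
      rw [abs_of_nonneg hω.1]
      linarith [hω.2]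
    refine (abs_sub _ _).trans ?_
    rw [abs_pow, hA]
    gcongr
  let Y : ℕ → Ω → ℝ := fun n ω => ((X (n+1) ω - μ)^2 - σ2)^2
  have hYm : ∀ n, StronglyMeasurable[ℱ (n+1)] (Y n) := by
    intro n
    have := (hadapt (n+1)).stronglyMeasurable
    exact (((this.sub stronglyMeasurable_const).pow 2).sub stronglyMeasurable_const).pow 2
  have hYb : ∀ n, ∀ᵐ ω ∂P, |Y n ω| ≤ A^2 := by
    intro n
    filter_upwards [hbX n] with ω hω
    simp only [Y, abs_pow]
    gcongr
  have hYi : ∀ n, Integrable (Y n) P := fun n =>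
    Integrable.of_bound ((hYm n).mono (ℱ.le _)).aestronglyMeasurable _ (hYb n)
  have hsq := squares_aux P ℱ (fun n ω => Y n ω - V) (A^2 + |V|)
    (fun n => (hYm n).sub stronglyMeasurable_const)
    (fun n => by
      filter_upwards [hYb n] with ω hω
      exact (abs_sub _ _).trans (by linarith))
    (fun n => by
      have h1 := condExp_sub (hYi n) (integrable_const (μ := P) V) (ℱ n)
      have h2 := hvar4 (n+1) (by omega)
      rw [Nat.add_sub_cancel] at h2
      have h3 : P[(fun _ => V : Ω → ℝ)|ℱ n] = fun _ => V := condExp_const (ℱ.le n) V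
      refine EventuallyEq.trans h1 ?_
      filter_upwards [h2] with ω h2
      rw [Pi.sub_apply, h3]
      change (P[Y n|ℱ n]) ω = V at h2
      simp [h2])
  filter_upwards [hsq, ae_all_iff.2 hbX, ae_all_iff.2 (fun n => hbdd (n+1) (by omega)),
    hmu_lim, hsig_lim] with ω h1 h2 h3 h4 h5
  have hY := monotone_aux (fun n => Y n ω) V (fun n => sq_nonneg _) h1
  replace h4 := (tendsto_add_atTop_iff_nat 1).2 h4
  replace h5 := (tendsto_add_atTop_iff_nat 1).2 h5
  let d : ℕ → ℝ := fun n => (2 * X (n+1) ω - 2 * μ) * (μ - muhat (n+1) ω)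
    - (muhat (n+1) ω - μ)* (μ - muhat (n+1) ω) + (σ2 - sighat2 (n+1) ω)
  have hd : Tendsto d atTop (nhds 0) := by
    have e4 : Tendsto (fun n => μ - muhat (n+1) ω) atTop (nhds 0) := by
      simpa using h4.const_sub μ
    have e4' : Tendsto (fun n => muhat (n+1) ω - μ) atTop (nhds 0) := by
      simpa using h4.sub_const μ
    have e5 : Tendsto (fun n => σ2 - sighat2 (n+1) ω) atTop (nhds 0) := by
      simpa using h5.const_sub σ2
    have e6 : Tendsto (fun n => (2 * X (n+1) ω - 2 * μ) * (μ - muhat (n+1) ω)) atTop (nhds 0) := by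
      refine bdd_le_mul_tendsto_zero' (2 + 2 * |μ|) (Eventually.of_forall fun n => ?_) e4
      refine (abs_sub _ _).trans ?_
      rw [abs_mul, abs_mul, abs_of_nonneg (h3 n).1, abs_two]
      linarith [(h3 n).2]
    simpa using (e6.sub (e4'.mul e4)).add e5
  let g : ℕ → ℝ := fun n => ((X (n+1) ω - μ)^2 - σ2) * d n * 2 + d n * d n
  have hg : Tendsto g atTop (nhds 0) := by
    have e1 : Tendsto (fun n => ((X (n+1) ω - μ)^2 - σ2) * d n) atTop (nhds 0) :=
      bdd_le_mul_tendsto_zero' A (Eventually.of_forall h2) hd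
    simpa using (e1.mul_const 2).add (hd.mul hd)
  have hmain : Tendsto (fun n : ℕ =>
      (∑ i ∈ Finset.Icc 1 n, ((X i ω - muhat i ω)^2 - sighat2 i ω)^2) / (n:ℝ))
        atTop (nhds V) := by
    have := hY.add hg.cesaro
    rw [add_zero] at this
    refine this.congr fun n => ?_
    have e : ∑ i ∈ Finset.Icc 1 n, ((X i ω - muhat i ω)^2 - sighat2 i ω)^2
        = ∑ i ∈ range n, (Y i ω + g i) := by
      rw [← Finset.Ico_add_one_right_eq_Icc, Finset.sum_Ico_eq_sum_range, Nat.add_sub_cancel]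
      refine Finset.sum_congr rfl fun i _ => ?_
      rw [add_comm 1 i]
      simp only [Y, g, d]
      ring
    rw [e, Finset.sum_add_distrib (f := fun i => Y i ω) (g := g), add_div, inv_mul_eq_div]
  refine ⟨hmain.congr fun n => by rw [one_div, inv_mul_eq_div], fun c2 _ => ?_⟩
  rw [← tendsto_add_atTop_iff_nat 1]
  have e1 : Tendsto (fun n : ℕ => c2 * (1 / ((n:ℝ)+1))) atTop (nhds 0) := by
    simpa using tendsto_one_div_add_atTop_nhds_zero_nat.const_mul c2
  have e2 : Tendsto (fun n : ℕ => (n:ℝ) / ((n:ℝ)+1)) atTop (nhds 1) :=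
    tendsto_natCast_div_add_atTop 1
  have e3 := e1.add (hmain.mul e2)
  rw [zero_add, mul_one] at e3
  refine e3.congr' ?_
  filter_upwards [eventually_gt_atTop 0] with n hn
  have hn' : (0:ℝ) < n := by exact_mod_cast hn
  rw [Nat.add_sub_cancel]
  push_cast
  field_simp
end

section
/- Rate of the fourth-moment estimator in the degenerate case: let X_1, X_2, ... satisfy Assumption 1 and Assumption 2 with common conditional variance V := Var((X_i − μ)²) equal to 0, and define the estimators μ̂_t := (c_4 + Σ_{i≤t−1} X_i)/t, σ̂_t² := (c_3 + Σ_{i≤t−1}(X_i − μ̂_i)²)/t, and m̂²_{4,t} := (c_2 + Σ_{i≤t−1} [ (X_i − μ̂_i)² − σ̂_i² ]² )/t, with constants c_2, c_3, c_4 ∈ [0,1]. Then almost surely m̂²_{4,t} = Õ(1/t); that is, almost surely there exist a finite constant C and an exponent k ≥ 0 such that m̂²_{4,t} ≤ C (1 + log t)^k / t for all t ≥ 1. -/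
open MeasureTheory ProbabilityTheory Filter Finset

variable {Ω : Type*}

lemma aux_summable : Summable fun n : ℕ => 1 / ((n:ℝ) * (1 + Real.log n)^2) := by
  rw [← summable_condensed_iff_of_nonneg]
  · have h2 : (1/2:ℝ) ≤ Real.log 2 := by
      have := Real.log_two_gt_d9
      linarith
    have h : Summable fun k : ℕ => 4 * (1 / ((k:ℝ) + 1)^2) := by
      apply Summable.mul_left
      have := (summable_nat_add_iff (f := fun n : ℕ => 1 / (n:ℝ)^2) 1).2
        (Real.summable_one_div_nat_pow.2 one_lt_two)
      simpa using this
    refine Summable.of_nonneg_of_le (fun k => by positivity) (fun k => ?_) h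
    have e : (2:ℝ)^k * (1 / (((2^k : ℕ) : ℝ) * (1 + Real.log ((2^k : ℕ) : ℝ))^2))
        = 1 / (1 + k * Real.log 2)^2 := by
      push_cast
      rw [Real.log_pow]
      field_simp
    rw [e]
    have hk : (0:ℝ) ≤ k := Nat.cast_nonneg k
    have h3 : ((k:ℝ) + 1) / 2 ≤ 1 + k * Real.log 2 := by nlinarith
    have h4 : 4 * (1 / ((k:ℝ) + 1)^2) = 1 / (((k:ℝ)+1)/2)^2 := by field_simp; norm_num
    rw [h4]
    gcongr
  · intro n; positivity
  · intro m n hm hmn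
    have hm' : (0:ℝ) < m := by exact_mod_cast hm
    have h1 : (1:ℝ) ≤ m := by exact_mod_cast hm
    have := Real.log_nonneg h1
    have hmn' : (m:ℝ) ≤ n := by exact_mod_cast hmn
    gcongr

lemma aux_ae_summable {m0 : MeasurableSpace Ω} (P : Measure Ω) (f : ℕ → Ω → ℝ) (b : ℕ → ℝ)
    (hf : ∀ n, Integrable (f n) P) (h0 : ∀ n ω, 0 ≤ f n ω)
    (hb : ∀ n, ∫ ω, f n ω ∂P ≤ b n) (hs : Summable b) :
    ∀ᵐ ω ∂P, Summable fun n => f n ω := by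
  have hm : ∀ n, AEMeasurable (fun ω => ENNReal.ofReal (f n ω)) P :=
    fun n => (hf n).aemeasurable.ennreal_ofReal
  have h1 : ∫⁻ ω, ∑' n, ENNReal.ofReal (f n ω) ∂P ≠ ⊤ := by
    rw [lintegral_tsum hm]
    refine ne_top_of_le_ne_top hs.tsum_ofReal_ne_top (ENNReal.tsum_le_tsum fun n => ?_)
    rw [← ofReal_integral_eq_lintegral_ofReal (hf n) (ae_of_all _ (h0 n))]
    exact ENNReal.ofReal_le_ofReal (hb n)
  filter_upwards [ae_lt_top' (AEMeasurable.tsum hm) h1] with ω hω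
  have := ENNReal.summable_toReal hω.ne
  simpa [ENNReal.toReal_ofReal, h0] using this

lemma aux_det (X : ℕ → Ω → ℝ) (ω : Ω) (μ σ2 c2 c3 c4 M C : ℝ) (hM0 : 0 ≤ M) (hc2 : 0 ≤ c2)
    (hD : ∀ i, 1 ≤ i → (X i ω - μ)^2 = σ2)
    (hM : ∀ i, 1 ≤ i → (μ - muHat c4 X i ω)^2 ≤ M)
    (hA : ∀ t : ℕ, 1 ≤ t → ∑ j ∈ Finset.Icc 1 (t-1), (μ - muHat c4 X j ω)^2
      ≤ C * (1 + Real.log t)^2) :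
    ∃ C : ℝ, ∃ k : ℕ, ∀ t : ℕ, 1 ≤ t →
      m4Hat2 c2 c3 c4 X t ω ≤ C * (1 + Real.log t)^k / (t : ℝ) := by
  have hC : 0 ≤ C := by simpa using hA 1 le_rfl
  have hs : 0 ≤ σ2 := by rw [← hD 1 le_rfl]; positivity
  set e : ℕ → ℝ := fun j => μ - muHat c4 X j ω with he
  set y : ℕ → ℝ := fun j => 2 * (X j ω - μ) * e j + e j ^ 2 with hy
  set K : ℝ := 2 * (4 * σ2 + M) with hK
  have hK0 : 0 ≤ K := by positivity
  set Q : ℝ := (c3 - σ2)^2 with hQ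
  have hQ0 : 0 ≤ Q := by positivity
  have hxy : ∀ j, 1 ≤ j → (X j ω - muHat c4 X j ω)^2 = σ2 + y j := by
    intro j hj
    rw [← hD j hj]
    simp only [hy, he]
    ring
  have hy2 : ∀ j, 1 ≤ j → y j ^ 2 ≤ K * e j ^ 2 := by
    intro j hj
    have h1 : y j ^ 2 ≤ 2 * ((2 * (X j ω - μ) * e j)^2 + (e j ^ 2)^2) := by
      simp only [hy]
      exact add_sq_le
    have h2 : (2 * (X j ω - μ) * e j)^2 = 4 * σ2 * e j ^ 2 := by
      rw [← hD j hj]; ring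
    have h3 : (e j ^ 2)^2 ≤ M * e j ^ 2 := by
      rw [sq (e j ^ 2)]
      exact mul_le_mul_of_nonneg_right (hM j hj) (sq_nonneg _)
    rw [h2] at h1
    rw [hK]; nlinarith
  have hL : ∀ t : ℕ, 1 ≤ t → 1 ≤ 1 + Real.log t := by
    intro t ht
    have : (1:ℝ) ≤ t := by exact_mod_cast ht
    linarith [Real.log_nonneg this]
  have hR : ∀ i : ℕ, 1 ≤ i → (sigHat2 c3 c4 X i ω - σ2)^2
      ≤ 2 * (Q + K * C) * (1 + Real.log i)^2 * (i:ℝ)⁻¹ := by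
    intro i hi
    have hi' : (1:ℝ) ≤ i := by exact_mod_cast hi
    have hi0 : (0:ℝ) < i := by linarith
    have e1 : sigHat2 c3 c4 X i ω - σ2 = ((c3 - σ2) + ∑ j ∈ Finset.Icc 1 (i-1), y j) / i := by
      unfold sigHat2
      rw [Finset.sum_congr rfl (fun j hj => hxy j (Finset.mem_Icc.1 hj).1), Finset.sum_add_distrib]
      simp only [Finset.sum_const, Nat.card_Icc, nsmul_eq_mul, Nat.add_sub_cancel]
      rw [Nat.cast_sub hi]
      field_simp
      push_cast
      ring
    have e2 : (∑ j ∈ Finset.Icc 1 (i-1), y j)^2 ≤ i * (K * (C * (1 + Real.log i)^2)) := by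
      refine (sq_sum_le_card_mul_sum_sq).trans ?_
      have h1 : ∑ j ∈ Finset.Icc 1 (i-1), y j ^ 2 ≤ K * (C * (1 + Real.log i)^2) := by
        calc _ ≤ ∑ j ∈ Finset.Icc 1 (i-1), K * e j ^ 2 :=
              Finset.sum_le_sum fun j hj => hy2 j (Finset.mem_Icc.1 hj).1
          _ = K * ∑ j ∈ Finset.Icc 1 (i-1), e j ^ 2 := by rw [Finset.mul_sum]
          _ ≤ _ := mul_le_mul_of_nonneg_left (hA i hi) hK0
      have h2 : ((Finset.Icc 1 (i-1)).card : ℝ) ≤ i := by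
        rw [Nat.card_Icc]; exact_mod_cast (by omega)
      exact mul_le_mul h2 h1 (Finset.sum_nonneg fun _ _ => sq_nonneg _) hi0.le
    have hL2 : 1 ≤ (1 + Real.log i)^2 := one_le_pow₀ (hL i hi)
    have e3 : Q ≤ i * (Q * (1 + Real.log i)^2) := by
      have : Q ≤ Q * (1 + Real.log i)^2 := le_mul_of_one_le_right hQ0 hL2
      exact this.trans (le_mul_of_one_le_left (by positivity) hi')
    rw [e1, div_pow, div_le_iff₀ (by positivity)]
    have e4 : 2 * (Q + K * C) * (1 + Real.log i)^2 * (i:ℝ)⁻¹ * (i:ℝ)^2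
       = 2 * (i * (Q * (1 + Real.log i)^2) + i * (K * (C * (1 + Real.log i)^2))) := by
      field_simp
    rw [e4]
    refine add_sq_le.trans ?_
    linarith
  refine ⟨c2 + 2 * (K * C) + 2 * (2 * (Q + K * C)), 3, fun t ht => ?_⟩
  unfold m4Hat2
  gcongr
  have hLt := hL t ht
  set L := 1 + Real.log t with hLdef
  have h3 : 1 ≤ L^3 := one_le_pow₀ hLt
  have h23 : L^2 ≤ L^3 := pow_le_pow_right₀ hLt (by norm_num)
  have hharm : ∑ i ∈ Finset.Icc 1 (t-1), (i:ℝ)⁻¹ ≤ L := by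
    have h := harmonic_le_one_add_log t
    rw [harmonic_eq_sum_Icc] at h
    push_cast at h
    refine le_trans ?_ h
    exact Finset.sum_le_sum_of_subset_of_nonneg (Finset.Icc_subset_Icc le_rfl (by omega))
      (fun _ _ _ => by positivity)
  have hterm : ∀ i ∈ Finset.Icc 1 (t-1),
      ((X i ω - muHat c4 X i ω)^2 - sigHat2 c3 c4 X i ω)^2
        ≤ 2 * K * e i ^ 2 + 2 * (2 * (Q + K * C)) * L^2 * (i:ℝ)⁻¹ := by
    intro i hi
    obtain ⟨hi1, hi2⟩ := Finset.mem_Icc.1 hi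
    have hi0 : (0:ℝ) < i := by exact_mod_cast hi1
    have hLi : (1 + Real.log i)^2 ≤ L^2 := by
      have := hL i hi1
      have hit : (i:ℝ) ≤ t := by exact_mod_cast (by omega)
      have := Real.log_le_log hi0 hit
      refine pow_le_pow_left₀ (by linarith) ?_ 2
      rw [hLdef]
      linarith
    have hr := hR i hi1
    have hr2 : 2 * (Q + K * C) * (1 + Real.log i)^2 * (i:ℝ)⁻¹
       ≤ 2 * (Q + K * C) * L^2 * (i:ℝ)⁻¹ := by gcongr
    rw [hxy i hi1]
    have h1 : (σ2 + y i - sigHat2 c3 c4 X i ω)^2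
        ≤ 2 * (y i ^ 2 + (sigHat2 c3 c4 X i ω - σ2)^2) := by
      nlinarith [sq_nonneg (y i + (sigHat2 c3 c4 X i ω - σ2))]
    have := hy2 i hi1
    linarith
  have hsum := Finset.sum_le_sum hterm
  rw [Finset.sum_add_distrib, ← Finset.mul_sum, ← Finset.mul_sum] at hsum
  have hAt := hA t ht
  have b1 : 2 * K * ∑ j ∈ Finset.Icc 1 (t-1), e j ^ 2 ≤ 2 * K * (C * L^3) := by
    have : C * L^2 ≤ C * L^3 := by gcongr
    have h' := hAt.trans this
    gcongr
  have b2 : 2 * (2 * (Q + K * C)) * L^2 * ∑ i ∈ Finset.Icc 1 (t-1), (i:ℝ)⁻¹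
      ≤ 2 * (2 * (Q + K * C)) * L^2 * L := by gcongr
  have b3 : c2 ≤ c2 * L^3 := le_mul_of_one_le_right hc2 h3
  calc _ ≤ c2 * L^3 + (2 * K * (C * L^3) + 2 * (2 * (Q + K * C)) * L^2 * L) := by linarith
    _ = _ := by ring

lemma aux_moment {m0 : MeasurableSpace Ω} (P : Measure Ω) [IsProbabilityMeasure P]
    (ℱ : Filtration ℕ m0) (X : ℕ → Ω → ℝ) (μ σ2 : ℝ)
    (hadapt : Adapted ℱ X)
    (hbdd : ∀ t, 1 ≤ t → ∀ᵐ ω ∂P, X t ω ∈ Set.Icc (0:ℝ) 1)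
    (hmean : ∀ t, 1 ≤ t → P[X t|ℱ (t - 1)] =ᵐ[P] fun _ => μ)
    (hvar : ∀ t, 1 ≤ t → P[(fun ω => (X t ω - μ)^2)|ℱ (t - 1)] =ᵐ[P] fun _ => σ2) (n : ℕ) :
    MemLp (fun ω => ∑ i ∈ Finset.Icc 1 n, (X i ω - μ)) 2 P ∧
    ∫ ω, (∑ i ∈ Finset.Icc 1 n, (X i ω - μ))^2 ∂P = n * σ2 := by
  have hXm : ∀ t, Measurable (X t) := fun t => (hadapt t).mono (ℱ.le t) le_rfl
  have hX2 : ∀ t, 1 ≤ t → MemLp (X t) 2 P := by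
    intro t ht
    refine MemLp.of_bound (hXm t).aestronglyMeasurable 1 ?_
    filter_upwards [hbdd t ht] with ω hω
    rw [Real.norm_eq_abs, abs_le]
    exact ⟨by linarith [hω.1], hω.2⟩
  have hD2 : ∀ t, 1 ≤ t → MemLp (fun ω => X t ω - μ) 2 P :=
    fun t ht => (hX2 t ht).sub (memLp_const μ)
  induction n with
  | zero => simp
  | succ n ih =>
    obtain ⟨ih1, ih2⟩ := ih
    have hd := hD2 (n+1) (by omega)
    simp only [Finset.sum_Icc_succ_top (show 1 ≤ n + 1 by omega)]
    refine ⟨ih1.add hd, ?_⟩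
    set S : Ω → ℝ := fun ω => ∑ i ∈ Finset.Icc 1 n, (X i ω - μ) with hS
    set D : Ω → ℝ := fun ω => X (n+1) ω - μ with hDdef
    have hSm : StronglyMeasurable[ℱ n] S := by
      apply Measurable.stronglyMeasurable
      refine Finset.measurable_fun_sum _ fun i hi => ?_
      exact ((hadapt i).mono (ℱ.mono (Finset.mem_Icc.1 hi).2) le_rfl).sub_const μ
    have hSD : Integrable (S * D) P := ih1.integrable_mul hd
    have hDi : Integrable D P := hd.integrable (by norm_num)
    have hXi : Integrable (X (n+1)) P := (hX2 (n+1) (by omega)).integrable (by norm_num)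
    have hcD : P[D|ℱ n] =ᵐ[P] 0 := by
      have h1 := condExp_sub hXi (integrable_const μ) (ℱ n)
      have h2 := hmean (n+1) (by omega)
      rw [Nat.add_sub_cancel] at h2
      have h3 : P[(fun _ : Ω => μ)|ℱ n] = fun _ => μ := condExp_const (ℱ.le n) μ
      filter_upwards [h1, h2] with ω a b
      change (P[X (n+1) - fun _ => μ|ℱ n]) ω = 0
      rw [a, Pi.sub_apply, b, h3]
      simp
    have hzero : ∫ ω, (S * D) ω ∂P = 0 := by
      rw [← integral_condExp (ℱ.le n)]
      have h1 := condExp_mul_of_stronglyMeasurable_left hSm hSD hDi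
      have : P[S * D|ℱ n] =ᵐ[P] 0 := by
        filter_upwards [h1, hcD] with ω a b
        rw [a, Pi.mul_apply, b]; simp
      rw [integral_congr_ae this]; simp
    have hsq : ∫ ω, (D ω)^2 ∂P = σ2 := by
      have h2 := hvar (n+1) (by omega)
      rw [← integral_condExp (ℱ.le (n+1-1)), integral_congr_ae h2]; simp
    have hexp : ∀ ω, (S ω + D ω)^2 = (S ω)^2 + 2 * (S * D) ω + (D ω)^2 := by
      intro ω; simp only [Pi.mul_apply]; ring
    change ∫ ω, (S ω + D ω)^2 ∂P = _
    simp_rw [hexp]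
    have hab : Integrable (fun ω => S ω ^ 2 + 2 * (S * D) ω) P :=
      ih1.integrable_sq.add (hSD.const_mul 2)
    have ih3 : ∫ ω, S ω ^ 2 ∂P = n * σ2 := ih2
    rw [integral_add hab hd.integrable_sq,
      integral_add ih1.integrable_sq (hSD.const_mul 2), integral_const_mul, hzero, hsq, ih3]
    push_cast; ring

/-- Proposition 17 of the paper: in the degenerate case `V = 0`, the fourth-moment
estimator is `Õ(1/t)` almost surely. -/
theorem fourth_moment_rate_degenerate
    {m0 : MeasurableSpace Ω} (P : Measure Ω) [IsProbabilityMeasure P]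
    (ℱ : Filtration ℕ m0) (X : ℕ → Ω → ℝ) (μ σ2 V : ℝ) (c2 c3 c4 : ℝ)
    (hc2 : c2 ∈ Set.Icc (0:ℝ) 1) (hc3 : c3 ∈ Set.Icc (0:ℝ) 1) (hc4 : c4 ∈ Set.Icc (0:ℝ) 1)
    (hadapt : Adapted ℱ X)
    (hint : ∀ t, 1 ≤ t → Integrable (X t) P)
    (hbdd : ∀ t, 1 ≤ t → ∀ᵐ ω ∂P, X t ω ∈ Set.Icc (0:ℝ) 1)
    (hmean : ∀ t, 1 ≤ t → P[X t|ℱ (t - 1)] =ᵐ[P] fun _ => μ)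
    (hvar : ∀ t, 1 ≤ t → P[(fun ω => (X t ω - μ)^2)|ℱ (t - 1)] =ᵐ[P] fun _ => σ2)
    (hvar4 : ∀ t, 1 ≤ t →
      P[(fun ω => ((X t ω - μ)^2 - σ2)^2)|ℱ (t - 1)] =ᵐ[P] fun _ => V)
    (hV : V = 0) :
    ∀ᵐ ω ∂P, ∃ C : ℝ, ∃ k : ℕ, ∀ t : ℕ, 1 ≤ t →
      m4Hat2 c2 c3 c4 X t ω ≤ C * (1 + Real.log t)^k / (t : ℝ) := by
  have hXm : ∀ t, Measurable (X t) := fun t => (hadapt t).mono (ℱ.le t) le_rfl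
  -- the squared deviations are almost surely constant
  have hD : ∀ᵐ ω ∂P, ∀ i, 1 ≤ i → (X i ω - μ)^2 = σ2 := by
    rw [ae_all_iff]
    intro i
    by_cases hi : 1 ≤ i
    · have h1 : ∫ ω, ((X i ω - μ)^2 - σ2)^2 ∂P = 0 := by
        rw [← integral_condExp (ℱ.le (i-1)), integral_congr_ae (hvar4 i hi), hV]; simp
      have h2 : Integrable (fun ω => ((X i ω - μ)^2 - σ2)^2) P := by
        refine Integrable.of_bound
          ((((hXm i).sub_const μ).pow_const 2).sub_const σ2 |>.pow_const 2).aestronglyMeasurable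
          (((1 + |μ|)^2 + |σ2|)^2) ?_
        filter_upwards [hbdd i hi] with ω hω
        have ha : |X i ω| ≤ 1 := abs_le.2 ⟨by linarith [hω.1], hω.2⟩
        have hb : |X i ω - μ| ≤ 1 + |μ| := (abs_sub _ _).trans (by linarith)
        rw [Real.norm_eq_abs, abs_pow]
        gcongr
        refine (abs_sub _ _).trans ?_
        rw [abs_pow]
        gcongr
      rw [integral_eq_zero_iff_of_nonneg (fun ω => sq_nonneg _) h2] at h1
      filter_upwards [h1] with ω hω _
      have : (X i ω - μ)^2 - σ2 = 0 := by simpa using hω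
      linarith
    · exact ae_of_all _ fun ω h => absurd h hi
  have hB : ∀ᵐ ω ∂P, ∀ i, 1 ≤ i → X i ω ∈ Set.Icc (0:ℝ) 1 := by
    rw [ae_all_iff]
    intro i
    by_cases hi : 1 ≤ i
    · filter_upwards [hbdd i hi] with ω hω _ using hω
    · exact ae_of_all _ fun ω h => absurd h hi
  have hmom := aux_moment P ℱ X μ σ2 hadapt hbdd hmean hvar
  have hs0 : 0 ≤ σ2 := by
    have := (hmom 1).2
    have h2 : 0 ≤ ∫ ω, (∑ i ∈ Finset.Icc 1 1, (X i ω - μ))^2 ∂P :=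
      integral_nonneg fun ω => sq_nonneg _
    rw [this] at h2
    simpa using h2
  set Q : ℝ := (μ - c4)^2 with hQ
  have he : ∀ t : ℕ, 1 ≤ t → ∀ ω, μ - muHat c4 X t ω
      = ((μ - c4) - ∑ i ∈ Finset.Icc 1 (t-1), (X i ω - μ)) / t := by
    intro t ht ω
    have ht0 : (0:ℝ) < t := by exact_mod_cast ht
    unfold muHat
    rw [Finset.sum_sub_distrib]
    simp only [Finset.sum_const, Nat.card_Icc, nsmul_eq_mul, Nat.add_sub_cancel]
    rw [Nat.cast_sub ht]
    field_simp
    push_cast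
    ring
  have hmem : ∀ t : ℕ, 1 ≤ t → MemLp (fun ω => μ - muHat c4 X t ω) 2 P := by
    intro t ht
    have h := ((memLp_const (μ - c4)).sub (hmom (t-1)).1).mul_const ((t:ℝ)⁻¹)
    refine h.ae_eq (ae_of_all _ fun ω => ?_)
    exact ((he t ht ω).trans (div_eq_mul_inv _ _)).symm
  have hEe : ∀ t : ℕ, 1 ≤ t → ∫ ω, (μ - muHat c4 X t ω)^2 ∂P ≤ 2 * (Q + σ2) * (1 / t) := by
    intro t ht
    have ht1 : (1:ℝ) ≤ t := by exact_mod_cast ht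
    have ht0 : (0:ℝ) < t := by linarith
    have hSi := (hmom (t-1)).1.integrable_sq
    have hle : ∫ ω, (μ - muHat c4 X t ω)^2 ∂P ≤
        ∫ ω, 2 * (Q + (∑ i ∈ Finset.Icc 1 (t-1), (X i ω - μ))^2) / (t:ℝ)^2 ∂P := by
      refine integral_mono (hmem t ht).integrable_sq
        ((((integrable_const Q).add hSi).const_mul 2).div_const _) fun ω => ?_
      simp only []
      rw [he t ht ω, div_pow]
      gcongr
      rw [hQ]
      nlinarith [sq_nonneg ((μ - c4) + ∑ i ∈ Finset.Icc 1 (t-1), (X i ω - μ))]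
    refine hle.trans ?_
    rw [integral_div, integral_const_mul, integral_add (integrable_const Q) hSi, (hmom (t-1)).2]
    simp only [integral_const, probReal_univ, one_smul]
    have h3 : (((t-1 : ℕ)) : ℝ) ≤ t := by exact_mod_cast Nat.sub_le t 1
    have h4 : 2 * (Q + σ2) * (1 / (t:ℝ)) = 2 * (t * Q + t * σ2) / (t:ℝ)^2 := by field_simp
    rw [h4]
    have hQ0 : 0 ≤ Q := sq_nonneg _
    gcongr
    exact le_mul_of_one_le_left hQ0 ht1
  -- weighted sum of squared errors is almost surely finite
  have hsum : ∀ᵐ ω ∂P, Summable fun n : ℕ =>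
      if 1 ≤ n then (μ - muHat c4 X n ω)^2 * (1 / (1 + Real.log n)^2) else 0 := by
    refine aux_ae_summable P
      (fun n ω => if 1 ≤ n then (μ - muHat c4 X n ω)^2 * (1 / (1 + Real.log n)^2) else 0)
      (fun n => 2 * (Q + σ2) * (1 / ((n:ℝ) * (1 + Real.log n)^2))) ?_ ?_ ?_
      (aux_summable.mul_left _)
    · intro n
      by_cases hn : 1 ≤ n
      · simp only [hn, if_true]
        exact (hmem n hn).integrable_sq.mul_const _
      · simp [hn]
    · intro n ω
      split_ifs <;> positivity
    · intro n
      by_cases hn : 1 ≤ n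
      · simp only [hn, if_true]
        rw [integral_mul_const]
        calc _ ≤ 2 * (Q + σ2) * (1 / n) * (1 / (1 + Real.log n)^2) :=
              mul_le_mul_of_nonneg_right (hEe n hn) (by positivity)
          _ = _ := by rw [mul_assoc, one_div_mul_one_div]
      · have : n = 0 := by omega
        simp [this]
  filter_upwards [hD, hB, hsum] with ω hDω hBω hSω
  refine aux_det X ω μ σ2 c2 c3 c4 ((|μ| + 1)^2)
    (∑' n : ℕ, if 1 ≤ n then (μ - muHat c4 X n ω)^2 * (1 / (1 + Real.log n)^2) else 0)
    (by positivity) hc2.1 hDω ?_ ?_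
  · intro i hi
    have hi0 : (0:ℝ) < i := by exact_mod_cast hi
    have h0 : 0 ≤ ∑ j ∈ Finset.Icc 1 (i-1), X j ω :=
      Finset.sum_nonneg fun j hj => (hBω j (Finset.mem_Icc.1 hj).1).1
    have h1 : ∑ j ∈ Finset.Icc 1 (i-1), X j ω ≤ (i:ℝ) - 1 := by
      have := Finset.sum_le_card_nsmul (Finset.Icc 1 (i-1)) (fun j => X j ω) 1
        fun j hj => (hBω j (Finset.mem_Icc.1 hj).1).2
      simpa [Nat.cast_sub hi] using this
    have hm0 : 0 ≤ muHat c4 X i ω := div_nonneg (by linarith [hc4.1]) hi0.le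
    have hm1 : muHat c4 X i ω ≤ 1 := (div_le_one hi0).2 (by linarith [hc4.2])
    rw [← sq_abs (μ - _)]
    gcongr
    refine (abs_sub _ _).trans ?_
    rw [abs_of_nonneg hm0]
    linarith
  · intro t ht
    have hle := hSω.sum_le_tsum (Finset.Icc 1 (t-1)) (fun n _ => by split_ifs <;> positivity)
    refine le_trans ?_ (mul_le_mul_of_nonneg_right hle (sq_nonneg _))
    rw [Finset.sum_mul]
    refine Finset.sum_le_sum fun i hi => ?_
    obtain ⟨hi1, hi2⟩ := Finset.mem_Icc.1 hi
    have hi1' : (1:ℝ) ≤ i := by exact_mod_cast hi1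
    have hit : (i:ℝ) ≤ t := by exact_mod_cast (by omega)
    have hl0 := Real.log_nonneg hi1'
    have hl := Real.log_le_log (by linarith) hit
    rw [if_pos hi1, mul_assoc]
    refine le_mul_of_one_le_right (sq_nonneg _) ?_
    rw [one_div_mul_eq_div, one_le_div (by positivity)]
    gcongr
end
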